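/- arXiv:2511.02001 — 2 statements merged into one kernel-verified Lean document; each statement's English description precedes it below -/
import Mathlib

section
/- Let k, ℓ, m ∈ ℕ_0 with k + ℓ + m = d. Let S = diag[s_1,…,s_k] with s_1 ≤ … ≤ s_k < 0, let C ∈ ℝ^{ℓ×ℓ} with σ(C) ⊂ iℝ, and let U = diag[u_1,…,u_m] with 0 < u_1 ≤ … ≤ u_m. Given α_S, α_U ∈ ℝ⁺ and α_C ∈ ℝ∖{0}, let Φ, Ψ be the linear flows on ℝ^d generated by A = diag[S, C, U] and B = diag[α_S S, α_C C, α_U U] respectively (blocks present only when the corresponding dimension is ≥ 1). Assume Φ is h-related to Ψ for some h ∈ 𝓗_{1⁻}(ℝ^d) with h(E_S) = E_S, where E_S = span{e_1,…,e_k}. Then: (i) if min{k,m} ≥ 1 then α_S = α_U; (ii) if min{k,ℓ} ≥ 1 and σ(C) ≠ {0}, then α_S = |α_C|; (iii) if min{ℓ,m} ≥ 1 and σ(C) ≠ {0}, then |α_C| = α_U. -/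
noncomputable section
namespace LF

open Filter Topology

/-- `ℝ^d` with the Euclidean norm. -/
abbrev Euc (d : ℕ) := EuclideanSpace ℝ (Fin d)

variable {d : ℕ}

/-- The time-`t` map of the linear flow on `ℝ^d` generated by the matrix `A`,
i.e. `x ↦ exp (t A) x`. -/
def linFlow (A : Matrix (Fin d) (Fin d) ℝ) (t : ℝ) (x : Euc d) : Euc d :=
  Matrix.toEuclideanLin (NormedSpace.exp (t • A)) x

/-- The orbit `{Φ_t x : t ∈ ℝ}` of `x` under the linear flow generated by `A`. -/
def flowOrbit (A : Matrix (Fin d) (Fin d) ℝ) (x : Euc d) : Set (Euc d) :=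
  Set.range fun t : ℝ => linFlow A t x

/-- `Φ` is `h`-related to `Ψ`: the homeomorphism `h` maps every orbit of the flow
generated by `A` onto an orbit of the flow generated by `B`. -/
def IsOrbitEquiv (A B : Matrix (Fin d) (Fin d) ℝ) (h : Euc d ≃ₜ Euc d) : Prop :=
  ∀ x : Euc d, h '' flowOrbit A x = flowOrbit B (h x)

/-- `f` satisfies a `β`-Hölder condition on some ball centred at `0`. -/
def HolderNearZero (β : ℝ) (f : Euc d → Euc d) : Prop :=
  ∃ r > (0 : ℝ), ∃ K : ℝ, ∀ x ∈ Metric.ball (0 : Euc d) r, ∀ y ∈ Metric.ball (0 : Euc d) r,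
    dist (f x) (f y) ≤ K * dist x y ^ β

/-- `h ∈ 𝓗_β`: `h 0 = 0` and `h`, `h⁻¹` both satisfy a `β`-Hölder condition near `0`. -/
def MemHolderClass (β : ℝ) (h : Euc d ≃ₜ Euc d) : Prop :=
  h 0 = 0 ∧ HolderNearZero β ⇑h ∧ HolderNearZero β ⇑h.symm

/-- `h ∈ 𝓗_0`: homeomorphisms fixing `0`. -/
def MemH0 (h : Euc d ≃ₜ Euc d) : Prop := h 0 = 0

/-- `h ∈ 𝓗_{0⁺} = ⋃_{γ>0} 𝓗_γ`. -/
def MemH0plus (h : Euc d ≃ₜ Euc d) : Prop := ∃ γ : ℝ, 0 < γ ∧ MemHolderClass γ h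

/-- `h ∈ 𝓗_{1⁻} = ⋂_{0<γ<1} 𝓗_γ`. -/
def MemH1minus (h : Euc d ≃ₜ Euc d) : Prop := ∀ γ : ℝ, 0 < γ → γ < 1 → MemHolderClass γ h

/-- `h ∈ 𝓗_{β⁻} = ⋂_{0<γ<β} 𝓗_γ`. -/
def MemHBelow (β : ℝ) (h : Euc d ≃ₜ Euc d) : Prop :=
  ∀ γ : ℝ, 0 < γ → γ < β → MemHolderClass γ h

/-- `h ∈ 𝓗_{β⁺} = ⋃_{γ>β} 𝓗_γ`. -/
def MemHAbove (β : ℝ) (h : Euc d ≃ₜ Euc d) : Prop :=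
  ∃ γ : ℝ, β < γ ∧ MemHolderClass γ h

/-- `φ ~^⋆ ψ`: `φ` is `h`-related to `ψ` for some `h` in the class `P`. -/
def RelEquivWith (P : (Euc d ≃ₜ Euc d) → Prop) (A B : Matrix (Fin d) (Fin d) ℝ) : Prop :=
  ∃ h : Euc d ≃ₜ Euc d, P h ∧ IsOrbitEquiv A B h

/-- `φ ≃^⋆ ψ`: there are `h` in the class `P` and `α ≠ 0` with
`h (φ t x) = ψ (α t) (h x)` for all `t`, `x`. -/
def SimEquivWith (P : (Euc d ≃ₜ Euc d) → Prop) (A B : Matrix (Fin d) (Fin d) ℝ) : Prop :=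
  ∃ (h : Euc d ≃ₜ Euc d) (α : ℝ), α ≠ 0 ∧ P h ∧
    ∀ (t : ℝ) (x : Euc d), h (linFlow A t x) = linFlow B (α * t) (h x)

/-- The stable set `X_S^Φ = {x : Φ_t x → 0 as t → ∞}`. -/
def stableSet (A : Matrix (Fin d) (Fin d) ℝ) : Set (Euc d) :=
  {x | Tendsto (fun t : ℝ => linFlow A t x) atTop (𝓝 0)}

/-- The unstable set `X_U^Φ = {x : Φ_t x → 0 as t → -∞}`. -/
def unstableSet (A : Matrix (Fin d) (Fin d) ℝ) : Set (Euc d) :=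
  {x | Tendsto (fun t : ℝ => linFlow A t x) atBot (𝓝 0)}

/-- The central set `X_C^Φ = {x : e^{-ε|t|} Φ_t x → 0 as |t| → ∞, for every ε > 0}`. -/
def centralSet (A : Matrix (Fin d) (Fin d) ℝ) : Set (Euc d) :=
  {x | ∀ ε > (0 : ℝ),
    Tendsto (fun t : ℝ => Real.exp (-(ε * |t|)) • linFlow A t x) (atBot ⊔ atTop) (𝓝 0)}

/-- The stable subspace of the flow generated by `A` (the stable set is a subspace,
so taking its span is innocuous). -/
def XS (A : Matrix (Fin d) (Fin d) ℝ) : Submodule ℝ (Euc d) := Submodule.span ℝ (stableSet A)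

/-- The unstable subspace. -/
def XU (A : Matrix (Fin d) (Fin d) ℝ) : Submodule ℝ (Euc d) := Submodule.span ℝ (unstableSet A)

/-- The central subspace. -/
def XC (A : Matrix (Fin d) (Fin d) ℝ) : Submodule ℝ (Euc d) := Submodule.span ℝ (centralSet A)

/-- The hyperbolic subspace `X_H^Φ = X_S^Φ ⊕ X_U^Φ`. -/
def XH (A : Matrix (Fin d) (Fin d) ℝ) : Submodule ℝ (Euc d) := XS A ⊔ XU A

def dimS (A : Matrix (Fin d) (Fin d) ℝ) : ℕ := Module.finrank ℝ (XS A)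
def dimU (A : Matrix (Fin d) (Fin d) ℝ) : ℕ := Module.finrank ℝ (XU A)
def dimHyp (A : Matrix (Fin d) (Fin d) ℝ) : ℕ := Module.finrank ℝ (XH A)

/-- The central-part generators `A^{Φ_C}` and `α A^{Ψ_C}` are similar, i.e.
`Q A_C = (α B_C) Q` for some linear isomorphism `Q : X_C^Φ → X_C^Ψ`. -/
def IsCentralSimilar (A B : Matrix (Fin d) (Fin d) ℝ) (α : ℝ) : Prop :=
  ∃ (hA : ∀ x ∈ XC A, Matrix.toEuclideanLin A x ∈ XC A)
    (hB : ∀ x ∈ XC B, Matrix.toEuclideanLin B x ∈ XC B)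
    (Q : XC A ≃ₗ[ℝ] XC B),
    ∀ x : XC A, Q ((Matrix.toEuclideanLin A).restrict hA x)
      = α • (Matrix.toEuclideanLin B).restrict hB (Q x)

/-- The forward Lyapunov exponent `λ_+^Φ(x) = lim_{t→∞} log ‖Φ_t x‖ / t`
(the limit exists for `x ≠ 0`, so it equals the `limsup` used here). -/
def lyap (A : Matrix (Fin d) (Fin d) ℝ) (x : Euc d) : ℝ :=
  Filter.limsup (fun t : ℝ => Real.log ‖linFlow A t x‖ / t) atTop

/-- The Lyapunov space `L^Φ(s) = {x : λ_+^Φ(x) ≤ s}` (with `λ_+^Φ(0) = -∞`), as a set. -/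
def lyapSet (A : Matrix (Fin d) (Fin d) ℝ) (s : ℝ) : Set (Euc d) :=
  {x | x = 0 ∨ lyap A x ≤ s}

/-- `ℓ^Φ(s) = dim L^Φ(s)` (the Lyapunov set is a subspace, so taking its span is innocuous). -/
def ell (A : Matrix (Fin d) (Fin d) ℝ) (s : ℝ) : ℕ :=
  Module.finrank ℝ (Submodule.span ℝ (lyapSet A s))

/-- The `(j+1)`-st smallest Lyapunov exponent `λ_{j+1}^Φ`, counted with multiplicity. -/
def lyapExp (A : Matrix (Fin d) (Fin d) ℝ) (j : ℕ) : ℝ :=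
  sInf {s : ℝ | j + 1 ≤ ell A s}

/-- The Lyapunov space at `s` of the restriction of the flow to the invariant set `V`. -/
def lyapSetIn (A : Matrix (Fin d) (Fin d) ℝ) (V : Set (Euc d)) (s : ℝ) : Set (Euc d) :=
  {x | x ∈ V ∧ (x = 0 ∨ lyap A x ≤ s)}

def ellIn (A : Matrix (Fin d) (Fin d) ℝ) (V : Set (Euc d)) (s : ℝ) : ℕ :=
  Module.finrank ℝ (Submodule.span ℝ (lyapSetIn A V s))

/-- The `(j+1)`-st smallest Lyapunov exponent of the flow restricted to `V`. -/
def lyapExpIn (A : Matrix (Fin d) (Fin d) ℝ) (V : Set (Euc d)) (j : ℕ) : ℝ :=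
  sInf {s : ℝ | j + 1 ≤ ellIn A V s}

/-- `λ_{j+1}^{Φ_H}`: the `(j+1)`-st smallest Lyapunov exponent of the restriction
of the flow to the hyperbolic subspace. -/
def lyapExpH (A : Matrix (Fin d) (Fin d) ℝ) (j : ℕ) : ℝ :=
  lyapExpIn A (XH A) j

/-- The flow generated by `A` is stable: every orbit tends to `0` as `t → ∞`. -/
def IsStable (A : Matrix (Fin d) (Fin d) ℝ) : Prop := ∀ x : Euc d, x ∈ stableSet A

/-- The flow generated by `A` is unstable: every orbit tends to `0` as `t → -∞`. -/
def IsUnstable (A : Matrix (Fin d) (Fin d) ℝ) : Prop := ∀ x : Euc d, x ∈ unstableSet A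

/-- The flow generated by `A` is hyperbolic: `X = X_S ⊕ X_U`. -/
def IsHyperbolic (A : Matrix (Fin d) (Fin d) ℝ) : Prop := IsCompl (XS A) (XU A)

/-- `ρ_+(Φ,Ψ) = (min_j λ_j^Φ/λ_j^Ψ) / |max_j λ_j^Φ/λ_j^Ψ|`. -/
def rhoPlus (A B : Matrix (Fin d) (Fin d) ℝ) : ℝ :=
  (⨅ j : Fin d, lyapExp A j / lyapExp B j) / |⨆ j : Fin d, lyapExp A j / lyapExp B j|

/-- The Lyapunov cross ratio `ρ(Φ,Ψ) = max {ρ_+(Φ,Ψ), ρ_+(Φ*,Ψ)}`, where `Φ*` is the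
time-reversal of `Φ`, generated by `-A`. -/
def rho (A B : Matrix (Fin d) (Fin d) ℝ) : ℝ := max (rhoPlus A B) (rhoPlus (-A) B)

/-- The minimal period `T_x^Φ = inf {t > 0 : Φ_t x = x} ∈ [0,∞]` (with `inf ∅ = ∞`). -/
def minPeriod (A : Matrix (Fin d) (Fin d) ℝ) (x : Euc d) : EReal :=
  sInf {T : EReal | ∃ t : ℝ, 0 < t ∧ linFlow A t x = x ∧ T = (t : EReal)}

/-- The set of complex eigenvalues of the real matrix `A`. -/
def cSpec {n : ℕ} (A : Matrix (Fin n) (Fin n) ℝ) : Set ℂ :=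
  spectrum ℂ (A.map Complex.ofReal)

/-- `x` is a fixed point of the flow generated by `A`. -/
def IsFixedPt (A : Matrix (Fin d) (Fin d) ℝ) (x : Euc d) : Prop :=
  ∀ t : ℝ, linFlow A t x = x

/-- The nilpotent `m × m` Jordan block `J_m` (ones on the superdiagonal). -/
def jordanNil (m : ℕ) : Matrix (Fin m) (Fin m) ℝ :=
  Matrix.of fun i j => if (i : ℕ) + 1 = (j : ℕ) then 1 else 0

def tripEquiv (k l m d : ℕ) (h : k + l + m = d) : (Fin k ⊕ (Fin l ⊕ Fin m)) ≃ Fin d :=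
  ((Equiv.refl (Fin k)).sumCongr finSumFinEquiv).trans (finSumFinEquiv.trans (finCongr (by omega)))

/-- The block-diagonal matrix `diag [S, C, U]` of size `d = k + l + m`. -/
def tripMat (k l m d : ℕ) (h : k + l + m = d) (S : Matrix (Fin k) (Fin k) ℝ)
    (C : Matrix (Fin l) (Fin l) ℝ) (U : Matrix (Fin m) (Fin m) ℝ) :
    Matrix (Fin d) (Fin d) ℝ :=
  Matrix.reindex (tripEquiv k l m d h) (tripEquiv k l m d h)
    (Matrix.fromBlocks S 0 0 (Matrix.fromBlocks C 0 0 U))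

/-- `E_S = span {e_1, …, e_k}`, the span of the first `k` coordinate vectors. -/
def spanES (k : ℕ) : Set (Euc d) := {x : Euc d | ∀ j : Fin d, k ≤ (j : ℕ) → x j = 0}

/-! ### Exponentials of bounded operators -/

section ExpLemmas
variable {E F : Type*} [NormedAddCommGroup E] [NormedSpace ℝ E] [CompleteSpace E]
  [NormedAddCommGroup F] [NormedSpace ℝ F] [CompleteSpace F]

/-- The flow `exp (t A)` of a bounded operator. -/
def flw (A : E →L[ℝ] E) (t : ℝ) : E →L[ℝ] E := NormedSpace.exp (t • A)

lemma exp_hasSum (A : E →L[ℝ] E) (x : E) :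
    HasSum (fun n : ℕ => ((n.factorial : ℝ)⁻¹) • (A ^ n) x) (NormedSpace.exp A x) := by
  have h := NormedSpace.exp_series_hasSum_exp' (𝕂 := ℝ) A
  exact h.mapL (ContinuousLinearMap.apply ℝ E x)

lemma pow_intertwine (A : E →L[ℝ] E) (B : F →L[ℝ] F) (f : E →L[ℝ] F)
    (hf : ∀ x, f (A x) = B (f x)) (n : ℕ) (x : E) : f ((A ^ n) x) = (B ^ n) (f x) := by
  induction n generalizing x with
  | zero => simp
  | succ n ih => rw [pow_succ, pow_succ]; exact (ih (A x)).trans (by rw [hf]; rfl)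

lemma flw_intertwine (A : E →L[ℝ] E) (B : F →L[ℝ] F) (f : E →L[ℝ] F)
    (hf : ∀ x, f (A x) = B (f x)) (t : ℝ) (x : E) : f (flw A t x) = flw B t (f x) := by
  have h1 := (exp_hasSum (t • A) x).mapL f
  have h2 := exp_hasSum (t • B) (f x)
  refine h1.unique ?_
  change HasSum _ (NormedSpace.exp (t • B) (f x))
  convert h2 using 2 with n
  rw [map_smul, pow_intertwine (t • A) (t • B) f (by intro y; simp [hf])]

lemma flw_zero (A : E →L[ℝ] E) (x : E) : flw A 0 x = x := by simp [flw]

lemma flw_add (A : E →L[ℝ] E) (s t : ℝ) (x : E) : flw A (s + t) x = flw A s (flw A t x) := by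
  let _ : NormedAlgebra ℚ (E →L[ℝ] E) := NormedAlgebra.restrictScalars ℚ ℝ _
  have : Commute (s • A) (t • A) := ((Commute.refl A).smul_left s).smul_right t
  simp only [flw, add_smul]
  rw [NormedSpace.exp_add_of_commute this]
  rfl

lemma flw_continuous (A : E →L[ℝ] E) : Continuous (flw A) := by
  let _ : NormedAlgebra ℚ (E →L[ℝ] E) := NormedAlgebra.restrictScalars ℚ ℝ _
  exact NormedSpace.exp_continuous.comp (by fun_prop)

lemma flw_hasDerivAt (A : E →L[ℝ] E) (x : E) (t : ℝ) :
    HasDerivAt (fun t => flw A t x) (flw A t (A x)) t := by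
  have h := hasDerivAt_exp_smul_const (𝕂 := ℝ) A t
  have := h.clm_apply (hasDerivAt_const t x)
  simpa [flw] using this

end ExpLemmas

section Cplx
variable {W : Type*} [NormedAddCommGroup W] [NormedSpace ℂ W] [FiniteDimensional ℂ W]

lemma flw_eigen [CompleteSpace W] (A : W →L[ℝ] W) (v : W) (μ : ℂ) (hv : A v = μ • v)
    (hA : ∀ (z : ℂ) w, A (z • w) = z • A w) (t : ℝ) :
    flw A t v = Complex.exp (t * μ) • v := by
  have h1 := exp_hasSum (t • A) v
  have hp : ∀ n : ℕ, ((t • A) ^ n) v = ((t * μ) ^ n : ℂ) • v := by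
    intro n
    induction n with
    | zero => simp
    | succ n ih =>
      rw [pow_succ', mul_apply_eq_comp, ih]
      simp only [smul_apply, hA, hv]
      rw [← Complex.coe_smul, smul_smul, smul_smul, pow_succ]
      congr 1; ring
  have h2 := NormedSpace.exp_series_hasSum_exp' (𝕂 := ℂ) ((t : ℂ) * μ)
  have h3 := h2.smul_const v
  rw [← Complex.exp_eq_exp_ℂ] at h3
  refine h1.unique ?_
  convert h3 using 2 with n
  rw [hp, ← Complex.coe_smul, smul_smul]
  simp

/-- A nonzero vector can be moved to an eigenvector by a polynomial in `M`. -/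
lemma exists_poly_eigen (M : W →ₗ[ℂ] W) (z : W) (hz : z ≠ 0) :
    ∃ (q : Polynomial ℂ) (μ : ℂ), Polynomial.aeval M q z ≠ 0 ∧
      M (Polynomial.aeval M q z) = μ • Polynomial.aeval M q z := by
  let f : Polynomial ℂ →ₗ[ℂ] W := (LinearMap.applyₗ z).comp (Polynomial.aeval M).toLinearMap
  have hf : ∀ q, f q = Polynomial.aeval M q z := fun q => rfl
  let R := LinearMap.range f
  have hR : ∀ x ∈ R, M x ∈ R := by
    rintro _ ⟨q, rfl⟩
    exact ⟨Polynomial.X * q, by simp [hf]⟩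
  have hzR : z ∈ R := ⟨1, by simp [hf]⟩
  have : Nontrivial R := ⟨⟨⟨z, hzR⟩, 0, by simpa using hz⟩⟩
  obtain ⟨μ, hμ⟩ := Module.End.exists_eigenvalue (M.restrict hR)
  obtain ⟨v, hv⟩ := hμ.exists_hasEigenvector
  obtain ⟨q, hq⟩ := v.2
  refine ⟨q, μ, ?_, ?_⟩
  · rw [← hf, hq]; simpa using hv.2
  · rw [← hf, hq]
    have := congrArg Subtype.val hv.apply_eq_smul
    simpa using this

lemma poly_commute (M : W →ₗ[ℂ] W) (q : Polynomial ℂ) : Commute (Polynomial.aeval M q) M := by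
  have h : Commute q Polynomial.X := mul_comm _ _
  simpa using h.map (Polynomial.aeval M)

lemma poly_comm [CompleteSpace W] (A : W →L[ℝ] W) (M : W →ₗ[ℂ] W) (hAM : ∀ w, A w = M w)
    (q : Polynomial ℂ) : ∃ Q : W →L[ℝ] W, (∀ w, Q w = Polynomial.aeval M q w) ∧
      ∀ t w, Q (flw A t w) = flw A t (Q w) := by
  let Q : W →L[ℝ] W := (LinearMap.toContinuousLinearMap (Polynomial.aeval M q)).restrictScalars ℝ
  refine ⟨Q, fun w => rfl, fun t w => flw_intertwine A A Q (fun x => ?_) t w⟩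
  change Polynomial.aeval M q (A x) = A (Polynomial.aeval M q x)
  rw [hAM, hAM]
  have : Commute (Polynomial.aeval M q) M := poly_commute M q
  exact congrArg (fun g => g x) this.eq

/-- C2: orbits of nonzero vectors stay away from `0`. -/
lemma cplx_lower [CompleteSpace W] (A : W →L[ℝ] W) (M : W →ₗ[ℂ] W) (hAM : ∀ w, A w = M w)
    (him : ∀ μ, Module.End.HasEigenvalue M μ → μ.re = 0) (z : W) (hz : z ≠ 0) :
    ∃ c > 0, ∀ t, c ≤ ‖flw A t z‖ := by
  obtain ⟨q, μ, h0, h1⟩ := exists_poly_eigen M z hz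
  obtain ⟨Q, hQ, hQc⟩ := poly_comm A M hAM q
  rw [← hQ] at h0 h1
  have hμ := him μ (Module.End.hasEigenvalue_of_hasEigenvector
    (Module.End.hasEigenvector_iff.mpr ⟨Module.End.mem_eigenspace_iff.mpr h1, h0⟩))
  have hQ0 : 0 < ‖Q z‖ := norm_pos_iff.mpr h0
  have hQn : 0 < ‖Q‖ := by
    rcases (norm_nonneg Q).eq_or_lt with h | h
    · have := Q.le_opNorm z
      rw [← h] at this; simp at this; exact absurd this h0
    · exact h
  refine ⟨‖Q z‖ / ‖Q‖, by positivity, fun t => ?_⟩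
  rw [div_le_iff₀ hQn, mul_comm]
  calc ‖Q z‖ = ‖flw A t (Q z)‖ := by
        rw [flw_eigen A (Q z) μ (by rw [hAM, h1]) (by intro z w; simp [hAM]), norm_smul,
          Complex.norm_exp]
        simp [hμ]
    _ = ‖Q (flw A t z)‖ := by rw [hQc]
    _ ≤ _ := Q.le_opNorm _

/-- C3: nontrivial periods are bounded below. -/
lemma cplx_period [CompleteSpace W] (A : W →L[ℝ] W) (M : W →ₗ[ℂ] W) (hAM : ∀ w, A w = M w)
    (Ω : ℝ) (hΩ : 0 < Ω) (him : ∀ μ, Module.End.HasEigenvalue M μ → ‖μ‖ ≤ Ω) (y : W) (σ : ℝ)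
    (hσ : 0 < σ) (hσ' : σ < 2 * Real.pi / Ω) (hy : flw A σ y = y) (t : ℝ) : flw A t y = y := by
  have hMz : M y = 0 := by
    by_contra hz
    obtain ⟨q, μ, h0, h1⟩ := exists_poly_eigen M (M y) hz
    obtain ⟨Q, hQ, hQc⟩ := poly_comm A M hAM q
    rw [← hQ] at h0 h1
    have hμ := him μ (Module.End.hasEigenvalue_of_hasEigenvector
      (Module.End.hasEigenvector_iff.mpr ⟨Module.End.mem_eigenspace_iff.mpr h1, h0⟩))
    have hAc : ∀ t w, A (flw A t w) = flw A t (A w) := flw_intertwine A A A (fun _ => rfl)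
    have hfix : flw A σ (Q (M y)) = Q (M y) := by
      rw [← hQc, ← hAM, ← hAc, hy]
    rw [flw_eigen A (Q (M y)) μ (by rw [hAM, h1]) (by intro z w; simp [hAM])] at hfix
    have he : Complex.exp (σ * μ) = 1 := by
      have : (Complex.exp (σ * μ) - 1) • Q (M y) = 0 := by rw [sub_smul, hfix]; simp
      rcases smul_eq_zero.mp this with h | h
      · exact sub_eq_zero.mp h
      · exact absurd h h0
    obtain ⟨n, hn⟩ := Complex.exp_eq_one_iff.mp he
    have hnorm : σ * ‖μ‖ = |(n : ℝ)| * (2 * Real.pi) := by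
      have := congrArg norm hn
      simpa [abs_of_pos hσ, abs_of_pos Real.pi_pos] using this
    have hlt : σ * ‖μ‖ < 2 * Real.pi := by
      calc σ * ‖μ‖ ≤ σ * Ω := by gcongr
        _ < 2 * Real.pi := by rwa [lt_div_iff₀ hΩ] at hσ'
    have hn0 : n = 0 := by
      by_contra hne
      have : (1 : ℝ) ≤ |(n : ℝ)| := by exact_mod_cast Int.one_le_abs hne
      nlinarith [Real.pi_pos]
    have hμ0 : μ = 0 := by
      rw [hn0] at hn
      have : (σ : ℂ) ≠ 0 := by exact_mod_cast hσ.ne'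
      simpa [this] using hn
    -- now `Q y` moves along a line
    have hQM : M (Q y) = Q (M y) := by
      rw [hQ, hQ]
      have : Commute (Polynomial.aeval M q) M := poly_commute M q
      exact (congrArg (fun g => g y) this.eq).symm
    have hconst : ∀ t, flw A t (Q (M y)) = Q (M y) := by
      intro t
      rw [flw_eigen A (Q (M y)) μ (by rw [hAM, h1]) (by intro z w; simp [hAM]), hμ0]; simp
    have hd : ∀ t : ℝ, HasDerivAt (fun t : ℝ => flw A t (Q y) - t • Q (M y)) 0 t := by
      intro t
      have h3 := (flw_hasDerivAt A (Q y) t).sub ((hasDerivAt_id t).smul_const (Q (M y)))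
      rw [hAM, hQM, hconst] at h3
      have h4 : Q (M y) - (1 : ℝ) • Q (M y) = 0 := by simp
      rw [h4] at h3
      exact h3
    have := is_const_of_deriv_eq_zero (fun t => (hd t).differentiableAt) (fun t => (hd t).deriv) σ 0
    have hQy : flw A σ (Q y) = Q y := by rw [← hQc, hy]
    rw [hQy, flw_zero] at this
    have h5 : σ • Q (M y) = 0 := by simpa using this
    rcases smul_eq_zero.mp h5 with h | h
    · exact hσ.ne' h
    · exact h0 h
  have := flw_eigen A y 0 (by rw [hAM, hMz]; simp) (by intro z w; simp [hAM]) t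
  simpa using this

/-- C1: subexponential growth. -/
lemma cplx_growth [CompleteSpace W] (A : W →L[ℝ] W) (M : W →ₗ[ℂ] W) (hAM : ∀ w, A w = M w)
    (him : ∀ μ, Module.End.HasEigenvalue M μ → μ.re = 0) (z : W) :
    ∀ δ > 0, ∃ K, ∀ t, ‖flw A t z‖ ≤ K * Real.exp (δ * |t|) := by
  have hz : z ∈ ⨆ μ, Module.End.maxGenEigenspace M μ := by
    rw [Module.End.iSup_maxGenEigenspace_eq_top]; trivial
  induction hz using Submodule.iSup_induction' with
  | zero => intro δ _; exact ⟨0, by simp⟩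
  | add x y _ _ hx hy =>
    intro δ hδ
    obtain ⟨K, hK⟩ := hx δ hδ
    obtain ⟨K', hK'⟩ := hy δ hδ
    refine ⟨K + K', fun t => ?_⟩
    rw [map_add, add_mul]
    exact (norm_add_le _ _).trans (add_le_add (hK t) (hK' t))
  | mem μ x hx =>
    obtain ⟨n, hn⟩ := (Module.End.mem_maxGenEigenspace M μ x).mp hx
    induction n generalizing x with
    | zero => intro δ _; refine ⟨0, ?_⟩; simp at hn; simp [hn]
    | succ n ih =>
      by_cases hx0 : x = 0
      · intro δ _; exact ⟨0, by simp [hx0]⟩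
      have hμ : μ.re = 0 := by
        refine him μ ?_
        have : Module.End.genEigenspace M μ ⊤ ≠ ⊥ := by
          intro h; exact hx0 (by have h2 := hx; rw [Module.End.maxGenEigenspace, h] at h2; simpa using h2)
        exact Module.End.HasUnifEigenvalue.lt zero_lt_one this
      intro δ hδ
      set x' := M x - μ • x with hx'
      have hx'n : ((M - μ • 1) ^ n) x' = 0 := by
        rw [pow_succ] at hn
        simpa [hx'] using hn
      obtain ⟨K, hK⟩ := ih x' ((Module.End.mem_maxGenEigenspace M μ x').mpr ⟨n, hx'n⟩) hx'n
        (δ / 2) (by positivity)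
      -- differentiate `exp(-μ t) exp(tA) x`
      let f : ℝ → W := fun t => Complex.exp (-(μ * t)) • flw A t x
      have hAs : ∀ (z : ℂ) (w : W), A (z • w) = z • A w := by intro z w; simp [hAM]
      have hfs : ∀ t (z : ℂ) (w : W), flw A t (z • w) = z • flw A t w := by
        intro t z w
        let Z : W →L[ℝ] W := (z • ContinuousLinearMap.id ℂ W).restrictScalars ℝ
        exact (flw_intertwine A A Z (fun w => (hAs z w).symm) t w).symm
      have hnexp : ∀ t : ℝ, ‖Complex.exp (-(μ * t))‖ = 1 := by
        intro t; rw [Complex.norm_exp]; simp [hμ]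
      have hfd : ∀ t : ℝ, HasDerivAt f (Complex.exp (-(μ * t)) • flw A t x') t := by
        intro t
        have h1 : HasDerivAt (fun t : ℝ => Complex.exp (-(μ * t)))
            (Complex.exp (-(μ * t)) * (-(μ * 1))) t :=
          (((Complex.ofRealCLM.hasDerivAt (x := t)).const_mul μ).neg).cexp
        have h2 := h1.smul (flw_hasDerivAt A x t)
        have h3 : Complex.exp (-(μ * t)) • flw A t x' = Complex.exp (-(μ * t)) • flw A t (A x) +
            (Complex.exp (-(μ * t)) * (-(μ * 1))) • flw A t x := by
          rw [hx', map_sub, hfs, hAM, mul_smul, smul_sub]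
          simp [neg_smul, sub_eq_add_neg]
        rw [h3]
        exact h2
      have hK0 : 0 ≤ K := by simpa using (norm_nonneg _).trans (hK 0)
      refine ⟨‖x‖ + K * (2 / δ), fun t => ?_⟩
      have hb : ∀ s ∈ Set.uIcc 0 t, ‖Complex.exp (-(μ * s)) • flw A s x'‖ ≤
          K * Real.exp (δ / 2 * |t|) := by
        intro s hs
        rw [norm_smul, hnexp, one_mul]
        refine (hK s).trans ?_
        have : |s| ≤ |t| := by simpa using Set.abs_sub_left_of_mem_uIcc hs
        gcongr
      have hmv := (convex_uIcc (0:ℝ) t).norm_image_sub_le_of_norm_hasDerivWithin_le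
        (fun s hs => (hfd s).hasDerivWithinAt) hb Set.left_mem_uIcc Set.right_mem_uIcc
      have hf0 : f 0 = x := by simp [f, flw_zero]
      have hft : ‖f t‖ = ‖flw A t x‖ := by simp only [f]; rw [norm_smul, hnexp, one_mul]
      rw [hf0] at hmv
      have h3 : ‖f t‖ ≤ ‖x‖ + K * Real.exp (δ / 2 * |t|) * |t| := by
        have := norm_sub_norm_le (f t) x
        simp only [sub_zero, Real.norm_eq_abs] at hmv
        linarith
      rw [← hft]
      refine h3.trans ?_
      have he1 : 1 ≤ Real.exp (δ * |t|) := Real.one_le_exp (by positivity)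
      have he2 : |t| ≤ 2 / δ * Real.exp (δ / 2 * |t|) := by
        have := Real.add_one_le_exp (δ / 2 * |t|)
        rw [div_mul_eq_mul_div, le_div_iff₀ hδ]
        linarith
      have he3 : Real.exp (δ * |t|) = Real.exp (δ / 2 * |t|) * Real.exp (δ / 2 * |t|) := by
        rw [← Real.exp_add]; congr 1; ring
      rw [add_mul]
      refine add_le_add (le_mul_of_one_le_right (norm_nonneg _) he1) ?_
      rw [he3]
      calc K * Real.exp (δ / 2 * |t|) * |t|
          ≤ K * Real.exp (δ / 2 * |t|) * (2 / δ * Real.exp (δ / 2 * |t|)) := by gcongr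
        _ = _ := by ring

end Cplx

/-! ### Abstract flows with a stable / central / unstable splitting -/

/-- A linear flow with invariant splitting given by projections. -/
structure Base (F : ℝ → Euc d →L[ℝ] Euc d) (PS PC PU : Euc d →L[ℝ] Euc d) : Prop where
  zero : ∀ x, F 0 x = x
  add : ∀ s t x, F (s + t) x = F s (F t x)
  cont : Continuous F
  sum : ∀ x, PS x + PC x + PU x = x
  commS : ∀ t x, PS (F t x) = F t (PS x)
  commC : ∀ t x, PC (F t x) = F t (PC x)
  commU : ∀ t x, PU (F t x) = F t (PU x)
  SS : ∀ x, PS (PS x) = PS x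
  SC : ∀ x, PS (PC x) = 0
  SU : ∀ x, PS (PU x) = 0
  CS : ∀ x, PC (PS x) = 0
  CC : ∀ x, PC (PC x) = PC x
  CU : ∀ x, PC (PU x) = 0
  US : ∀ x, PU (PS x) = 0
  UC : ∀ x, PU (PC x) = 0
  UU : ∀ x, PU (PU x) = PU x
  funS : ∀ x, PS x ≠ 0 → ∃ (a : Euc d →L[ℝ] ℝ) (ρ : ℝ), ρ < 0 ∧ a x ≠ 0 ∧
    ∀ t y, a (F t y) = Real.exp (ρ * t) * a y
  funU : ∀ x, PU x ≠ 0 → ∃ (a : Euc d →L[ℝ] ℝ) (ρ : ℝ), 0 < ρ ∧ a x ≠ 0 ∧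
    ∀ t y, a (F t y) = Real.exp (ρ * t) * a y
  growth : ∀ δ > 0, ∃ K : ℝ, ∀ x t, ‖F t (PC x)‖ ≤ K * Real.exp (δ * |t|) * ‖PC x‖
  lower : ∀ x, PC x = x → x ≠ 0 → ∃ c > 0, ∀ t, c ≤ ‖F t x‖

/-- The range of `P` has extremal exponent `σ`. -/
structure Rate (F : ℝ → Euc d →L[ℝ] Euc d) (P : Euc d →L[ℝ] Euc d) (σ : ℝ) : Prop where
  bound : ∀ x, ∀ t ≥ 0, ‖F t (P x)‖ ≤ Real.exp (σ * t) * ‖P x‖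
  eig : ∃ e : Euc d, e ≠ 0 ∧ P e = e ∧ ∀ t, F t e = Real.exp (σ * t) • e

/-- `h` maps orbits onto orbits. -/
def OrbRel (F F' : ℝ → Euc d →L[ℝ] Euc d) (h : Euc d ≃ₜ Euc d) : Prop :=
  (∀ x t, ∃ τ, h (F t x) = F' τ (h x)) ∧ (∀ x τ, ∃ t, F' τ (h x) = h (F t x))

lemma Base.rev {F : ℝ → Euc d →L[ℝ] Euc d} {PS PC PU : Euc d →L[ℝ] Euc d}
    (B : Base F PS PC PU) : Base (fun t => F (-t)) PU PC PS where
  zero x := by simpa using B.zero x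
  add s t x := by rw [neg_add]; exact B.add _ _ _
  cont := B.cont.comp continuous_neg
  sum x := by rw [← B.sum x]; simp only [map_add, B.SS, B.SC, B.SU, B.CS, B.CC, B.CU, B.US, B.UC, B.UU]; abel
  commS t x := B.commU _ _
  commC t x := B.commC _ _
  commU t x := B.commS _ _
  SS := B.UU
  SC := B.UC
  SU := B.US
  CS := B.CU
  CC := B.CC
  CU := B.CS
  US := B.SU
  UC := B.SC
  UU := B.SS
  funS x hx := by
    obtain ⟨a, ρ, h1, h2, h3⟩ := B.funU x hx
    refine ⟨a, -ρ, by linarith, h2, fun t y => ?_⟩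
    rw [h3]; congr 2; ring
  funU x hx := by
    obtain ⟨a, ρ, h1, h2, h3⟩ := B.funS x hx
    refine ⟨a, -ρ, by linarith, h2, fun t y => ?_⟩
    rw [h3]; congr 2; ring
  growth δ hδ := by
    obtain ⟨K, hK⟩ := B.growth δ hδ
    exact ⟨K, fun x t => by simpa using hK x (-t)⟩
  lower x hx h0 := by
    obtain ⟨c, hc, h⟩ := B.lower x hx h0
    exact ⟨c, hc, fun t => h (-t)⟩

lemma OrbRel.rev {F F' : ℝ → Euc d →L[ℝ] Euc d} {h : Euc d ≃ₜ Euc d} (H : OrbRel F F' h) :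
    OrbRel (fun t => F (-t)) (fun t => F' (-t)) h := by
  constructor
  · intro x t
    obtain ⟨τ, hτ⟩ := H.1 x (-t)
    exact ⟨-τ, by simpa using hτ⟩
  · intro x t
    obtain ⟨τ, hτ⟩ := H.2 x (-t)
    exact ⟨-τ, by simpa using hτ⟩

lemma OrbRel.symm {F F' : ℝ → Euc d →L[ℝ] Euc d} {h : Euc d ≃ₜ Euc d} (H : OrbRel F F' h) :
    OrbRel F' F h.symm := by
  constructor
  · intro x t
    obtain ⟨τ, hτ⟩ := H.2 (h.symm x) t
    refine ⟨τ, ?_⟩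
    rw [h.apply_symm_apply] at hτ
    rw [hτ, h.symm_apply_apply]
  · intro x t
    obtain ⟨τ, hτ⟩ := H.1 (h.symm x) t
    refine ⟨τ, ?_⟩
    rw [h.apply_symm_apply] at hτ
    rw [← hτ, h.symm_apply_apply]

lemma exp_compare {a b α β : ℝ} (ha : 0 < a) (N : ℕ)
    (H : ∀ n : ℕ, N ≤ n → a * Real.exp (α * n) ≤ b * Real.exp (β * n)) : α ≤ β := by
  by_contra hlt
  push Not at hlt
  have ht : Tendsto (fun n : ℕ => Real.exp ((α - β) * n)) atTop atTop :=
    Real.tendsto_exp_atTop.comp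
      (tendsto_natCast_atTop_atTop.const_mul_atTop (sub_pos.mpr hlt))
  obtain ⟨n, hn1, hn2⟩ := ((ht.eventually_gt_atTop (b / a)).and (eventually_ge_atTop N)).exists
  have := H n hn2
  have e1 : Real.exp (α * n) = Real.exp ((α - β) * n) * Real.exp (β * n) := by
    rw [← Real.exp_add]; congr 1; ring
  rw [e1, ← mul_assoc] at this
  have h2 := le_of_mul_le_mul_right this (Real.exp_pos _)
  rw [div_lt_iff₀ ha] at hn1
  linarith

lemma limit_helper {a c : ℝ} (H : ∀ γ : ℝ, 0 < γ → γ < 1 → a ≤ γ ^ 2 * c) : a ≤ c := by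
  have ht : Tendsto (fun γ : ℝ => γ ^ 2 * c) (𝓝[<] 1) (𝓝 c) := by
    have : Continuous (fun γ : ℝ => γ ^ 2 * c) := by fun_prop
    have h := this.tendsto 1
    simp only [one_pow, one_mul] at h
    exact h.mono_left nhdsWithin_le_nhds
  refine ge_of_tendsto ht ?_
  have h0 : ∀ᶠ γ : ℝ in 𝓝[<] 1, 0 < γ :=
    nhdsWithin_le_nhds (eventually_gt_nhds (by norm_num))
  filter_upwards [h0, self_mem_nhdsWithin] with γ h1 h2
  exact H γ h1 h2

lemma exp_rpow_mul {c x γ : ℝ} (hc : 0 ≤ c) :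
    (Real.exp x * c) ^ γ = Real.exp (γ * x) * c ^ γ := by
  rw [Real.mul_rpow (Real.exp_pos _).le hc, ← Real.exp_mul, mul_comm x γ]

lemma exists_small (e : Euc d) (he : e ≠ 0) (r : ℝ) (hr : 0 < r) :
    ∃ c : ℝ, 0 < c ∧ c • e ≠ 0 ∧ ‖c • e‖ < r := by
  have hn : 0 < ‖e‖ := norm_pos_iff.mpr he
  refine ⟨r / (2 * ‖e‖), by positivity, smul_ne_zero (by positivity) he, ?_⟩
  rw [norm_smul, Real.norm_of_nonneg (by positivity)]
  field_simp
  linarith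

lemma Rate.exists_small {F : ℝ → Euc d →L[ℝ] Euc d} {P : Euc d →L[ℝ] Euc d} {σ : ℝ}
    (R : Rate F P σ) (r : ℝ) (hr : 0 < r) :
    ∃ e : Euc d, e ≠ 0 ∧ P e = e ∧ (∀ t, F t e = Real.exp (σ * t) • e) ∧ ‖e‖ < r := by
  obtain ⟨e, h0, h1, h2⟩ := R.eig
  obtain ⟨c, _, h4, h5⟩ := LF.exists_small e h0 r hr
  exact ⟨c • e, h4, by simp [h1], fun t => by rw [map_smul, h2, smul_comm], h5⟩

set_option maxHeartbeats 1000000 in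
lemma half_rigidity_SU {F F' : ℝ → Euc d →L[ℝ] Euc d} {PS PC PU PS' PC' PU' : Euc d →L[ℝ] Euc d}
    {σ υ σ' υ' : ℝ} (B : Base F PS PC PU) (B' : Base F' PS' PC' PU')
    (RS : Rate F PS σ) (RU : Rate F PU υ) (RS' : Rate F' PS' σ') (RU' : Rate F' PU' υ')
    (hσ : σ < 0) (hυ : 0 < υ) (hσ' : σ' < 0) (hυ' : 0 < υ')
    (h : Euc d ≃ₜ Euc d) (h0 : h 0 = 0)
    (hol : ∀ γ : ℝ, 0 < γ → γ < 1 → HolderNearZero γ ⇑h ∧ HolderNearZero γ ⇑h.symm)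
    (orb : OrbRel F F' h) (hES : ∀ x, PS x = x → PS' (h x) = h x) :
    σ * υ' ≤ σ' * υ := by
  suffices hs : σ * (υ' - σ') ≤ σ' * (υ - σ) by linarith
  refine limit_helper fun γ hγ0 hγ1 => ?_
  obtain ⟨⟨r1, hr1, K1, hK1⟩, r2, hr2, K2, hK2⟩ := hol γ hγ0 hγ1
  obtain ⟨e, he0, hPe, hFe, her⟩ := RS.exists_small (r1 / 2) (by positivity)
  obtain ⟨f, hf0, hPf, hFf, hfr⟩ := RU.exists_small (r1 / 2) (by positivity)
  have hen : 0 < ‖e‖ := norm_pos_iff.mpr he0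
  have hfn : 0 < ‖f‖ := norm_pos_iff.mpr hf0
  set x : ℕ → Euc d := fun n => e + Real.exp (-(υ - σ) * n) • f with hx
  have hq1 : ∀ n : ℕ, Real.exp (-(υ - σ) * n) ≤ 1 := by
    intro n; rw [Real.exp_le_one_iff]
    have : (0 : ℝ) ≤ n := n.cast_nonneg
    nlinarith
  have hxr : ∀ n, x n ∈ Metric.ball (0 : Euc d) r1 := by
    intro n
    rw [mem_ball_zero_iff]
    calc ‖x n‖ ≤ ‖e‖ + ‖Real.exp (-(υ - σ) * n) • f‖ := norm_add_le _ _
      _ ≤ ‖e‖ + 1 * ‖f‖ := by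
          rw [norm_smul, Real.norm_of_nonneg (Real.exp_pos _).le]
          gcongr; exact hq1 n
      _ < r1 := by linarith
  have heb : e ∈ Metric.ball (0 : Euc d) r1 := by rw [mem_ball_zero_iff]; linarith
  set D := |K1| * ‖f‖ ^ γ with hD
  have hD0 : 0 ≤ D := by positivity
  have hdist : ∀ n : ℕ, ‖h (x n) - h e‖ ≤ D * Real.exp (γ * (-(υ - σ) * n)) := by
    intro n
    have h1 := hK1 _ (hxr n) _ heb
    rw [dist_eq_norm, dist_eq_norm] at h1
    have h2 : ‖x n - e‖ = Real.exp (-(υ - σ) * n) * ‖f‖ := by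
      simp [hx, norm_smul]
    rw [h2, exp_rpow_mul hfn.le] at h1
    calc _ ≤ _ := h1
      _ ≤ |K1| * (Real.exp (γ * (-(υ - σ) * n)) * ‖f‖ ^ γ) := by
          gcongr; exact le_abs_self K1
      _ = _ := by rw [hD]; ring
  have hPSe := hES e hPe
  have hPCe : PC' (h e) = 0 := by rw [← hPSe, B'.CS]
  have hPUe : PU' (h e) = 0 := by rw [← hPSe, B'.US]
  obtain ⟨Kg, hKg⟩ := B'.growth υ' hυ'
  have hden : 0 < υ' - σ' := by linarith
  set θ := γ * (υ - σ) / (υ' - σ') with hθ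
  have hθ0 : 0 ≤ θ := div_nonneg (mul_nonneg hγ0.le (by linarith)) hden.le
  have hθe : θ * (υ' - σ') = γ * (υ - σ) := by rw [hθ]; field_simp
  set D2 := ‖PS'‖ * (‖h e‖ + D) + |Kg| * (‖PC'‖ * D) + ‖PU'‖ * D with hD2
  have hD20 : 0 ≤ D2 := by positivity
  have hup : ∀ n : ℕ, ‖F' (θ * n) (h (x n))‖ ≤ D2 * Real.exp (σ' * θ * n) := by
    intro n
    have hn0 : (0 : ℝ) ≤ n := n.cast_nonneg
    have ht0 : 0 ≤ θ * n := by positivity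
    have hqe : Real.exp (υ' * (θ * n)) * Real.exp (γ * (-(υ - σ) * n)) = Real.exp (σ' * θ * n) := by
      rw [← Real.exp_add]; congr 1
      linear_combination (n : ℝ) * hθe
    set q := Real.exp (γ * (-(υ - σ) * n)) with hq
    have hq1 : q ≤ 1 := by
      rw [hq, Real.exp_le_one_iff]
      have : 0 ≤ γ * ((υ - σ) * n) := by
        have : 0 ≤ υ - σ := by linarith
        positivity
      linarith
    have hdq : D * q ≤ D := mul_le_of_le_one_right hD0 hq1
    have hS : ‖PS' (h (x n))‖ ≤ ‖PS'‖ * (‖h e‖ + D) := by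
      refine (PS'.le_opNorm _).trans ?_
      gcongr
      have := norm_add_le (h e) (h (x n) - h e)
      rw [add_sub_cancel] at this
      linarith [hdist n]
    have hC : ‖PC' (h (x n))‖ ≤ ‖PC'‖ * D * q := by
      have : PC' (h (x n)) = PC' (h (x n) - h e) := by rw [map_sub, hPCe, sub_zero]
      rw [this, mul_assoc]
      refine (PC'.le_opNorm _).trans ?_
      gcongr; exact hdist n
    have hU : ‖PU' (h (x n))‖ ≤ ‖PU'‖ * D * q := by
      have : PU' (h (x n)) = PU' (h (x n) - h e) := by rw [map_sub, hPUe, sub_zero]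
      rw [this, mul_assoc]
      refine (PU'.le_opNorm _).trans ?_
      gcongr; exact hdist n
    have e1 := RS'.bound (h (x n)) (θ * n) ht0
    have e2 := hKg (h (x n)) (θ * n)
    have e3 := RU'.bound (h (x n)) (θ * n) ht0
    rw [abs_of_nonneg ht0] at e2
    rw [← mul_assoc] at e1
    have e1' : ‖F' (θ * n) (PS' (h (x n)))‖ ≤ Real.exp (σ' * θ * n) * (‖PS'‖ * (‖h e‖ + D)) :=
      e1.trans (by gcongr)
    have e2' : ‖F' (θ * n) (PC' (h (x n)))‖ ≤ |Kg| * (‖PC'‖ * D) * Real.exp (σ' * θ * n) := by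
      calc _ ≤ _ := e2
        _ ≤ |Kg| * Real.exp (υ' * (θ * n)) * (‖PC'‖ * D * q) := by
            gcongr; exact le_abs_self Kg
        _ = |Kg| * (‖PC'‖ * D) * (Real.exp (υ' * (θ * n)) * q) := by ring
        _ = _ := by rw [hqe]
    have e3' : ‖F' (θ * n) (PU' (h (x n)))‖ ≤ ‖PU'‖ * D * Real.exp (σ' * θ * n) := by
      calc _ ≤ _ := e3
        _ ≤ Real.exp (υ' * (θ * n)) * (‖PU'‖ * D * q) := by gcongr
        _ = ‖PU'‖ * D * (Real.exp (υ' * (θ * n)) * q) := by ring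
        _ = _ := by rw [hqe]
    have e4 : F' (θ * n) (h (x n)) = F' (θ * n) (PS' (h (x n))) + F' (θ * n) (PC' (h (x n)))
        + F' (θ * n) (PU' (h (x n))) := by rw [← map_add, ← map_add, B'.sum]
    rw [e4]
    refine (norm_add₃_le).trans ?_
    rw [hD2]; linarith
  by_cases hcase : σ' * θ < 0
  swap
  · -- degenerate: cannot happen
    exfalso
    have : 0 < θ := div_pos (mul_pos hγ0 (by linarith)) hden
    exact hcase (mul_neg_of_neg_of_pos hσ' this)
  have htend : Tendsto (fun n : ℕ => D2 * Real.exp (σ' * θ * n)) atTop (𝓝 0) := by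
    have : Tendsto (fun n : ℕ => σ' * θ * (n : ℝ)) atTop atBot :=
      tendsto_natCast_atTop_atTop.const_mul_atTop_of_neg hcase
    simpa using (Real.tendsto_exp_atBot.comp this).const_mul D2
  obtain ⟨N, hN⟩ := eventually_atTop.mp (htend.eventually_lt_const hr2)
  have hmin : 0 < min ‖e‖ ‖f‖ := lt_min hen hfn
  have key : ∀ n : ℕ, N ≤ n → min ‖e‖ ‖f‖ * Real.exp (σ * n) ≤
      ((‖PS‖ + ‖PU‖) * (|K2| * D2 ^ γ)) * Real.exp (γ * (σ' * θ) * n) := by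
    intro n hn
    obtain ⟨s, hs⟩ := orb.2 (x n) (θ * n)
    have hw : h (F s (x n)) ∈ Metric.ball (0 : Euc d) r2 := by
      rw [mem_ball_zero_iff, ← hs]; exact (hup n).trans_lt (hN n hn)
    have h1 := hK2 _ hw 0 (by simpa using hr2)
    rw [h.symm_apply_apply, ← h0, h.symm_apply_apply, h0, dist_zero_right, dist_zero_right, ← hs] at h1
    have h2 : ‖F s (x n)‖ ≤ |K2| * D2 ^ γ * Real.exp (γ * (σ' * θ) * n) := by
      calc _ ≤ _ := h1
        _ ≤ |K2| * (Real.exp (σ' * θ * n) * D2) ^ γ := by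
            gcongr
            · exact le_abs_self K2
            · exact (hup n).trans_eq (mul_comm _ _)
        _ = _ := by rw [exp_rpow_mul hD20, ← mul_assoc γ]; ring
    have h3 : min ‖e‖ ‖f‖ * Real.exp (σ * n) ≤ (‖PS‖ + ‖PU‖) * ‖F s (x n)‖ := by
      have hFx : F s (x n) = Real.exp (σ * s) • e + Real.exp (υ * s - (υ - σ) * n) • f := by
        simp only [hx, map_add, map_smul, hFe, hFf, smul_smul, ← Real.exp_add]
        congr 3; ring
      have hPUe : PU e = 0 := by rw [← hPe, B.US]
      have hPSf : PS f = 0 := by rw [← hPf, B.SU]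
      rcases le_total s n with hsn | hsn
      · have hp : PS (F s (x n)) = Real.exp (σ * s) • e := by
          rw [hFx]; simp [hPe, hPSf]
        have hb := PS.le_opNorm (F s (x n))
        rw [hp, norm_smul, Real.norm_of_nonneg (Real.exp_pos _).le] at hb
        calc min ‖e‖ ‖f‖ * Real.exp (σ * n) ≤ ‖e‖ * Real.exp (σ * s) := by
              have e1 : Real.exp (σ * n) ≤ Real.exp (σ * s) := Real.exp_le_exp.mpr (by nlinarith)
              exact mul_le_mul (min_le_left _ _) e1 (Real.exp_pos _).le (norm_nonneg _)
          _ ≤ ‖PS‖ * ‖F s (x n)‖ := by linarith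
          _ ≤ _ := by gcongr; linarith [norm_nonneg PU]
      · have hp : PU (F s (x n)) = Real.exp (υ * s - (υ - σ) * n) • f := by
          rw [hFx]; simp [hPf, hPUe]
        have hb := PU.le_opNorm (F s (x n))
        rw [hp, norm_smul, Real.norm_of_nonneg (Real.exp_pos _).le] at hb
        calc min ‖e‖ ‖f‖ * Real.exp (σ * n) ≤ ‖f‖ * Real.exp (υ * s - (υ - σ) * n) := by
              have e1 : Real.exp (σ * n) ≤ Real.exp (υ * s - (υ - σ) * n) :=
                Real.exp_le_exp.mpr (by nlinarith)
              exact mul_le_mul (min_le_right _ _) e1 (Real.exp_pos _).le (norm_nonneg _)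
          _ ≤ ‖PU‖ * ‖F s (x n)‖ := by linarith
          _ ≤ _ := by gcongr; linarith [norm_nonneg PS]
    calc _ ≤ _ := h3
      _ ≤ (‖PS‖ + ‖PU‖) * (|K2| * D2 ^ γ * Real.exp (γ * (σ' * θ) * n)) := by gcongr
      _ = _ := by ring
  have hfin := exp_compare hmin N key
  calc σ * (υ' - σ') ≤ γ * (σ' * θ) * (υ' - σ') := by gcongr
    _ = γ * σ' * (θ * (υ' - σ')) := by ring
    _ = _ := by rw [hθe]; ring

lemma exp_unbounded {ρ c M t1 : ℝ} (hρ : 0 < ρ) (hc : c ≠ 0)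
    (H : ∀ t, t1 ≤ t → |Real.exp (ρ * t) * c| ≤ M) : False := by
  have ht : Tendsto (fun t : ℝ => Real.exp (ρ * t)) atTop atTop :=
    Real.tendsto_exp_atTop.comp (tendsto_id.const_mul_atTop hρ)
  obtain ⟨t, h1, h2⟩ := ((ht.eventually_gt_atTop (M / |c|)).and (eventually_ge_atTop t1)).exists
  have := H t h2
  rw [abs_mul, abs_of_pos (Real.exp_pos _)] at this
  rw [div_lt_iff₀ (abs_pos.mpr hc)] at h1
  linarith

lemma Base.PU_zero {F : ℝ → Euc d →L[ℝ] Euc d} {PS PC PU : Euc d →L[ℝ] Euc d}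
    (B : Base F PS PC PU) {y : Euc d} {t1 M : ℝ} (H : ∀ t, t1 ≤ t → ‖F t y‖ ≤ M) : PU y = 0 := by
  by_contra hy
  obtain ⟨a, ρ, hρ, ha, hF⟩ := B.funU y hy
  refine exp_unbounded (t1 := t1) (M := ‖a‖ * M) hρ ha fun t ht => ?_
  rw [← hF, ← Real.norm_eq_abs]
  refine (a.le_opNorm _).trans ?_
  have := H t ht
  gcongr

lemma Base.PS_zero {F : ℝ → Euc d →L[ℝ] Euc d} {PS PC PU : Euc d →L[ℝ] Euc d}
    (B : Base F PS PC PU) {y : Euc d} {t1 M : ℝ} (H : ∀ t, t ≤ t1 → ‖F t y‖ ≤ M) : PS y = 0 :=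
  B.rev.PU_zero (t1 := -t1) (M := M) fun t ht => H (-t) (by linarith)

lemma Base.jcont {F : ℝ → Euc d →L[ℝ] Euc d} {PS PC PU : Euc d →L[ℝ] Euc d}
    (B : Base F PS PC PU) : Continuous fun p : ℝ × Euc d => F p.1 p.2 :=
  (B.cont.comp continuous_fst).clm_apply continuous_snd

lemma Base.tcont {F : ℝ → Euc d →L[ℝ] Euc d} {PS PC PU : Euc d →L[ℝ] Euc d}
    (B : Base F PS PC PU) (x : Euc d) : Continuous fun t : ℝ => F t x :=
  B.cont.clm_apply continuous_const

/-- The time change along an orbit. -/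
lemma time_change {F F' : ℝ → Euc d →L[ℝ] Euc d} {PS PC PU : Euc d →L[ℝ] Euc d}
    (B : Base F PS PC PU)
    (h : Euc d ≃ₜ Euc d) (orb : OrbRel F F' h) (x : Euc d) (hx : PS x ≠ 0)
    (a : Euc d →L[ℝ] ℝ) (ρ : ℝ) (hρ : ρ ≠ 0) (ha : a (h x) ≠ 0)
    (haF : ∀ t y, a (F' t y) = Real.exp (ρ * t) * a y) :
    ∃ τ : ℝ → ℝ, (∀ t, h (F t x) = F' (τ t) (h x)) ∧ (StrictMono τ ∨ StrictAnti τ) ∧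
      Function.Surjective τ := by
  choose τ hτ using orb.1 x
  obtain ⟨a0, ρ0, hρ0, ha0, haF0⟩ := B.funS x hx
  have hform : ∀ t, Real.exp (ρ * τ t) = a (h (F t x)) / a (h x) := by
    intro t; rw [hτ, haF, mul_div_cancel_right₀ _ ha]
  have hform2 : τ = fun t => Real.log (a (h (F t x)) / a (h x)) / ρ := by
    funext t; rw [← hform, Real.log_exp, mul_div_cancel_left₀ _ hρ]
  have hcont : Continuous τ := by
    rw [hform2]
    refine Continuous.div_const (Continuous.log ?_ ?_) _
    · exact (a.continuous.comp (h.continuous.comp (B.tcont x))).div_const _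
    · intro t; rw [← hform]; exact (Real.exp_pos _).ne'
  have hinj : Function.Injective τ := by
    intro s t hst
    have e1 : F s x = F t x := h.injective (by rw [hτ, hτ, hst])
    have e2 : Real.exp (ρ0 * s) = Real.exp (ρ0 * t) := by
      have := congrArg a0 e1
      rw [haF0, haF0] at this
      exact mul_right_cancel₀ ha0 this
    exact mul_left_cancel₀ hρ0.ne (Real.exp_injective e2)
  refine ⟨τ, hτ, hcont.strictMono_of_inj hinj, fun L => ?_⟩
  obtain ⟨t, ht⟩ := orb.2 x L
  refine ⟨t, ?_⟩
  rw [hτ] at ht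
  have := congrArg a ht
  rw [haF, haF] at this
  exact (mul_left_cancel₀ hρ (Real.exp_injective (mul_right_cancel₀ ha this))).symm

lemma gap_lemma {F : ℝ → Euc d →L[ℝ] Euc d} {PS PC PU : Euc d →L[ℝ] Euc d}
    (B : Base F PS PC PU) (w y0 y1 : Euc d) (a b c : ℕ → ℝ) (T D : ℝ) (hD : D < T)
    (hab : ∀ n, a n ≤ b n) (hbc : ∀ n, b n ≤ c n)
    (ha : Tendsto (fun n => F (a n) w) atTop (𝓝 y0))
    (hb : Tendsto (fun n => F (b n) w) atTop (𝓝 y1))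
    (hc : Tendsto (fun n => F (c n) w) atTop (𝓝 y0))
    (hne : y1 ≠ y0) (hper : ∀ s, 0 < s → s < T → F s y0 ≠ y0) :
    ∀ᶠ n in atTop, D ≤ c n - a n := by
  by_contra hcon
  rw [not_eventually] at hcon
  have hfr : ∃ᶠ n in atTop, c n - a n ∈ Set.Icc 0 D := by
    refine hcon.mono fun n hn => ⟨by linarith [hab n, hbc n], ?_⟩
    push Not at hn; exact hn.le
  obtain ⟨s, hs, φ, hφ, hlim⟩ := isCompact_Icc.tendsto_subseq' hfr
  have key : ∀ (e : ℕ → ℝ) (s' : ℝ) (y : Euc d), Tendsto (fun n => F (e n) w) atTop (𝓝 y) →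
      Tendsto (fun n => e (φ n) - a (φ n)) atTop (𝓝 s') → F s' y0 = y := by
    intro e s' y h1 h2
    have h3 : Tendsto (fun n => F (e (φ n) - a (φ n)) (F (a (φ n)) w)) atTop (𝓝 (F s' y0)) :=
      (B.jcont.tendsto (s', y0)).comp (h2.prodMk_nhds (ha.comp hφ.tendsto_atTop))
    have h4 : (fun n => F (e (φ n) - a (φ n)) (F (a (φ n)) w)) = (fun n => F (e n) w) ∘ φ := by
      funext n; rw [← B.add]; simp
    rw [h4] at h3
    exact tendsto_nhds_unique h3 (h1.comp hφ.tendsto_atTop)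
  have h1 := key c s y0 hc hlim
  have hs0 : s = 0 := by
    by_contra hne0
    exact hper s (lt_of_le_of_ne hs.1 (Ne.symm hne0)) (hs.2.trans_lt hD) h1
  subst hs0
  have h2 := key b 0 y1 hb (squeeze_zero (fun n => by linarith [hab (φ n)])
    (fun n => by simp only [Function.comp]; linarith [hbc (φ n)]) hlim)
  rw [B.zero] at h2
  exact hne h2.symm

lemma limit_orbit {F : ℝ → Euc d →L[ℝ] Euc d} {PS PC PU : Euc d →L[ℝ] Euc d}
    (B : Base F PS PC PU) (z y0 : Euc d) (L : ℕ → ℝ)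
    (hL : Tendsto (fun n => F (L n) z) atTop (𝓝 y0)) (hz : PC z = z) (hy : PC y0 = y0)
    (hcpt : IsCompact (Set.range fun t => F t y0)) : z ∈ Set.range fun t => F t y0 := by
  set Γ := Set.range fun t => F t y0 with hΓ
  obtain ⟨ys, hys, φ, hφ, hlim⟩ := hcpt.tendsto_subseq (x := fun n => F (-L n) y0)
    (fun n => ⟨_, rfl⟩)
  let W : Submodule ℝ (Euc d) := Submodule.span ℝ Γ
  have : CompleteSpace W := FiniteDimensional.complete ℝ W
  have hbd : ∀ v : W, ∃ M, ∀ t, ‖((F t).comp W.subtypeL) v‖ ≤ M := by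
    rintro ⟨v, hv⟩
    simp only [ContinuousLinearMap.comp_apply, Submodule.subtypeL_apply]
    induction hv using Submodule.span_induction with
    | mem v hv =>
      obtain ⟨M, hM⟩ := hcpt.isBounded.exists_norm_le
      refine ⟨M, fun t => hM _ ?_⟩
      obtain ⟨s, rfl⟩ := hv
      exact ⟨t + s, B.add _ _ _⟩
    | zero => exact ⟨0, fun t => by simp⟩
    | add u v _ _ h1 h2 =>
      obtain ⟨M1, h1⟩ := h1
      obtain ⟨M2, h2⟩ := h2
      refine ⟨M1 + M2, fun t => ?_⟩
      rw [map_add]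
      exact (norm_add_le _ _).trans (add_le_add (h1 t) (h2 t))
    | smul r v _ h1 =>
      obtain ⟨M1, h1⟩ := h1
      refine ⟨|r| * M1, fun t => ?_⟩
      rw [map_smul, norm_smul, Real.norm_eq_abs]
      exact mul_le_mul_of_nonneg_left (h1 t) (abs_nonneg _)
  obtain ⟨M, hM⟩ := banach_steinhaus hbd
  have hW : ∀ v ∈ W, ∀ t, ‖F t v‖ ≤ M * ‖v‖ := by
    intro v hv t
    have := ((F t).comp W.subtypeL).le_of_opNorm_le (hM t) ⟨v, hv⟩
    simpa using this
  have hΓW : ∀ v ∈ Γ, v ∈ W := fun v hv => Submodule.subset_span hv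
  have h1 : Tendsto (fun n => F (L (φ n)) ys - y0) atTop (𝓝 0) := by
    have h2 : Tendsto (fun n => M * ‖ys - F (-L (φ n)) y0‖) atTop (𝓝 0) := by
      have h3 : Tendsto (fun n => ys - F (-L (φ n)) y0) atTop (𝓝 0) := by
        simpa using (tendsto_const_nhds (x := ys)).sub hlim
      simpa using h3.norm.const_mul M
    refine squeeze_zero_norm (fun n => ?_) h2
    have h4 : F (L (φ n)) ys - y0 = F (L (φ n)) (ys - F (-L (φ n)) y0) := by
      rw [map_sub, ← B.add, add_neg_cancel, B.zero]
    rw [h4]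
    exact hW _ (W.sub_mem (hΓW _ hys) (hΓW _ ⟨_, rfl⟩)) _
  have h2 : Tendsto (fun n => F (L (φ n)) (z - ys)) atTop (𝓝 0) := by
    have := ((hL.comp hφ.tendsto_atTop).sub_const y0).sub h1
    rw [sub_self, sub_zero] at this
    refine this.congr fun n => ?_
    simp only [Function.comp, map_sub]; abel
  have h3 : PC ys = ys := by
    obtain ⟨t, rfl⟩ := hys
    simp only [B.commC, hy]
  by_cases hzy : z - ys = 0
  · rw [sub_eq_zero] at hzy; rw [hzy]; exact hys
  · exfalso
    obtain ⟨c, hc, hlow⟩ := B.lower (z - ys) (by rw [map_sub, hz, h3]) hzy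
    have := (h2.norm.eventually_lt_const (by simpa using hc)).exists
    obtain ⟨n, hn⟩ := this
    exact absurd (hlow (L (φ n))) (not_le.mpr hn)

lemma Base.range_compact {F : ℝ → Euc d →L[ℝ] Euc d} {PS PC PU : Euc d →L[ℝ] Euc d}
    (B : Base F PS PC PU) (c : Euc d) (T : ℝ) (hT : 0 < T) (hc : F T c = c) :
    IsCompact (Set.range fun t => F t c) :=
  Function.Periodic.compact_of_continuous (c := T)
    (fun t => by simp only [B.add, hc]) hT.ne' (B.tcont c)

lemma Base.nat_period {F : ℝ → Euc d →L[ℝ] Euc d} {PS PC PU : Euc d →L[ℝ] Euc d}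
    (B : Base F PS PC PU) (c : Euc d) (T : ℝ) (hc : F T c = c) (n : ℕ) : F (n * T) c = c := by
  induction n with
  | zero => simp [B.zero]
  | succ n ih => push_cast; rw [add_mul, one_mul, B.add, hc, ih]

/-- choice of the point `x = p + c` -/
lemma choose_point {F F' : ℝ → Euc d →L[ℝ] Euc d} {PS PC PU PS' : Euc d →L[ℝ] Euc d}
    {σ T : ℝ} (B : Base F PS PC PU) (RS : Rate F PS σ) (h : Euc d ≃ₜ Euc d)
    (H : ∀ x, x ≠ 0 → PS x = x → PS' (h x) ≠ 0) (hT : 0 < T)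
    (c0 : Euc d) (hc0 : c0 ≠ 0) (hPc0 : PC c0 = c0) (hTc0 : F T c0 = c0)
    (hT2c0 : F (T / 2) c0 = -c0) (r : ℝ) (hr : 0 < r) :
    ∃ p c : Euc d, p ≠ 0 ∧ PS p = p ∧ (∀ t, F t p = Real.exp (σ * t) • p) ∧ ‖p‖ < r / 2 ∧
      c ≠ 0 ∧ PC c = c ∧ F T c = c ∧ F (T / 2) c = -c ∧ (∀ t, ‖F t c‖ < r / 2) ∧
      PS' (h (p + c)) ≠ 0 := by
  obtain ⟨p, hp0, hPp, hFp, hpr⟩ := RS.exists_small (r / 2) (by positivity)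
  obtain ⟨M, hM⟩ := (B.range_compact c0 T hT hTc0).isBounded.exists_norm_le
  have e1 : ∀ᶠ ε : ℝ in 𝓝[>] 0, ε * M < r / 2 := by
    have : Tendsto (fun ε : ℝ => ε * M) (𝓝 0) (𝓝 (0 * M)) :=
      (continuous_id.mul continuous_const).tendsto 0
    rw [zero_mul] at this
    exact nhdsWithin_le_nhds (this.eventually_lt_const (by positivity))
  have e2 : ∀ᶠ ε : ℝ in 𝓝[>] 0, PS' (h (p + ε • c0)) ≠ 0 := by
    have hc : Continuous fun ε : ℝ => PS' (h (p + ε • c0)) := by fun_prop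
    have := hc.tendsto 0
    simp only [zero_smul, add_zero] at this
    exact nhdsWithin_le_nhds (this.eventually_ne (H p hp0 hPp))
  obtain ⟨ε, ⟨h1, h2⟩, h3⟩ := ((e1.and e2).and self_mem_nhdsWithin).exists
  have h3 : 0 < ε := h3
  refine ⟨p, ε • c0, hp0, hPp, hFp, hpr, smul_ne_zero h3.ne' hc0, by rw [map_smul, hPc0],
    by rw [map_smul, hTc0], by rw [map_smul, hT2c0, smul_neg], fun t => ?_, h2⟩
  rw [map_smul, norm_smul, Real.norm_of_nonneg h3.le]
  refine lt_of_le_of_lt ?_ h1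
  have := hM _ ⟨t, rfl⟩
  gcongr

set_option maxHeartbeats 1000000 in
lemma half_rigidity_SC {F F' : ℝ → Euc d →L[ℝ] Euc d} {PS PC PU PS' PC' PU' : Euc d →L[ℝ] Euc d}
    {σ σ' T T' : ℝ} (B : Base F PS PC PU) (B' : Base F' PS' PC' PU')
    (RS : Rate F PS σ) (RS' : Rate F' PS' σ') (hσ : σ < 0) (hσ' : σ' < 0)
    (h : Euc d ≃ₜ Euc d) (h0 : h 0 = 0)
    (hol : ∀ γ : ℝ, 0 < γ → γ < 1 → HolderNearZero γ ⇑h.symm)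
    (orb : OrbRel F F' h) (H : ∀ x, x ≠ 0 → PS x = x → PS' (h x) ≠ 0)
    (hT : 0 < T) (hT' : 0 < T')
    (C4 : ∃ c, c ≠ 0 ∧ PC c = c ∧ F T c = c ∧ F (T / 2) c = -c)
    (C3 : ∀ y, PC' y = y → ∀ s, 0 < s → s < T' → F' s y = y → ∀ t, F' t y = y) :
    σ * T ≤ σ' * T' := by
  refine limit_helper fun γ hγ0 hγ1 => ?_
  obtain ⟨r', hr', K, hK⟩ := hol γ hγ0 hγ1
  obtain ⟨ρ, hρ, hball⟩ : ∃ ρ > 0, ∀ x : Euc d, ‖x‖ < ρ → ‖h x‖ < r' := by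
    have := Metric.continuous_iff.mp h.continuous 0 r' hr'
    simpa [h0] using this
  obtain ⟨c0, hc0, hPc0, hTc0, hT2c0⟩ := C4
  obtain ⟨p, c, hp0, hPp, hFp, hpr, hc, hPc, hTc, hT2c, hcr, hPS'⟩ :=
    choose_point (PS' := PS') (F' := F') B RS h H hT c0 hc0 hPc0 hTc0 hT2c0 ρ hρ
  have hPSc : PS c = 0 := by rw [← hPc, B.SC]
  set x := p + c with hx
  have hPSx : PS x = p := by rw [hx, map_add, hPp, hPSc, add_zero]
  have hFx : ∀ t, F t x = Real.exp (σ * t) • p + F t c := fun t => by rw [hx, map_add, hFp]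
  have hbx : ∀ t, 0 ≤ t → ‖h (F t x)‖ < r' := by
    intro t ht
    refine hball _ ?_
    rw [hFx]
    refine (norm_add_le _ _).trans_lt ?_
    rw [norm_smul, Real.norm_of_nonneg (Real.exp_pos _).le]
    have h1 : Real.exp (σ * t) ≤ 1 := by rw [Real.exp_le_one_iff]; nlinarith
    nlinarith [hcr t, norm_nonneg p]
  -- time change
  obtain ⟨a, ρa, hρa, ha, haF⟩ := B'.funS (h x) hPS'
  obtain ⟨τ, hτ, hmono, hsurj⟩ := time_change B h orb x (by rw [hPSx]; exact hp0) a ρa hρa.ne ha haF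
  have hτm : StrictMono τ := by
    rcases hmono with hm | hm
    · exact hm
    · exfalso
      refine exp_unbounded (ρ := -ρa) (c := a (h x)) (M := ‖a‖ * r') (t1 := -τ 0)
        (by linarith) ha fun L hL => ?_
      obtain ⟨t0, ht0⟩ := hsurj (-L)
      have h1 : 0 ≤ t0 := by rw [← hm.le_iff_ge, ht0]; linarith
      have h2 : Real.exp (-ρa * L) * a (h x) = a (h (F t0 x)) := by
        rw [hτ, haF, ht0]; congr 2; ring
      rw [h2, ← Real.norm_eq_abs]
      refine (a.le_opNorm _).trans ?_
      have := (hbx t0 h1).le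
      gcongr
  have hPU : PU' (h x) = 0 := by
    refine B'.PU_zero (t1 := τ 0) (M := r') fun L hL => ?_
    obtain ⟨t0, ht0⟩ := hsurj L
    have h1 : 0 ≤ t0 := by rw [← hτm.le_iff_le, ht0]; exact hL
    rw [← ht0, ← hτ]
    exact (hbx t0 h1).le
  have hqz : h x = PS' (h x) + PC' (h x) := by
    conv_lhs => rw [← B'.sum (h x), hPU, add_zero]
  set q := PS' (h x) with hq
  set z := PC' (h x) with hz
  -- the periodic orbit
  have hby : ∀ t, ‖F' t (h c)‖ ≤ r' := by
    intro t
    obtain ⟨s, hs⟩ := orb.2 c t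
    rw [hs]
    exact (hball _ (by linarith [hcr s])).le
  have hyS : PS' (h c) = 0 := B'.PS_zero (t1 := 0) fun t _ => hby t
  have hyU : PU' (h c) = 0 := B'.PU_zero (t1 := 0) fun t _ => hby t
  have hyC : PC' (h c) = h c := by
    have := B'.sum (h c)
    rwa [hyS, hyU, zero_add, add_zero] at this
  have hne : h (-c) ≠ h c := by
    intro hh
    have h1 := h.injective hh
    have h2 : c = 0 := by
      have h3 : (2 : ℝ) • c = 0 := by
        rw [two_smul]; nth_rewrite 1 [← h1]; simp
      simpa using h3
    exact hc h2
  have hnfix : ¬ ∀ t, F' t (h c) = h c := by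
    intro hh
    obtain ⟨s, hs⟩ := orb.1 c (T / 2)
    rw [hT2c, hh] at hs
    exact hne hs
  have hcn : ∀ n : ℕ, F (n * T) c = c := B.nat_period c T hTc
  have hexp0 : ∀ b : ℝ, Tendsto (fun n : ℕ => Real.exp (σ * (n * T + b)) • p) atTop (𝓝 0) := by
    intro b
    have h1 : Tendsto (fun n : ℕ => σ * (n * T + b)) atTop atBot :=
      (tendsto_atTop_add_const_right _ b
        (tendsto_natCast_atTop_atTop.atTop_mul_const hT)).const_mul_atTop_of_neg hσ
    simpa using (Real.tendsto_exp_atBot.comp h1).smul_const p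
  have hlimb : ∀ b : ℝ, Tendsto (fun n : ℕ => F' (τ (n * T + b)) (h x)) atTop (𝓝 (h (F b c))) := by
    intro b
    have h1 : Tendsto (fun n : ℕ => F (n * T + b) x) atTop (𝓝 (F b c)) := by
      have h2 := (hexp0 b).add_const (F b c)
      rw [zero_add] at h2
      refine h2.congr fun n => ?_
      rw [hFx, add_comm (n * T) b, B.add, hcn]
    refine ((h.continuous.tendsto _).comp h1).congr fun n => ?_
    exact hτ _
  set Lf : ℕ → ℝ := fun n => τ (n * T) with hLf
  have hl0 : Tendsto (fun n : ℕ => F' (Lf n) (h x)) atTop (𝓝 (h c)) := by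
    simpa [B.zero] using hlimb 0
  have hl1 : Tendsto (fun n : ℕ => F' (τ (n * T + T / 2)) (h x)) atTop (𝓝 (h (-c))) := by
    have := hlimb (T / 2)
    rwa [hT2c] at this
  have hl2 : Tendsto (fun n : ℕ => F' (Lf (n + 1)) (h x)) atTop (𝓝 (h c)) :=
    hl0.comp (tendsto_add_atTop_nat 1)
  have hgap : ∀ᶠ n in atTop, γ * T' ≤ Lf (n + 1) - Lf n := by
    refine gap_lemma B' (h x) (h c) (h (-c)) Lf (fun n => τ (n * T + T / 2)) (fun n => Lf (n + 1))
      T' (γ * T') (by nlinarith) (fun n => ?_) (fun n => ?_) hl0 hl1 hl2 hne ?_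
    · exact hτm.monotone (by linarith)
    · refine hτm.monotone ?_
      push_cast; linarith
    · intro s hs0 hsT hs
      exact hnfix (C3 _ hyC s hs0 hsT hs)
  obtain ⟨N, hN⟩ := eventually_atTop.mp hgap
  have hgrow : ∀ n, N ≤ n → Lf N + ((n : ℝ) - N) * (γ * T') ≤ Lf n := by
    intro n hn
    induction n, hn using Nat.le_induction with
    | base => simp
    | succ n hn ih =>
      have := hN n hn
      push_cast
      linarith
  have hγT : 0 < γ * T' := by positivity
  have hLtop : Tendsto Lf atTop atTop := by
    refine tendsto_atTop_mono' atTop (f₁ := fun n : ℕ => Lf N + ((n : ℝ) - N) * (γ * T')) ?_ ?_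
    · filter_upwards [eventually_ge_atTop N] with n hn using hgrow n hn
    · refine tendsto_atTop_add_const_left _ _ (Tendsto.atTop_mul_const hγT ?_)
      exact tendsto_atTop_add_const_right _ (-(N : ℝ)) tendsto_natCast_atTop_atTop
  obtain ⟨N2, hN2⟩ := eventually_atTop.mp (hLtop.eventually_ge_atTop 0)
  have hqS : PS' q = q := by rw [hq, B'.SS]
  have hqb : ∀ t, 0 ≤ t → ‖F' t q‖ ≤ Real.exp (σ' * t) * ‖q‖ := fun t ht => RS'.bound (h x) t ht
  have hqlim : Tendsto (fun n => F' (Lf n) q) atTop (𝓝 0) := by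
    have h1 : Tendsto (fun n => Real.exp (σ' * Lf n) * ‖q‖) atTop (𝓝 0) := by
      have := (Real.tendsto_exp_atBot.comp (hLtop.const_mul_atTop_of_neg hσ')).mul_const ‖q‖
      simpa using this
    refine squeeze_zero_norm' ?_ h1
    filter_upwards [eventually_ge_atTop N2] with n hn using hqb _ (hN2 n hn)
  have hzlim : Tendsto (fun n => F' (Lf n) z) atTop (𝓝 (h c)) := by
    have := hl0.sub hqlim
    rw [sub_zero] at this
    refine this.congr fun n => ?_
    rw [hqz, map_add, add_sub_cancel_left]
  have hrange : (Set.range fun t => F' t (h c)) = h '' (Set.range fun t => F t c) := by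
    ext y
    constructor
    · rintro ⟨t, rfl⟩
      obtain ⟨s, hs⟩ := orb.2 c t
      exact ⟨_, ⟨s, rfl⟩, hs.symm⟩
    · rintro ⟨_, ⟨s, rfl⟩, rfl⟩
      obtain ⟨t, ht⟩ := orb.1 c s
      exact ⟨t, ht.symm⟩
  have hcpt : IsCompact (Set.range fun t => F' t (h c)) := by
    rw [hrange]; exact (B.range_compact c T hT hTc).image h.continuous
  obtain ⟨t1, ht1⟩ := limit_orbit B' z (h c) Lf hzlim (by rw [hz, B'.CC]) hyC hcpt
  have ht1 : F' t1 (h c) = z := ht1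
  have hg : ∀ n, ∃ s, F' (Lf n) z = h (F s c) := by
    intro n
    obtain ⟨s, hs⟩ := orb.2 c (Lf n + t1)
    exact ⟨s, by rw [← hs, B'.add, ht1]⟩
  -- final estimate
  have key : ∀ n : ℕ, max N N2 ≤ n → ‖p‖ * Real.exp (σ * T * n) ≤
      (‖PS‖ * (|K| * ‖q‖ ^ γ) * Real.exp (γ * σ' * (Lf N - N * (γ * T')))) *
        Real.exp (γ ^ 2 * (σ' * T') * n) := by
    intro n hn
    have hnN : N ≤ n := (le_max_left _ _).trans hn
    have hnN2 : N2 ≤ n := (le_max_right _ _).trans hn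
    obtain ⟨s, hs⟩ := hg n
    have hn0 : (0 : ℝ) ≤ n * T := by positivity
    have h1 := hK (h (F (n * T) x)) (by rw [mem_ball_zero_iff]; exact hbx _ hn0)
      (h (F s c)) (by rw [mem_ball_zero_iff]; exact hball _ (by linarith [hcr s]))
    rw [h.symm_apply_apply, h.symm_apply_apply, dist_eq_norm, dist_eq_norm, ← hs, hτ] at h1
    have h2 : F' (τ (n * T)) (h x) - F' (Lf n) z = F' (Lf n) q := by
      rw [hqz, map_add]; simp [hLf]
    rw [h2] at h1
    have h3 : PS (F (n * T) x - F s c) = Real.exp (σ * T * n) • p := by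
      rw [map_sub, B.commS, B.commS, hPSx, hPSc, map_zero, sub_zero, hFp]
      congr 2; ring
    have h4 := PS.le_opNorm (F (n * T) x - F s c)
    rw [h3, norm_smul, Real.norm_of_nonneg (Real.exp_pos _).le] at h4
    have h5 : ‖F' (Lf n) q‖ ^ γ ≤ Real.exp (γ * (σ' * Lf n)) * ‖q‖ ^ γ := by
      rw [← exp_rpow_mul (norm_nonneg _)]
      exact Real.rpow_le_rpow (norm_nonneg _) (hqb _ (hN2 n hnN2)) hγ0.le
    have h6 : Real.exp (γ * (σ' * Lf n)) ≤ Real.exp (γ * σ' * (Lf N - N * (γ * T'))) *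
        Real.exp (γ ^ 2 * (σ' * T') * n) := by
      rw [← Real.exp_add, Real.exp_le_exp]
      have h7 := hgrow n hnN
      have h8 : γ * σ' ≤ 0 := by nlinarith
      have h9 := mul_le_mul_of_nonpos_left h7 h8
      calc γ * (σ' * Lf n) = γ * σ' * Lf n := by ring
        _ ≤ _ := h9
        _ = _ := by ring
    calc ‖p‖ * Real.exp (σ * T * n) = Real.exp (σ * T * n) * ‖p‖ := mul_comm _ _
      _ ≤ _ := h4
      _ ≤ ‖PS‖ * (|K| * (Real.exp (γ * σ' * (Lf N - N * (γ * T'))) *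
        Real.exp (γ ^ 2 * (σ' * T') * n) * ‖q‖ ^ γ)) := by
          refine mul_le_mul_of_nonneg_left (h1.trans ?_) (norm_nonneg _)
          refine mul_le_mul (le_abs_self K) (h5.trans ?_) (by positivity) (abs_nonneg _)
          exact mul_le_mul_of_nonneg_right h6 (by positivity)
      _ = _ := by ring
  exact exp_compare (norm_pos_iff.mpr hp0) _ key

/-- matrix as continuous linear operator -/
def cl (A : Matrix (Fin d) (Fin d) ℝ) : Euc d →L[ℝ] Euc d :=
  Matrix.toEuclideanCLM (n := Fin d) (𝕜 := ℝ) A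

lemma cl_apply (A : Matrix (Fin d) (Fin d) ℝ) (x : Euc d) (i : Fin d) :
    cl A x i = ∑ j, A i j * x j := rfl

open scoped Matrix.Norms.Operator in
lemma cl_exp (A : Matrix (Fin d) (Fin d) ℝ) :
    cl (NormedSpace.exp A) = NormedSpace.exp (cl A) := by
  let _ : NormedAlgebra ℚ (Matrix (Fin d) (Fin d) ℝ) := NormedAlgebra.restrictScalars ℚ ℝ _
  let _ : NormedAlgebra ℚ (Euc d →L[ℝ] Euc d) := NormedAlgebra.restrictScalars ℚ ℝ _
  refine NormedSpace.map_exp (Matrix.toEuclideanCLM (n := Fin d) (𝕜 := ℝ)) ?_ A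
  exact LinearMap.continuous_of_finiteDimensional
    (Matrix.toEuclideanCLM (n := Fin d) (𝕜 := ℝ)).toAlgEquiv.toLinearMap

lemma linFlow_eq (A : Matrix (Fin d) (Fin d) ℝ) (t : ℝ) (x : Euc d) :
    linFlow A t x = flw (cl A) t x := by
  have h1 : cl (t • A) = t • cl A := by
    ext x i; simp [cl_apply, Finset.mul_sum, mul_assoc]
  rw [flw, ← h1, ← cl_exp]
  rfl

lemma flw_real_eigen {E : Type*} [NormedAddCommGroup E] [NormedSpace ℝ E] [CompleteSpace E]
    (A : E →L[ℝ] E) (v : E) (μ : ℝ) (hv : A v = μ • v) (t : ℝ) :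
    flw A t v = Real.exp (μ * t) • v := by
  have h1 := exp_hasSum (t • A) v
  have hp : ∀ n : ℕ, ((t • A) ^ n) v = ((t * μ) ^ n) • v := by
    intro n
    induction n with
    | zero => simp
    | succ n ih =>
      rw [pow_succ', mul_apply_eq_comp, ih]
      simp only [smul_apply, map_smul, hv]
      rw [smul_smul, smul_smul, pow_succ]
      congr 1; ring
  have h2 := NormedSpace.exp_series_hasSum_exp' (𝕂 := ℝ) (t * μ)
  have h3 := h2.smul_const v
  rw [← Real.exp_eq_exp_ℝ, mul_comm t μ] at h3
  refine h1.unique ?_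
  convert h3 using 2 with n
  rw [hp, smul_smul, mul_comm t μ]
  simp

lemma flw_functional {E : Type*} [NormedAddCommGroup E] [NormedSpace ℝ E] [CompleteSpace E]
    (A : E →L[ℝ] E) (a : E →L[ℝ] ℝ) (μ : ℝ) (ha : ∀ x, a (A x) = μ * a x) (t : ℝ) (x : E) :
    a (flw A t x) = Real.exp (μ * t) * a x := by
  rw [flw_intertwine A (μ • ContinuousLinearMap.id ℝ ℝ) a (by intro x; simp [ha]),
    flw_real_eigen _ _ μ (by simp)]
  simp

lemma norm_le_of_coord (x y : Euc d) (c : ℝ) (hc : 0 ≤ c) (H : ∀ i, |x i| ≤ c * |y i|) :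
    ‖x‖ ≤ c * ‖y‖ := by
  rw [EuclideanSpace.norm_eq, EuclideanSpace.norm_eq, ← Real.sqrt_sq hc,
    ← Real.sqrt_mul (sq_nonneg c), Finset.mul_sum]
  refine Real.sqrt_le_sqrt (Finset.sum_le_sum fun i _ => ?_)
  rw [← mul_pow]
  exact pow_le_pow_left₀ (norm_nonneg _) (H i) 2

section Trip
variable {k l m : ℕ} (hk : k + l + m = d)

/-- the block matrix with diagonal hyperbolic parts -/
def tm (s : Fin k → ℝ) (C : Matrix (Fin l) (Fin l) ℝ) (u : Fin m → ℝ) : Euc d →L[ℝ] Euc d :=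
  cl (tripMat k l m d hk (Matrix.diagonal s) C (Matrix.diagonal u))

/-- stable index -/
def iS (i : Fin k) : Fin d := tripEquiv k l m d hk (Sum.inl i)
/-- central index -/
def iC (i : Fin l) : Fin d := tripEquiv k l m d hk (Sum.inr (Sum.inl i))
/-- unstable index -/
def iU (i : Fin m) : Fin d := tripEquiv k l m d hk (Sum.inr (Sum.inr i))

lemma idx_cases {p : Fin d → Prop} (hS : ∀ i : Fin k, p (iS hk i)) (hC : ∀ i : Fin l, p (iC hk i))
    (hU : ∀ i : Fin m, p (iU hk i)) (i : Fin d) : p i := by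
  obtain ⟨a, rfl⟩ := (tripEquiv k l m d hk).surjective i
  rcases a with i | i | i
  exacts [hS i, hC i, hU i]

lemma sum_idx (f : Fin d → ℝ) : ∑ i, f i =
    ∑ i : Fin k, f (iS hk i) + (∑ i : Fin l, f (iC hk i) + ∑ i : Fin m, f (iU hk i)) := by
  rw [← (tripEquiv k l m d hk).sum_comp, Fintype.sum_sum_type, Fintype.sum_sum_type]
  rfl

variable (s : Fin k → ℝ) (C : Matrix (Fin l) (Fin l) ℝ) (u : Fin m → ℝ)

lemma tm_S (x : Euc d) (i : Fin k) : tm hk s C u x (iS hk i) = s i * x (iS hk i) := by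
  rw [tm, cl_apply, sum_idx hk]
  simp [tripMat, iS, iC, iU, Matrix.diagonal_apply]

lemma tm_C (x : Euc d) (i : Fin l) :
    tm hk s C u x (iC hk i) = ∑ j, C i j * x (iC hk j) := by
  rw [tm, cl_apply, sum_idx hk]
  simp [tripMat, iS, iC, iU]

lemma tm_U (x : Euc d) (i : Fin m) : tm hk s C u x (iU hk i) = u i * x (iU hk i) := by
  rw [tm, cl_apply, sum_idx hk]
  simp [tripMat, iS, iC, iU, Matrix.diagonal_apply]

/-- general coordinate multiplier -/
def pj (a b c : ℝ) : Euc d →L[ℝ] Euc d :=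
  cl (Matrix.diagonal fun i =>
    Sum.elim (fun _ => a) (Sum.elim (fun _ => b) (fun _ => c)) ((tripEquiv k l m d hk).symm i))

lemma pj_S (a b c : ℝ) (x : Euc d) (i : Fin k) : pj hk a b c x (iS hk i) = a * x (iS hk i) := by
  simp [pj, cl_apply, Matrix.diagonal_apply, iS]
lemma pj_C (a b c : ℝ) (x : Euc d) (i : Fin l) : pj hk a b c x (iC hk i) = b * x (iC hk i) := by
  simp [pj, cl_apply, Matrix.diagonal_apply, iC]
lemma pj_U (a b c : ℝ) (x : Euc d) (i : Fin m) : pj hk a b c x (iU hk i) = c * x (iU hk i) := by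
  simp [pj, cl_apply, Matrix.diagonal_apply, iU]

lemma euc_ext {x y : Euc d} (hS : ∀ i : Fin k, x (iS hk i) = y (iS hk i))
    (hC : ∀ i : Fin l, x (iC hk i) = y (iC hk i))
    (hU : ∀ i : Fin m, x (iU hk i) = y (iU hk i)) : x = y := by
  ext i
  exact idx_cases hk (p := fun i => x i = y i) hS hC hU i

lemma pj_comm (a b c t : ℝ) (x : Euc d) :
    pj hk a b c (flw (tm hk s C u) t x) = flw (tm hk s C u) t (pj hk a b c x) := by
  refine flw_intertwine _ _ _ (fun x => ?_) t x
  refine euc_ext hk (fun i => ?_) (fun i => ?_) (fun i => ?_)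
  · rw [pj_S, tm_S, tm_S, pj_S]; ring
  · rw [pj_C, tm_C, tm_C, Finset.mul_sum]
    refine Finset.sum_congr rfl fun j _ => ?_
    rw [pj_C]; ring
  · rw [pj_U, tm_U, tm_U, pj_U]; ring

lemma pj_pj (a b c a' b' c' : ℝ) (x : Euc d) :
    pj hk a b c (pj hk a' b' c' x) = pj hk (a * a') (b * b') (c * c') x := by
  refine euc_ext hk (fun i => ?_) (fun i => ?_) (fun i => ?_)
  · simp only [pj_S]; ring
  · simp only [pj_C]; ring
  · simp only [pj_U]; ring

lemma pj_zero (x : Euc d) : pj hk 0 0 0 x = 0 := by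
  refine euc_ext hk (fun i => ?_) (fun i => ?_) (fun i => ?_)
  · rw [pj_S]; simp
  · rw [pj_C]; simp
  · rw [pj_U]; simp

lemma flw_S (t : ℝ) (x : Euc d) (i : Fin k) :
    flw (tm hk s C u) t x (iS hk i) = Real.exp (s i * t) * x (iS hk i) :=
  flw_functional (tm hk s C u) (EuclideanSpace.proj (iS hk i)) (s i) (fun x => tm_S hk s C u x i) t x

lemma flw_U (t : ℝ) (x : Euc d) (i : Fin m) :
    flw (tm hk s C u) t x (iU hk i) = Real.exp (u i * t) * x (iU hk i) :=
  flw_functional (tm hk s C u) (EuclideanSpace.proj (iU hk i)) (u i) (fun x => tm_U hk s C u x i) t x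

/-- complex embedding of the centre coordinates -/
def iot : Euc d →L[ℝ] (Fin l → ℂ) :=
  LinearMap.toContinuousLinearMap
    { toFun := fun x j => (x (iC hk j) : ℂ)
      map_add' := fun x y => by funext j; simp
      map_smul' := fun r x => by funext j; simp }

lemma iot_apply (x : Euc d) (j : Fin l) : iot hk x j = (x (iC hk j) : ℂ) := rfl

/-- real part into the centre coordinates -/
def kap : (Fin l → ℂ) →L[ℝ] Euc d :=
  LinearMap.toContinuousLinearMap
    { toFun := fun w => WithLp.toLp 2 fun i =>
        Sum.elim (fun _ : Fin k => (0 : ℝ)) (Sum.elim (fun j => (w j).re) (fun _ : Fin m => 0))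
          ((tripEquiv k l m d hk).symm i)
      map_add' := fun x y => by
        ext i
        simp only [PiLp.add_apply]
        rcases (tripEquiv k l m d hk).symm i with j | j | j <;> simp
      map_smul' := fun r x => by
        ext i
        simp only [PiLp.smul_apply]
        rcases (tripEquiv k l m d hk).symm i with j | j | j <;> simp }

lemma kap_S (w : Fin l → ℂ) (i : Fin k) : kap hk w (iS hk i) = 0 := by simp [kap, iS]
lemma kap_C (w : Fin l → ℂ) (i : Fin l) : kap hk w (iC hk i) = (w i).re := by simp [kap, iC]
lemma kap_U (w : Fin l → ℂ) (i : Fin m) : kap hk w (iU hk i) = 0 := by simp [kap, iU]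

/-- complexified centre operator -/
def Mc : (Fin l → ℂ) →ₗ[ℂ] (Fin l → ℂ) := Matrix.toLin' (C.map Complex.ofReal)
/-- the same as a real continuous operator -/
def Ac : (Fin l → ℂ) →L[ℝ] (Fin l → ℂ) :=
  (LinearMap.toContinuousLinearMap (Mc C)).restrictScalars ℝ

lemma Ac_eq (w : Fin l → ℂ) : Ac C w = Mc C w := rfl
lemma Mc_apply (w : Fin l → ℂ) (i : Fin l) : Mc C w i = ∑ j, (C i j : ℂ) * w j := by
  simp [Mc, Matrix.toLin'_apply, Matrix.mulVec, dotProduct]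

lemma Mc_eigen (μ : ℂ) : Module.End.HasEigenvalue (Mc C) μ ↔ μ ∈ cSpec C := by
  rw [Module.End.hasEigenvalue_iff_mem_spectrum, Mc, Matrix.spectrum_toLin', cSpec]

lemma iot_flw (t : ℝ) (x : Euc d) :
    iot hk (flw (tm hk s C u) t x) = flw (Ac C) t (iot hk x) := by
  refine flw_intertwine _ _ _ (fun x => ?_) t x
  funext j
  rw [iot_apply, tm_C, Ac_eq, Mc_apply]
  push_cast
  rfl

lemma kap_flw (t : ℝ) (w : Fin l → ℂ) :
    kap hk (flw (Ac C) t w) = flw (tm hk s C u) t (kap hk w) := by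
  refine flw_intertwine _ _ _ (fun w => ?_) t w
  refine euc_ext hk (fun i => ?_) (fun i => ?_) (fun i => ?_)
  · rw [kap_S, tm_S, kap_S, mul_zero]
  · rw [kap_C, tm_C, Ac_eq, Mc_apply, Complex.re_sum]
    refine Finset.sum_congr rfl fun j _ => ?_
    rw [kap_C]; simp
  · rw [kap_U, tm_U, kap_U, mul_zero]

lemma kap_iot (x : Euc d) : kap hk (iot hk x) = pj hk 0 1 0 x := by
  refine euc_ext hk (fun i => ?_) (fun i => ?_) (fun i => ?_)
  · rw [kap_S, pj_S, zero_mul]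
  · rw [kap_C, pj_C, iot_apply]; simp
  · rw [kap_U, pj_U, zero_mul]

lemma pj_kap (w : Fin l → ℂ) : pj hk 0 1 0 (kap hk w) = kap hk w := by
  refine euc_ext hk (fun i => ?_) (fun i => ?_) (fun i => ?_)
  · rw [pj_S, kap_S, mul_zero]
  · rw [pj_C, one_mul]
  · rw [pj_U, kap_U, mul_zero]

end Trip

section Trip2
variable {k l m : ℕ} (hk : k + l + m = d)
variable (s : Fin k → ℝ) (C : Matrix (Fin l) (Fin l) ℝ) (u : Fin m → ℝ)

lemma trip_growth (hC : ∀ z ∈ cSpec C, z.re = 0) (δ : ℝ) (hδ : 0 < δ) :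
    ∃ K : ℝ, ∀ x t, ‖flw (tm hk s C u) t (pj hk 0 1 0 x)‖
      ≤ K * Real.exp (δ * |t|) * ‖pj hk 0 1 0 x‖ := by
  let g : ℝ → Euc d →L[ℝ] Euc d := fun t =>
    Real.exp (-(δ * |t|)) • ((flw (tm hk s C u) t).comp (pj hk 0 1 0))
  have hg : ∀ x, ∃ M, ∀ t, ‖g t x‖ ≤ M := by
    intro x
    obtain ⟨K, hK⟩ := cplx_growth (Ac C) (Mc C) (Ac_eq C)
      (fun μ hμ => hC μ ((Mc_eigen C μ).mp hμ)) (iot hk x) δ hδ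
    refine ⟨‖kap hk (k := k) (m := m)‖ * K, fun t => ?_⟩
    have h1 : g t x = Real.exp (-(δ * |t|)) • kap hk (flw (Ac C) t (iot hk x)) := by
      rw [kap_flw hk s C u, kap_iot]; rfl
    rw [h1, norm_smul, Real.norm_of_nonneg (Real.exp_pos _).le]
    have h2 := (kap hk (k := k) (m := m)).le_opNorm (flw (Ac C) t (iot hk x))
    have h3 := hK t
    calc _ ≤ Real.exp (-(δ * |t|)) * (‖kap hk (k := k) (m := m)‖ * (K * Real.exp (δ * |t|))) := by
          refine mul_le_mul_of_nonneg_left (h2.trans ?_) (Real.exp_pos _).le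
          exact mul_le_mul_of_nonneg_left h3 (norm_nonneg _)
      _ = ‖kap hk (k := k) (m := m)‖ * K * (Real.exp (-(δ * |t|)) * Real.exp (δ * |t|)) := by ring
      _ = _ := by rw [← Real.exp_add]; simp
  obtain ⟨K, hK⟩ := banach_steinhaus hg
  refine ⟨K, fun x t => ?_⟩
  have h1 := (g t).le_of_opNorm_le (hK t) (pj hk 0 1 0 x)
  have h2 : g t (pj hk 0 1 0 x) =
      Real.exp (-(δ * |t|)) • flw (tm hk s C u) t (pj hk 0 1 0 x) := by
    change Real.exp (-(δ * |t|)) • flw (tm hk s C u) t (pj hk 0 1 0 (pj hk 0 1 0 x)) = _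
    rw [pj_pj]; norm_num
  rw [h2, norm_smul, Real.norm_of_nonneg (Real.exp_pos _).le] at h1
  have h3 : Real.exp (δ * |t|) * Real.exp (-(δ * |t|)) = 1 := by rw [← Real.exp_add]; simp
  calc _ = Real.exp (δ * |t|) * (Real.exp (-(δ * |t|)) * ‖flw (tm hk s C u) t (pj hk 0 1 0 x)‖) := by
        rw [← mul_assoc, h3, one_mul]
    _ ≤ Real.exp (δ * |t|) * (K * ‖pj hk 0 1 0 x‖) :=
        mul_le_mul_of_nonneg_left h1 (Real.exp_pos _).le
    _ = _ := by ring

lemma trip_lower (hC : ∀ z ∈ cSpec C, z.re = 0) (x : Euc d) (hx : pj hk 0 1 0 x = x) (h0 : x ≠ 0) :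
    ∃ c > 0, ∀ t, c ≤ ‖flw (tm hk s C u) t x‖ := by
  have hι : iot hk x ≠ 0 := by
    intro hh
    rw [← kap_iot, hh, map_zero] at hx
    exact h0 hx.symm
  obtain ⟨c, hc, hlow⟩ := cplx_lower (Ac C) (Mc C) (Ac_eq C)
      (fun μ hμ => hC μ ((Mc_eigen C μ).mp hμ)) (iot hk x) hι
  have hn : 0 < ‖iot hk‖ + 1 := by positivity
  refine ⟨c / (‖iot hk‖ + 1), by positivity, fun t => ?_⟩
  rw [div_le_iff₀ hn]
  have h1 := (iot hk).le_opNorm (flw (tm hk s C u) t x)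
  rw [iot_flw] at h1
  have h2 := hlow t
  have h3 := norm_nonneg (flw (tm hk s C u) t x)
  linarith

lemma trip_base (hs : ∀ i, s i < 0) (hC : ∀ z ∈ cSpec C, z.re = 0) (hu : ∀ i, 0 < u i) :
    Base (flw (tm hk s C u)) (pj hk 1 0 0) (pj hk 0 1 0) (pj hk 0 0 1) where
  zero := flw_zero _
  add := flw_add _
  cont := flw_continuous _
  sum x := by
    refine euc_ext hk (fun i => ?_) (fun i => ?_) (fun i => ?_)
    · simp [pj_S]
    · simp [pj_C]
    · simp [pj_U]
  commS := pj_comm hk s C u _ _ _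
  commC := pj_comm hk s C u _ _ _
  commU := pj_comm hk s C u _ _ _
  SS x := by rw [pj_pj]; norm_num
  SC x := by rw [pj_pj]; norm_num [pj_zero]
  SU x := by rw [pj_pj]; norm_num [pj_zero]
  CS x := by rw [pj_pj]; norm_num [pj_zero]
  CC x := by rw [pj_pj]; norm_num
  CU x := by rw [pj_pj]; norm_num [pj_zero]
  US x := by rw [pj_pj]; norm_num [pj_zero]
  UC x := by rw [pj_pj]; norm_num [pj_zero]
  UU x := by rw [pj_pj]; norm_num
  funS x hx := by
    by_contra hcon
    refine hx (euc_ext hk (fun i => ?_) (fun i => ?_) (fun i => ?_))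
    · rw [pj_S, one_mul]
      by_contra hi
      exact hcon ⟨EuclideanSpace.proj (iS hk i), s i, hs i, hi, fun t y => flw_S hk s C u t y i⟩
    · simp [pj_C]
    · simp [pj_U]
  funU x hx := by
    by_contra hcon
    refine hx (euc_ext hk (fun i => ?_) (fun i => ?_) (fun i => ?_))
    · simp [pj_S]
    · simp [pj_C]
    · rw [pj_U, one_mul]
      by_contra hi
      exact hcon ⟨EuclideanSpace.proj (iU hk i), u i, hu i, hi, fun t y => flw_U hk s C u t y i⟩
  growth := trip_growth hk s C u hC
  lower := trip_lower hk s C u hC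

lemma iS_inj {i j : Fin k} : iS hk i = iS hk j ↔ i = j := by simp [iS]
lemma iU_inj {i j : Fin m} : iU hk i = iU hk j ↔ i = j := by simp [iU]
lemma iC_ne_iS (i : Fin l) (j : Fin k) : iC hk i ≠ iS hk j := by simp [iC, iS]
lemma iU_ne_iS (i : Fin m) (j : Fin k) : iU hk i ≠ iS hk j := by simp [iU, iS]
lemma iC_ne_iU (i : Fin l) (j : Fin m) : iC hk i ≠ iU hk j := by simp [iC, iU]
lemma iS_ne_iU (i : Fin k) (j : Fin m) : iS hk i ≠ iU hk j := by simp [iS, iU]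

lemma trip_rateS (i0 : Fin k) (hi0 : ∀ i, s i ≤ s i0) :
    Rate (flw (tm hk s C u)) (pj hk 1 0 0) (s i0) where
  bound x t ht := by
    rw [← pj_comm]
    refine norm_le_of_coord _ _ _ (Real.exp_pos _).le
      (idx_cases hk (fun i => ?_) (fun i => ?_) (fun i => ?_))
    · rw [pj_S, pj_S, flw_S, one_mul, one_mul, abs_mul, abs_of_pos (Real.exp_pos _)]
      refine mul_le_mul_of_nonneg_right (Real.exp_le_exp.mpr ?_) (abs_nonneg _)
      exact mul_le_mul_of_nonneg_right (hi0 i) ht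
    · simp [pj_C]
    · simp [pj_U]
  eig := by
    refine ⟨EuclideanSpace.single (iS hk i0) 1, by simp, ?_, fun t => ?_⟩
    · refine euc_ext hk (fun i => ?_) (fun i => ?_) (fun i => ?_)
      · simp [pj_S]
      · simp [pj_C, iC_ne_iS]
      · simp [pj_U, iU_ne_iS]
    · refine flw_real_eigen _ _ _ ?_ t
      refine euc_ext hk (fun i => ?_) (fun i => ?_) (fun i => ?_)
      · by_cases h : i = i0
        · subst h; simp [tm_S]
        · simp [tm_S, iS_inj, h]
      · simp [tm_C, iC_ne_iS]
      · simp [tm_U, iU_ne_iS]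

lemma trip_eigU (j0 : Fin m) : ∃ e : Euc d, e ≠ 0 ∧ pj hk 0 0 1 e = e ∧
    ∀ t, flw (tm hk s C u) t e = Real.exp (u j0 * t) • e := by
  refine ⟨EuclideanSpace.single (iU hk j0) 1, by simp, ?_, fun t => ?_⟩
  · refine euc_ext hk (fun i => ?_) (fun i => ?_) (fun i => ?_)
    · simp [pj_S, iS_ne_iU]
    · simp [pj_C, iC_ne_iU]
    · simp [pj_U]
  · refine flw_real_eigen _ _ _ ?_ t
    refine euc_ext hk (fun i => ?_) (fun i => ?_) (fun i => ?_)
    · simp [tm_S, iS_ne_iU]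
    · simp [tm_C, iC_ne_iU]
    · by_cases h : i = j0
      · subst h; simp [tm_U]
      · simp [tm_U, iU_inj, h]

lemma trip_boundU (t c : ℝ) (hc : ∀ i, u i * t ≤ c) (x : Euc d) :
    ‖flw (tm hk s C u) t (pj hk 0 0 1 x)‖ ≤ Real.exp c * ‖pj hk 0 0 1 x‖ := by
  rw [← pj_comm]
  refine norm_le_of_coord _ _ _ (Real.exp_pos _).le
    (idx_cases hk (fun i => ?_) (fun i => ?_) (fun i => ?_))
  · simp [pj_S]
  · simp [pj_C]
  · rw [pj_U, pj_U, flw_U, one_mul, one_mul, abs_mul, abs_of_pos (Real.exp_pos _)]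
    exact mul_le_mul_of_nonneg_right (Real.exp_le_exp.mpr (hc i)) (abs_nonneg _)

lemma trip_rateU (j0 : Fin m) (hj0 : ∀ j, u j ≤ u j0) :
    Rate (flw (tm hk s C u)) (pj hk 0 0 1) (u j0) where
  bound x t ht := trip_boundU hk s C u t _ (fun i => mul_le_mul_of_nonneg_right (hj0 i) ht) x
  eig := trip_eigU hk s C u j0

lemma trip_rateU_rev (j0 : Fin m) (hj0 : ∀ j, u j0 ≤ u j) :
    Rate (fun t => flw (tm hk s C u) (-t)) (pj hk 0 0 1) (-u j0) where
  bound x t ht := trip_boundU hk s C u (-t) _ (fun i => by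
    have := mul_le_mul_of_nonneg_right (hj0 i) ht
    linarith) x
  eig := by
    obtain ⟨e, h1, h2, h3⟩ := trip_eigU hk s C u j0
    exact ⟨e, h1, h2, fun t => by rw [h3]; congr 2; ring⟩

lemma trip_C3 (Ω : ℝ) (hΩ : 0 < Ω) (hC : ∀ z ∈ cSpec C, ‖z‖ ≤ Ω) (y : Euc d)
    (hy : pj hk 0 1 0 y = y) (r : ℝ) (h0 : 0 < r) (hr : r < 2 * Real.pi / Ω)
    (hper : flw (tm hk s C u) r y = y) (t : ℝ) : flw (tm hk s C u) t y = y := by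
  have h1 := cplx_period (Ac C) (Mc C) (Ac_eq C) Ω hΩ
    (fun μ hμ => hC μ ((Mc_eigen C μ).mp hμ)) (iot hk y) r h0 hr
    (by rw [← iot_flw hk s C u, hper]) t
  rw [← hy, ← kap_iot, ← kap_flw, h1]

lemma trip_C4 (Ω : ℝ) (hΩ : 0 < Ω) (μ : ℂ) (hμ : μ ∈ cSpec C) (hre : μ.re = 0) (hn : ‖μ‖ = Ω) :
    ∃ c, c ≠ 0 ∧ pj hk 0 1 0 c = c ∧ flw (tm hk s C u) (2 * Real.pi / Ω) c = c ∧
      flw (tm hk s C u) (2 * Real.pi / Ω / 2) c = -c := by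
  obtain ⟨v, hv⟩ := ((Mc_eigen C μ).mpr hμ).exists_hasEigenvector
  have hv0 : v ≠ 0 := hv.2
  have hMv : Mc C v = μ • v := hv.apply_eq_smul
  have hlin : ∀ (z : ℂ) w, Ac C (z • w) = z • Ac C w := fun z w => map_smul (Mc C) z w
  have hμI : μ = μ.im * Complex.I := by
    apply Complex.ext <;> simp [hre]
  have him : |μ.im| = Ω := by
    rw [← hn]; conv_rhs => rw [hμI]
    simp
  have hhalf : Complex.exp (((2 * Real.pi / Ω / 2 : ℝ) : ℂ) * μ) = -1 := by
    have h1 : (((2 * Real.pi / Ω / 2 : ℝ) : ℂ) * μ) = ((Real.pi / Ω * μ.im : ℝ) : ℂ) * Complex.I := by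
      conv_lhs => rw [hμI]
      push_cast; ring
    rw [h1]
    rcases abs_eq hΩ.le |>.mp him with h | h
    · rw [h, div_mul_cancel₀ _ hΩ.ne', Complex.exp_pi_mul_I]
    · rw [h, mul_neg, div_mul_cancel₀ _ hΩ.ne']
      push_cast
      rw [neg_mul, Complex.exp_neg, Complex.exp_pi_mul_I]; norm_num
  have hw : ∀ z : ℂ, flw (Ac C) (2 * Real.pi / Ω / 2) (z • v) = -(z • v) := by
    intro z
    rw [flw_eigen (Ac C) (z • v) μ (by rw [hlin, Ac_eq, hMv, smul_comm]) hlin, hhalf]; simp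
  obtain ⟨z, hz⟩ : ∃ z : ℂ, kap hk (k := k) (m := m) (z • v) ≠ 0 := by
    by_contra hcon
    push Not at hcon
    apply hv0
    funext j
    have h1 := congrArg (fun w : Euc d => w (iC hk j)) (hcon 1)
    have h2 := congrArg (fun w : Euc d => w (iC hk j)) (hcon Complex.I)
    simp only [kap_C] at h1 h2
    apply Complex.ext
    · simpa using h1
    · simpa using h2
  have hk2 : flw (tm hk s C u) (2 * Real.pi / Ω / 2) (kap hk (z • v)) = -kap hk (z • v) := by
    rw [← kap_flw, hw, map_neg]
  refine ⟨kap hk (z • v), hz, pj_kap hk _, ?_, hk2⟩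
  rw [← add_halves (2 * Real.pi / Ω), flw_add, hk2, map_neg, hk2, neg_neg]

end Trip2

lemma orbRel_of_isOrbitEquiv {A A' : Matrix (Fin d) (Fin d) ℝ} {h : Euc d ≃ₜ Euc d}
    (H : IsOrbitEquiv A A' h) : OrbRel (flw (cl A)) (flw (cl A')) h := by
  constructor
  · intro x t
    have h1 : h (linFlow A t x) ∈ flowOrbit A' (h x) := by
      rw [← H x]; exact ⟨_, ⟨t, rfl⟩, rfl⟩
    obtain ⟨τ, hτ⟩ := h1
    exact ⟨τ, by rw [← linFlow_eq, ← linFlow_eq]; exact hτ.symm⟩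
  · intro x τ
    have h1 : linFlow A' τ (h x) ∈ h '' flowOrbit A x := by
      rw [H x]; exact ⟨τ, rfl⟩
    obtain ⟨_, ⟨t, rfl⟩, ht⟩ := h1
    exact ⟨t, by rw [← linFlow_eq, ← linFlow_eq]; exact ht.symm⟩

lemma H_of_noU {F F' : ℝ → Euc d →L[ℝ] Euc d} {PS PS' PC' PU' : Euc d →L[ℝ] Euc d}
    {σ : ℝ} (B' : Base F' PS' PC' PU') (RS : Rate F PS σ) (hσ : σ < 0)
    (h : Euc d ≃ₜ Euc d) (h0 : h 0 = 0) (orb : OrbRel F F' h) (hU : ∀ x, PU' x = 0)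
    (x : Euc d) (hx : x ≠ 0) (hPx : PS x = x) : PS' (h x) ≠ 0 := by
  intro hS
  have hC : PC' (h x) = h x := by
    have := B'.sum (h x)
    rwa [hS, hU, zero_add, add_zero] at this
  have hhx : h x ≠ 0 := fun hh => hx (h.injective (hh.trans h0.symm))
  obtain ⟨c, hc, hlow⟩ := B'.lower (h x) hC hhx
  have h1 : Tendsto (fun t : ℝ => F t x) atTop (𝓝 0) := by
    have h2 : Tendsto (fun t : ℝ => Real.exp (σ * t) * ‖x‖) atTop (𝓝 0) := by
      have := (Real.tendsto_exp_atBot.comp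
        (tendsto_id.const_mul_atTop_of_neg hσ)).mul_const ‖x‖
      simpa using this
    refine squeeze_zero_norm' ?_ h2
    filter_upwards [eventually_ge_atTop 0] with t ht
    have := RS.bound x t ht
    rwa [hPx] at this
  have h3 : Tendsto (fun t : ℝ => ‖h (F t x)‖) atTop (𝓝 0) := by
    have := ((h.continuous.tendsto 0).comp h1).norm
    rw [h0, norm_zero] at this
    exact this
  obtain ⟨t, ht⟩ := (h3.eventually_lt_const hc).exists
  obtain ⟨τ, hτ⟩ := orb.1 x t
  rw [hτ] at ht
  exact absurd (hlow τ) (not_le.mpr ht)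

lemma C4_rev {F : ℝ → Euc d →L[ℝ] Euc d} {PS PC PU : Euc d →L[ℝ] Euc d}
    (B : Base F PS PC PU) {T : ℝ} (C4 : ∃ c, c ≠ 0 ∧ PC c = c ∧ F T c = c ∧ F (T / 2) c = -c) :
    ∃ c, c ≠ 0 ∧ PC c = c ∧ F (-T) c = c ∧ F (-(T / 2)) c = -c := by
  obtain ⟨c, h1, h2, h3, h4⟩ := C4
  refine ⟨c, h1, h2, ?_, ?_⟩
  · nth_rewrite 1 [← h3]; rw [← B.add, neg_add_cancel, B.zero]
  · have : F (-(T / 2)) (-c) = c := by rw [← h4, ← B.add, neg_add_cancel, B.zero]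
    rw [map_neg] at this
    rw [← this, neg_neg, this]

lemma C3_rev {F : ℝ → Euc d →L[ℝ] Euc d} {PS PC PU : Euc d →L[ℝ] Euc d}
    (B : Base F PS PC PU) {T : ℝ}
    (C3 : ∀ y, PC y = y → ∀ s, 0 < s → s < T → F s y = y → ∀ t, F t y = y) :
    ∀ y, PC y = y → ∀ s, 0 < s → s < T → F (-s) y = y → ∀ t, F (-t) y = y := by
  intro y hy s h0 hs hper t
  refine C3 y hy s h0 hs ?_ (-t)
  nth_rewrite 1 [← hper]; rw [← B.add, add_neg_cancel, B.zero]

lemma cSpec_smul {l : ℕ} (C : Matrix (Fin l) (Fin l) ℝ) (α : ℝ) (hα : α ≠ 0) (z : ℂ) :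
    (α : ℂ) * z ∈ cSpec (α • C) ↔ z ∈ cSpec C := by
  have h1 : (α • C).map Complex.ofReal = Units.mk0 (α : ℂ) (by exact_mod_cast hα) •
      C.map Complex.ofReal := by
    ext i j; simp [Units.smul_def]
  rw [cSpec, cSpec, h1]
  exact spectrum.smul_mem_smul_iff (r := Units.mk0 (α : ℂ) (by exact_mod_cast hα))

lemma cSpec_smul' {l : ℕ} (C : Matrix (Fin l) (Fin l) ℝ) (α : ℝ) (hα : α ≠ 0) (z : ℂ)
    (hz : z ∈ cSpec (α • C)) : ∃ w ∈ cSpec C, z = α * w := by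
  have hα' : (α : ℂ) ≠ 0 := by exact_mod_cast hα
  refine ⟨z / α, ?_, by field_simp⟩
  rw [← cSpec_smul C α hα]
  rwa [mul_div_cancel₀ _ hα']

lemma exists_top_freq {l : ℕ} (hl : 1 ≤ l) (C : Matrix (Fin l) (Fin l) ℝ) (hne : cSpec C ≠ {0}) :
    ∃ μ ∈ cSpec C, 0 < ‖μ‖ ∧ ∀ z ∈ cSpec C, ‖z‖ ≤ ‖μ‖ := by
  have : Nonempty (Fin l) := ⟨⟨0, hl⟩⟩
  have hnon : (cSpec C).Nonempty := by
    obtain ⟨μ, hμ⟩ := Module.End.exists_eigenvalue (Mc C)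
    exact ⟨μ, (Mc_eigen C μ).mp hμ⟩
  have hfin : (cSpec C).Finite := by
    have := Module.End.finite_hasEigenvalue (Mc C)
    refine this.subset fun μ hμ => (Mc_eigen C μ).mpr hμ
  obtain ⟨μ, hμ, hmax⟩ := Set.exists_max_image _ (fun z => ‖z‖) hfin hnon
  refine ⟨μ, hμ, ?_, hmax⟩
  by_contra hle
  push Not at hle
  apply hne
  refine Set.Subset.antisymm (fun z hz => ?_) ?_
  · exact norm_le_zero_iff.mp ((hmax z hz).trans hle)
  · rintro z rfl
    rwa [norm_le_zero_iff.mp hle] at hμ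

lemma mem_spanES {k l m : ℕ} (hk : k + l + m = d) (x : Euc d) :
    x ∈ spanES (d := d) k ↔ pj hk 1 0 0 x = x := by
  constructor
  · intro hx
    refine euc_ext hk (fun i => ?_) (fun i => ?_) (fun i => ?_)
    · rw [pj_S, one_mul]
    · rw [pj_C, zero_mul, hx _ (by simp [iC, tripEquiv])]
    · rw [pj_U, zero_mul, hx _ (by simp [iU, tripEquiv, add_assoc])]
  · intro hx
    refine idx_cases hk (p := fun j => k ≤ (j : ℕ) → x j = 0) (fun i hi => ?_) (fun i _ => ?_)
      (fun i _ => ?_)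
    · exfalso
      have : ((iS hk i : Fin d) : ℕ) = i := by simp [iS, tripEquiv]
      rw [this] at hi
      exact absurd i.2 (not_lt.mpr hi)
    · rw [← hx, pj_C, zero_mul]
    · rw [← hx, pj_U, zero_mul]

lemma ratio_conclude {a α β Ω : ℝ} (ha : a < 0) (hβ : 0 < β) (hΩ : 0 < Ω)
    (H1 : a * (2 * Real.pi / Ω) ≤ α * a * (2 * Real.pi / (β * Ω)))
    (H2 : α * a * (2 * Real.pi / (β * Ω)) ≤ a * (2 * Real.pi / Ω)) : α = β := by
  have h := le_antisymm H1 H2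
  have hpi := Real.pi_pos
  field_simp at h
  have h3 : β = α := by
    have := mul_left_cancel₀ ha.ne h
    linarith
  exact h3.symm

/-- **Lemma 6.6**: let `Φ`, `Ψ` be generated by `diag [S, C, U]` and
`diag [α_S S, α_C C, α_U U]` with `S`, `U` diagonal stable/unstable parts and `σ(C) ⊂ iℝ`.
If `Φ` is `h`-related to `Ψ` with `h ∈ 𝓗_{1⁻}` and `h(E_S) = E_S`, then:
(i) if `k, m ≥ 1` then `α_S = α_U`; (ii) if `k, l ≥ 1` and `σ(C) ≠ {0}` then `α_S = |α_C|`;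
(iii) if `l, m ≥ 1` and `σ(C) ≠ {0}` then `|α_C| = α_U`. -/
theorem scaling_rigidity {d : ℕ} (k l m : ℕ) (hklm : k + l + m = d)
    (s : Fin k → ℝ) (hsmono : Monotone s) (hsneg : ∀ i, s i < 0)
    (C : Matrix (Fin l) (Fin l) ℝ) (hC : ∀ z ∈ cSpec C, z.re = 0)
    (u : Fin m → ℝ) (humono : Monotone u) (hupos : ∀ i, 0 < u i)
    (αS αU : ℝ) (hαS : 0 < αS) (hαU : 0 < αU) (αC : ℝ) (hαC : αC ≠ 0)
    (h : Euc d ≃ₜ Euc d) (hmem : MemH1minus h)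
    (hrel : IsOrbitEquiv
      (tripMat k l m d hklm (Matrix.diagonal s) C (Matrix.diagonal u))
      (tripMat k l m d hklm (αS • Matrix.diagonal s) (αC • C) (αU • Matrix.diagonal u)) h)
    (hES : ⇑h '' spanES k = spanES k) :
    (1 ≤ k → 1 ≤ m → αS = αU) ∧
    (1 ≤ k → 1 ≤ l → cSpec C ≠ {0} → αS = |αC|) ∧
    (1 ≤ l → 1 ≤ m → cSpec C ≠ {0} → |αC| = αU) := by
  have hk := hklm
  have h0 : h 0 = 0 := (hmem (1/2) (by norm_num) (by norm_num)).1
  have h0' : h.symm 0 = 0 := by rw [← h0, h.symm_apply_apply, h0]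
  have hol : ∀ γ : ℝ, 0 < γ → γ < 1 → HolderNearZero γ ⇑h ∧ HolderNearZero γ ⇑h.symm :=
    fun γ h1 h2 => (hmem γ h1 h2).2
  have hol' : ∀ γ : ℝ, 0 < γ → γ < 1 → HolderNearZero γ ⇑h.symm ∧ HolderNearZero γ ⇑h.symm.symm :=
    fun γ h1 h2 => ⟨(hol γ h1 h2).2, (hol γ h1 h2).1⟩
  have orb : OrbRel (flw (tm hk s C u)) (flw (tm hk (αS • s) (αC • C) (αU • u))) h := by
    have h1 := orbRel_of_isOrbitEquiv hrel
    rw [← Matrix.diagonal_smul, ← Matrix.diagonal_smul] at h1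
    exact h1
  have orb' := orb.symm
  have hC' : ∀ z ∈ cSpec (αC • C), z.re = 0 := by
    intro z hz
    obtain ⟨w, hw, rfl⟩ := cSpec_smul' C αC hαC z hz
    simp [hC w hw]
  have B := trip_base hk s C u hsneg hC hupos
  have B' := trip_base hk (αS • s) (αC • C) (αU • u)
    (fun i => mul_neg_of_pos_of_neg hαS (hsneg i)) hC' (fun i => mul_pos hαU (hupos i))
  have hESf : ∀ x, pj hk 1 0 0 x = x → pj hk 1 0 0 (h x) = h x := by
    intro x hx
    rw [← mem_spanES] at hx ⊢
    rw [← hES]; exact ⟨x, hx, rfl⟩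
  have hESb : ∀ x, pj hk 1 0 0 x = x → pj hk 1 0 0 (h.symm x) = h.symm x := by
    intro x hx
    rw [← mem_spanES] at hx ⊢
    rw [← hES] at hx
    obtain ⟨y, hy, rfl⟩ := hx
    rwa [h.symm_apply_apply]
  have hi : 1 ≤ k → 1 ≤ m → αS = αU := by
    intro hk1 hm1
    let i0 : Fin k := ⟨k - 1, by omega⟩
    let j0 : Fin m := ⟨m - 1, by omega⟩
    have hi0 : ∀ i, s i ≤ s i0 := fun i => hsmono (by
      rw [Fin.le_def]; have := i.2; simp only [i0]; omega)
    have hj0 : ∀ j, u j ≤ u j0 := fun j => humono (by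
      rw [Fin.le_def]; have := j.2; simp only [j0]; omega)
    have RS := trip_rateS hk s C u i0 hi0
    have RU := trip_rateU hk s C u j0 hj0
    have RS' := trip_rateS hk (αS • s) (αC • C) (αU • u) i0
      (fun i => mul_le_mul_of_nonneg_left (hi0 i) hαS.le)
    have RU' := trip_rateU hk (αS • s) (αC • C) (αU • u) j0
      (fun i => mul_le_mul_of_nonneg_left (hj0 i) hαU.le)
    have a1 : s i0 < 0 := hsneg i0
    have a2 : 0 < u j0 := hupos j0
    have a3 : (αS • s) i0 < 0 := mul_neg_of_pos_of_neg hαS a1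
    have a4 : 0 < (αU • u) j0 := mul_pos hαU a2
    have e1 := half_rigidity_SU B B' RS RU RS' RU' a1 a2 a3 a4 h h0 hol orb hESf
    have e2 := half_rigidity_SU B' B RS' RU' RS RU a3 a4 a1 a2 h.symm h0' hol' orb' hESb
    simp only [Pi.smul_apply, smul_eq_mul] at e1 e2
    have e3 : s i0 * u j0 < 0 := mul_neg_of_neg_of_pos a1 a2
    have e4 : (s i0 * u j0) * (αU - αS) = 0 := le_antisymm (by linarith) (by linarith)
    rcases mul_eq_zero.mp e4 with e5 | e5
    · exact absurd e5 e3.ne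
    · linarith
  have freq : 1 ≤ l → cSpec C ≠ {0} → ∃ Ω : ℝ, 0 < Ω ∧ 0 < |αC| * Ω ∧
      (∃ μ ∈ cSpec C, ‖μ‖ = Ω) ∧ (∀ z ∈ cSpec C, ‖z‖ ≤ Ω) ∧
      (∃ μ ∈ cSpec (αC • C), ‖μ‖ = |αC| * Ω) ∧ (∀ z ∈ cSpec (αC • C), ‖z‖ ≤ |αC| * Ω) := by
    intro hl hne
    obtain ⟨μ, hμ, hpos, hmax⟩ := exists_top_freq hl C hne
    refine ⟨‖μ‖, hpos, mul_pos (abs_pos.mpr hαC) hpos, ⟨μ, hμ, rfl⟩, hmax,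
      ⟨αC * μ, (cSpec_smul C αC hαC μ).mpr hμ, by simp⟩, fun z hz => ?_⟩
    obtain ⟨w, hw, rfl⟩ := cSpec_smul' C αC hαC z hz
    rw [norm_mul, Complex.norm_real, Real.norm_eq_abs]
    exact mul_le_mul_of_nonneg_left (hmax w hw) (abs_nonneg _)
  have hpi := Real.pi_pos
  have hii : 1 ≤ k → 1 ≤ l → cSpec C ≠ {0} → αS = |αC| := by
    intro hk1 hl1 hne
    obtain ⟨Ω, hΩ, hΩ', ⟨μ, hμ, hμn⟩, hmax, ⟨μ', hμ', hμn'⟩, hmax'⟩ := freq hl1 hne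
    let i0 : Fin k := ⟨k - 1, by omega⟩
    have hi0 : ∀ i, s i ≤ s i0 := fun i => hsmono (by
      rw [Fin.le_def]; have := i.2; simp only [i0]; omega)
    have RS := trip_rateS hk s C u i0 hi0
    have RS' := trip_rateS hk (αS • s) (αC • C) (αU • u) i0
      (fun i => mul_le_mul_of_nonneg_left (hi0 i) hαS.le)
    have a1 : s i0 < 0 := hsneg i0
    have a3 : (αS • s) i0 < 0 := mul_neg_of_pos_of_neg hαS a1
    have H1 : ∀ x, x ≠ 0 → pj hk 1 0 0 x = x → pj hk 1 0 0 (h x) ≠ 0 := by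
      intro x hx hPx
      rw [hESf x hPx]
      exact fun hh => hx (h.injective (hh.trans h0.symm))
    have H2 : ∀ x, x ≠ 0 → pj hk 1 0 0 x = x → pj hk 1 0 0 (h.symm x) ≠ 0 := by
      intro x hx hPx
      rw [hESb x hPx]
      exact fun hh => hx (h.symm.injective (hh.trans h0'.symm))
    have e1 := half_rigidity_SC B B' RS RS' a1 a3 h h0 (fun γ p q => (hol γ p q).2) orb H1
      (T := 2 * Real.pi / Ω) (T' := 2 * Real.pi / (|αC| * Ω)) (by positivity) (by positivity)
      (trip_C4 hk s C u Ω hΩ μ hμ (hC μ hμ) hμn)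
      (trip_C3 hk (αS • s) (αC • C) (αU • u) _ hΩ' hmax')
    have e2 := half_rigidity_SC B' B RS' RS a3 a1 h.symm h0' (fun γ p q => (hol' γ p q).2) orb' H2
      (T := 2 * Real.pi / (|αC| * Ω)) (T' := 2 * Real.pi / Ω) (by positivity) (by positivity)
      (trip_C4 hk (αS • s) (αC • C) (αU • u) _ hΩ' μ' hμ' (hC' μ' hμ') hμn')
      (trip_C3 hk s C u Ω hΩ hmax)
    exact ratio_conclude a1 (abs_pos.mpr hαC) hΩ e1 e2
  refine ⟨hi, hii, fun hl1 hm1 hne => ?_⟩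
  by_cases hk1 : 1 ≤ k
  · rw [← hii hk1 hl1 hne, hi hk1 hm1]
  obtain ⟨Ω, hΩ, hΩ', ⟨μ, hμ, hμn⟩, hmax, ⟨μ', hμ', hμn'⟩, hmax'⟩ := freq hl1 hne
  let j0 : Fin m := ⟨0, by omega⟩
  have hj0 : ∀ j, u j0 ≤ u j := fun j => humono (by
    rw [Fin.le_def]; simp only [j0]; omega)
  have RU := trip_rateU_rev hk s C u j0 hj0
  have RU' := trip_rateU_rev hk (αS • s) (αC • C) (αU • u) j0
      (fun i => mul_le_mul_of_nonneg_left (hj0 i) hαU.le)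
  have a1 : -u j0 < 0 := by linarith [hupos j0]
  have a3 : -(αU • u) j0 < 0 := by
    have : 0 < (αU • u) j0 := mul_pos hαU (hupos j0)
    linarith
  have hS0 : ∀ x, pj hk 1 0 0 x = 0 := by
    intro x
    refine euc_ext hk (fun i => ?_) (fun i => ?_) (fun i => ?_)
    · exact absurd i.2 (by omega)
    · simp [pj_C]
    · simp [pj_U]
  have e1 := half_rigidity_SC B.rev B'.rev RU RU' a1 a3 h h0 (fun γ p q => (hol γ p q).2) orb.rev
    (H_of_noU B'.rev RU a1 h h0 orb.rev hS0)
    (T := 2 * Real.pi / Ω) (T' := 2 * Real.pi / (|αC| * Ω)) (by positivity) (by positivity)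
    (C4_rev B (trip_C4 hk s C u Ω hΩ μ hμ (hC μ hμ) hμn))
    (C3_rev B' (trip_C3 hk (αS • s) (αC • C) (αU • u) _ hΩ' hmax'))
  have e2 := half_rigidity_SC B'.rev B.rev RU' RU a3 a1 h.symm h0' (fun γ p q => (hol' γ p q).2)
    orb'.rev (H_of_noU B.rev RU' a3 h.symm h0' orb'.rev hS0)
    (T := 2 * Real.pi / (|αC| * Ω)) (T' := 2 * Real.pi / Ω) (by positivity) (by positivity)
    (C4_rev B' (trip_C4 hk (αS • s) (αC • C) (αU • u) _ hΩ' μ' hμ' (hC' μ' hμ') hμn'))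
    (C3_rev B (trip_C3 hk s C u Ω hΩ hmax))
  have e3 : -(αU • u) j0 = αU * (-u j0) := by simp
  rw [e3] at e1 e2
  exact (ratio_conclude a1 (abs_pos.mpr hαC) hΩ e1 e2).symm

end LF
end
end

section
/- Let Φ and Ψ be stable linear flows on X = ℝ^d, and assume Φ is h-related to Ψ for some h ∈ 𝓗_{1⁻}(X). Then there exists a unique α ∈ ℝ⁺ such that: (a) Λ^Φ = α Λ^Ψ, i.e. λ_j^Φ = α λ_j^Ψ for every j ∈ {1,…,d}; (b) h(L^Φ(αs)) = L^Ψ(s) for every s ∈ ℝ; and (c) lim_{t→∞} τ_x(t)/t = α for every x ∈ X∖{0}, where τ_x is the reparametrization determined by h. -/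
noncomputable section
namespace LF

open Filter Topology

variable {d : ℕ}

/-! ### Exponential growth for complex linear flows -/

section Cplx

set_option linter.unusedSectionVars false

open Polynomial

variable {E : Type*} [NormedAddCommGroup E] [NormedSpace ℂ E] [FiniteDimensional ℂ E]

/-- complex linear flow -/
def cfl (T : E →L[ℂ] E) (t : ℝ) : E →L[ℂ] E := NormedSpace.exp (t • T)

lemma cfl_hasDerivAt (T : E →L[ℂ] E) (z : E) (t : ℝ) :
    HasDerivAt (fun s => cfl T s z) (cfl T t (T z)) t := by
  have : CompleteSpace E := FiniteDimensional.complete ℂ E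
  have h := hasDerivAt_exp_smul_const (𝕂 := ℝ) T t
  have h2 : HasFDerivAt (fun L : E →L[ℂ] E => L z)
      ((ContinuousLinearMap.apply ℂ E z).restrictScalars ℝ) (cfl T t) :=
    ((ContinuousLinearMap.apply ℂ E z).restrictScalars ℝ).hasFDerivAt
  have h3 := h2.comp_hasDerivAt t h
  exact h3

lemma cfl_zero (T : E →L[ℂ] E) : cfl T 0 = 1 := by
  simp [cfl, NormedSpace.exp_zero]

lemma cfl_commute_aeval (T : E →L[ℂ] E) (q : ℂ[X]) (t : ℝ) (z : E) :
    aeval T q (cfl T t z) = cfl T t (aeval T q z) := by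
  have h1 : Commute (aeval T q) (t • T) := by
    have : Commute (aeval T q) T := by
      have := Polynomial.aeval_X (R := ℂ) T
      calc aeval T q * T = aeval T (q * X) := by simp
        _ = aeval T (X * q) := by rw [mul_comm]
        _ = T * aeval T q := by simp
    exact this.smul_right t
  have h2 : Commute (aeval T q) (cfl T t) := h1.exp_right
  exact congrArg (fun L : E →L[ℂ] E => L z) h2.eq

/-- the twisted orbit -/
lemma twisted_hasDerivAt (T : E →L[ℂ] E) (β : ℂ) (z : E) (t : ℝ) :
    HasDerivAt (fun s : ℝ => Complex.exp (-β * s) • cfl T s z)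
      (Complex.exp (-β * t) • cfl T t (T z - β • z)) t := by
  have h1 : HasDerivAt (fun s : ℝ => Complex.exp (-β * s)) (Complex.exp (-β * t) * (-β)) t := by
    have : HasDerivAt (fun s : ℝ => -β * (s : ℂ)) (-β * 1) t :=
      (Complex.ofRealCLM.hasDerivAt (x := t)).const_mul (-β)
    simpa using this.cexp
  have h2 := h1.smul (cfl_hasDerivAt T z t)
  refine h2.congr_deriv ?_
  simp only [map_sub, map_smul, smul_sub, mul_smul, neg_smul, smul_neg]
  abel

lemma norm_cexp_mul (β : ℂ) (t : ℝ) : ‖Complex.exp (β * t)‖ = Real.exp (β.re * t) := by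
  rw [Complex.norm_exp]; simp

lemma cfl_upper (T : E →L[ℂ] E) (a η : ℝ) (hη : 0 < η) (s : Multiset ℂ) :
    (∀ β ∈ s, β.re ≤ a) → ∀ x : E, aeval T (s.map (fun β => X - C β)).prod x = 0 →
      ∃ K : ℝ, ∀ t : ℝ, 0 ≤ t → ‖cfl T t x‖ ≤ K * Real.exp ((a + η) * t) := by
  induction s using Multiset.induction with
  | empty =>
    intro _ x hx
    have hx0 : x = 0 := by simpa using hx
    exact ⟨0, fun t _ => by simp [hx0]⟩
  | cons β s ih =>
    intro hs x hx
    have hβ : β.re ≤ a := hs β (Multiset.mem_cons_self β s)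
    set y := T x - β • x with hy
    obtain ⟨K, hK⟩ := ih (fun γ hγ => hs γ (Multiset.mem_cons_of_mem hγ)) y (by
      rw [Multiset.map_cons, Multiset.prod_cons, mul_comm] at hx
      simpa [hy, Algebra.algebraMap_eq_smul_one] using hx)
    set ω := a + η - β.re with hω
    have hωpos : 0 < ω := by simp only [hω]; linarith
    refine ⟨‖x‖ + |K| / ω, fun t ht => ?_⟩
    have key := image_norm_le_of_norm_deriv_right_le_deriv_boundary
      (f := fun s : ℝ => Complex.exp (-β * s) • cfl T s x) (a := 0) (b := t)
      (f' := fun s : ℝ => Complex.exp (-β * s) • cfl T s y)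
      (fun s _ => (twisted_hasDerivAt T β x s).continuousAt.continuousWithinAt)
      (fun s _ => (twisted_hasDerivAt T β x s).hasDerivWithinAt)
      (B := fun s => ‖x‖ + |K| / ω * Real.exp (ω * s))
      (B' := fun s => |K| * Real.exp (ω * s))
      (by simp [cfl_zero]; positivity)
      (fun s => by
        have : HasDerivAt (fun s : ℝ => ω * s) (ω * 1) s := (hasDerivAt_id s).const_mul ω
        have h2 := (this.exp.const_mul (|K| / ω)).const_add ‖x‖
        refine h2.congr_deriv ?_
        field_simp)
      (fun s hs => by
        rw [norm_smul, norm_cexp_mul]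
        calc Real.exp ((-β).re * s) * ‖cfl T s y‖
            ≤ Real.exp ((-β).re * s) * (|K| * Real.exp ((a + η) * s)) := by
              gcongr
              exact (hK s hs.1).trans (by gcongr; exact le_abs_self K)
          _ = |K| * Real.exp (ω * s) := by
              rw [mul_left_comm, ← Real.exp_add]; congr 2; simp [hω]; ring)
      (x := t) ⟨ht, le_rfl⟩
    simp only [norm_smul, norm_cexp_mul] at key
    have e1 : ‖cfl T t x‖ = Real.exp (β.re * t) * (Real.exp ((-β).re * t) * ‖cfl T t x‖) := by
      rw [← mul_assoc, ← Real.exp_add]; simp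
    have e2 : (1 : ℝ) ≤ Real.exp (ω * t) := Real.one_le_exp (by positivity)
    calc ‖cfl T t x‖ = Real.exp (β.re * t) * (Real.exp ((-β).re * t) * ‖cfl T t x‖) := e1
      _ ≤ Real.exp (β.re * t) * (‖x‖ + |K| / ω * Real.exp (ω * t)) := by gcongr
      _ ≤ Real.exp (β.re * t) * (‖x‖ * Real.exp (ω * t) + |K| / ω * Real.exp (ω * t)) := by
          gcongr
          exact le_mul_of_one_le_right (norm_nonneg _) e2
      _ = (‖x‖ + |K| / ω) * (Real.exp (β.re * t) * Real.exp (ω * t)) := by ring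
      _ = _ := by rw [← Real.exp_add]; congr 2; simp [hω]; ring

lemma cfl_upper_poly (T : E →L[ℂ] E) (a η : ℝ) (hη : 0 < η) (p : ℂ[X]) (hp : p ≠ 0)
    (hs : ∀ β ∈ p.roots, β.re ≤ a) (x : E) (hx : aeval T p x = 0) :
      ∃ K : ℝ, ∀ t : ℝ, 0 ≤ t → ‖cfl T t x‖ ≤ K * Real.exp ((a + η) * t) := by
  refine cfl_upper T a η hη p.roots hs x ?_
  rw [(IsAlgClosed.splits p).eq_prod_roots, map_mul, aeval_C] at hx
  have : p.leadingCoeff ≠ 0 := by simpa using hp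
  simpa [Algebra.algebraMap_eq_smul_one, this] using hx

lemma cfl_eigen (T : E →L[ℂ] E) (β : ℂ) (v : E) (hv : T v = β • v) (t : ℝ) :
    ‖cfl T t v‖ = Real.exp (β.re * t) * ‖v‖ := by
  have h := is_const_of_deriv_eq_zero (f := fun s : ℝ => Complex.exp (-β * s) • cfl T s v)
    (fun s => (twisted_hasDerivAt T β v s).differentiableAt)
    (fun s => by rw [(twisted_hasDerivAt T β v s).deriv]; simp [hv]) t 0
  have h2 := congrArg norm h
  simp only [norm_smul, norm_cexp_mul] at h2
  simp [cfl_zero] at h2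
  rw [← h2, ← mul_assoc, ← Real.exp_add]; simp

lemma cfl_dual_eigen (T : E →L[ℂ] E) (β : ℂ) (ξ : E →L[ℂ] ℂ) (hξ : ∀ z, ξ (T z) = β * ξ z)
    (t : ℝ) (z : E) : ‖ξ (cfl T t z)‖ = Real.exp (β.re * t) * ‖ξ z‖ := by
  have hder : ∀ s : ℝ, HasDerivAt (fun s : ℝ => Complex.exp (-β * s) * ξ (cfl T s z)) 0 s := by
    intro s
    have h1 := ((ξ.restrictScalars ℝ).hasFDerivAt
      (x := Complex.exp (-β * s) • cfl T s z)).comp_hasDerivAt s (twisted_hasDerivAt T β z s)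
    have h4 : (fun s : ℝ => Complex.exp (-β * s) * ξ (cfl T s z)) =
        (ξ.restrictScalars ℝ) ∘ fun s : ℝ => Complex.exp (-β * s) • cfl T s z := by
      ext u; simp
    rw [h4]
    refine h1.congr_deriv ?_
    · have h3 : ξ (cfl T s (T z - β • z)) = 0 := by
        have hc := cfl_commute_aeval T (X - C β) s z
        simp [Algebra.algebraMap_eq_smul_one] at hc
        rw [map_sub, map_smul, ← hc, map_sub, hξ]; simp
      simpa using h3
  have h := is_const_of_deriv_eq_zero (fun s => (hder s).differentiableAt)
    (fun s => (hder s).deriv) t 0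
  have h2 := congrArg norm h
  simp only [norm_mul, norm_cexp_mul] at h2
  simp [cfl_zero] at h2
  rw [← h2, ← mul_assoc, ← Real.exp_add]; simp

lemma cfl_exp_exists (T : E →L[ℂ] E) (x : E) (hx : x ≠ 0) :
    ∃ a : ℝ, (∃ c > 0, ∀ t : ℝ, 0 ≤ t → c * Real.exp (a * t) ≤ ‖cfl T t x‖) ∧
      ∀ η > 0, ∃ K : ℝ, ∀ t : ℝ, 0 ≤ t → ‖cfl T t x‖ ≤ K * Real.exp ((a + η) * t) := by
  classical
  have hex : ∃ n : ℕ, ∃ p : ℂ[X], p ≠ 0 ∧ aeval T p x = 0 ∧ p.natDegree = n := by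
    have hint : IsIntegral ℂ T := Algebra.IsIntegral.isIntegral T
    exact ⟨_, minpoly ℂ T, minpoly.ne_zero hint, by simp [minpoly.aeval], rfl⟩
  obtain ⟨p, hp, hpx, hpn⟩ := Nat.find_spec hex
  have hmin : ∀ q : ℂ[X], q ≠ 0 → q.natDegree < p.natDegree → aeval T q x ≠ 0 := by
    intro q hq hlt h0
    rw [hpn] at hlt
    exact Nat.find_min hex hlt ⟨q, hq, h0, rfl⟩
  have hne : p.roots.toFinset.Nonempty := by
    rw [Multiset.toFinset_nonempty]
    intro h0
    have := (IsAlgClosed.splits p).eq_prod_roots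
    rw [h0] at this
    rw [this] at hpx
    simp [Algebra.algebraMap_eq_smul_one, hp, hx] at hpx
  obtain ⟨β, hβ, hmax⟩ := p.roots.toFinset.exists_max_image Complex.re hne
  rw [Multiset.mem_toFinset] at hβ
  refine ⟨β.re, ?_, fun η hη => cfl_upper_poly T β.re η hη p hp
    (fun γ hγ => hmax γ (by simpa using hγ)) x hpx⟩
  obtain ⟨q, hq⟩ := Polynomial.dvd_iff_isRoot.mpr (Polynomial.isRoot_of_mem_roots hβ)
  have hq0 : q ≠ 0 := by rintro rfl; simp at hq; exact hp hq
  have hdeg : q.natDegree < p.natDegree := by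
    rw [hq, Polynomial.natDegree_mul (X_sub_C_ne_zero β) hq0]; simp
  have hv := hmin q hq0 hdeg
  set v := aeval T q x with hvdef
  have hTv : T v = β • v := by
    rw [hq] at hpx
    have : T v - β • v = 0 := by
      simpa [hvdef, Algebra.algebraMap_eq_smul_one] using hpx
    exact sub_eq_zero.mp this
  have hqpos : 0 < ‖aeval T q‖ := by
    rw [norm_pos_iff]; intro h0; rw [hvdef, h0] at hv; simp at hv
  refine ⟨‖v‖ / ‖aeval T q‖, by have := norm_pos_iff.mpr hv; positivity, fun t _ => ?_⟩
  have h1 := cfl_eigen T β v hTv t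
  rw [hvdef, ← cfl_commute_aeval, ← hvdef] at h1
  have h2 := (aeval T q).le_opNorm (cfl T t x)
  rw [h1] at h2
  rw [div_mul_eq_mul_div, div_le_iff₀ hqpos]
  linarith

lemma cfl_top (T : E →L[ℂ] E) [Nontrivial E] :
    ∃ b : ℝ, (∀ η > 0, ∃ K > 0, ∀ t : ℝ, 0 ≤ t → ∀ x, ‖cfl T t x‖ ≤ K * Real.exp ((b + η) * t) * ‖x‖)
      ∧ ∃ ξ : E →L[ℂ] ℂ, ξ ≠ 0 ∧ ∀ (t : ℝ) z, ‖ξ (cfl T t z)‖ = Real.exp (b * t) * ‖ξ z‖ := by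
  classical
  have : CompleteSpace E := FiniteDimensional.complete ℂ E
  have hint : IsIntegral ℂ T := Algebra.IsIntegral.isIntegral T
  set p := minpoly ℂ T with hpdef
  have hp : p ≠ 0 := minpoly.ne_zero hint
  have hp0 : aeval T p = 0 := minpoly.aeval ℂ T
  have hne : p.roots.toFinset.Nonempty := by
    rw [Multiset.toFinset_nonempty]
    intro h0
    have := (IsAlgClosed.splits p).eq_prod_roots
    rw [h0] at this
    rw [this] at hp0
    simp [Algebra.algebraMap_eq_smul_one, hp] at hp0
  obtain ⟨β, hβ, hmax⟩ := p.roots.toFinset.exists_max_image Complex.re hne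
  rw [Multiset.mem_toFinset] at hβ
  refine ⟨β.re, fun η hη => ?_, ?_⟩
  · have hpt : ∀ x : E, ∃ K, ∀ t : {t : ℝ // 0 ≤ t},
        ‖(((Real.exp (-((β.re + η) * t)) : ℝ) : ℂ) • cfl T t) x‖ ≤ K := by
      intro x
      obtain ⟨K, hK⟩ := cfl_upper_poly T β.re η hη p hp
        (fun γ hγ => hmax γ (by simpa using hγ)) x (by simp [hp0])
      refine ⟨K, fun t => ?_⟩
      rw [smul_apply, norm_smul, Complex.norm_real, Real.norm_eq_abs,
        abs_of_pos (Real.exp_pos _), Real.exp_neg, inv_mul_le_iff₀ (Real.exp_pos _), mul_comm]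
      exact hK t t.2
    obtain ⟨K, hK⟩ := banach_steinhaus hpt
    refine ⟨|K| + 1, by positivity, fun t ht x => ?_⟩
    have h1 := hK ⟨t, ht⟩
    rw [norm_smul, Complex.norm_real, Real.norm_eq_abs,
        abs_of_pos (Real.exp_pos _), Real.exp_neg, inv_mul_le_iff₀ (Real.exp_pos _), mul_comm] at h1
    refine ((cfl T t).le_opNorm x).trans ?_
    gcongr
    refine h1.trans ?_
    gcongr
    linarith [le_abs_self K]
  · obtain ⟨q, hq⟩ := Polynomial.dvd_iff_isRoot.mpr (Polynomial.isRoot_of_mem_roots hβ)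
    have hq0 : q ≠ 0 := by rintro rfl; simp at hq; exact hp hq
    have hdeg : q.natDegree < p.natDegree := by
      rw [hq, Polynomial.natDegree_mul (X_sub_C_ne_zero β) hq0]; simp
    have hqT : aeval T q ≠ 0 := by
      intro h0
      have := minpoly.degree_le_of_ne_zero ℂ T hq0 h0
      have := Polynomial.natDegree_le_natDegree this
      exact absurd hdeg (not_lt.mpr this)
    obtain ⟨x, hx⟩ : ∃ x, aeval T q x ≠ 0 := by
      by_contra hcon
      push Not at hcon
      exact hqT (ContinuousLinearMap.ext hcon)
    obtain ⟨g, hg⟩ := SeparatingDual.exists_ne_zero (R := ℂ) hx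
    refine ⟨g ∘L aeval T q, fun h0 => hg (by simpa using congrArg (fun L => L x) h0), ?_⟩
    refine cfl_dual_eigen T β _ (fun z => ?_)
    have h1 : aeval T (q * (X - C β)) z = 0 := by rw [mul_comm, ← hq, hp0]; simp
    have h2 : aeval T q (T z) - β • aeval T q z = 0 := by
      simpa [Algebra.algebraMap_eq_smul_one] using h1
    rw [sub_eq_zero] at h2
    simp [h2]

end Cplx


/-! ### Basic facts on real linear flows -/

section RealFlow

/-- complexification of a real vector -/
def cx (d : ℕ) : Euc d →ₗ[ℝ] EuclideanSpace ℂ (Fin d) where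
  toFun x := WithLp.toLp 2 (fun i => (x i : ℂ))
  map_add' x y := by ext i; simp
  map_smul' r x := by ext i; simp

lemma norm_cx (x : Euc d) : ‖cx d x‖ = ‖x‖ := by
  simp [cx, EuclideanSpace.norm_eq]

/-- complexified generator -/
def cgen (A : Matrix (Fin d) (Fin d) ℝ) :
    EuclideanSpace ℂ (Fin d) →L[ℂ] EuclideanSpace ℂ (Fin d) :=
  Matrix.toEuclideanCLM (𝕜 := ℂ) (A.map Complex.ofReal)

open scoped Matrix.Norms.L2Operator in
lemma cx_linFlow (A : Matrix (Fin d) (Fin d) ℝ) (t : ℝ) (x : Euc d) :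
    cx d (linFlow A t x) = cfl (cgen A) t (cx d x) := by
  have h1 : cfl (cgen A) t
      = Matrix.toEuclideanCLM (𝕜 := ℂ) ((NormedSpace.exp (t • A)).map Complex.ofReal) := by
    have h2 : (NormedSpace.exp (t • A)).map Complex.ofReal
        = NormedSpace.exp ((t • A).map Complex.ofReal) := by
      have hc : Continuous (Complex.ofRealHom.mapMatrix : Matrix (Fin d) (Fin d) ℝ →+* _) := by
        have : Continuous fun M : Matrix (Fin d) (Fin d) ℝ => M.map Complex.ofReal :=
          continuous_id.matrix_map Complex.continuous_ofReal
        exact this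
      let _ : NormedAlgebra ℚ (Matrix (Fin d) (Fin d) ℝ) := NormedAlgebra.restrictScalars ℚ ℝ _
      exact NormedSpace.map_exp (Complex.ofRealHom.mapMatrix) hc (t • A)
    have hc3 : Continuous (Matrix.toEuclideanCLM (𝕜 := ℂ) (n := Fin d)) := by
      exact (Matrix.toEuclideanCLM (𝕜 := ℂ) (n := Fin d)).toAlgEquiv.toLinearMap.continuous_of_finiteDimensional
    let _ : NormedAlgebra ℚ (Matrix (Fin d) (Fin d) ℂ) := NormedAlgebra.restrictScalars ℚ ℂ _
    have h3 := NormedSpace.map_exp (Matrix.toEuclideanCLM (𝕜 := ℂ) (n := Fin d)) hc3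
      ((t • A).map Complex.ofReal)
    rw [h2, h3, cfl, cgen]
    congr 1
    have : (t • A).map Complex.ofReal = (t : ℂ) • A.map Complex.ofReal := by
      ext i j; simp
    rw [this, map_smul]
    ext; simp
  rw [h1]
  ext i
  simp [cx, linFlow, Matrix.mulVec, dotProduct]

lemma linFlow_add_time (A : Matrix (Fin d) (Fin d) ℝ) (s t : ℝ) (x : Euc d) :
    linFlow A (s + t) x = linFlow A s (linFlow A t x) := by
  unfold linFlow
  rw [add_smul, Matrix.exp_add_of_commute _ _
    (((Commute.refl A).smul_left s).smul_right t)]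
  simp [Matrix.toLpLin_apply]

lemma linFlow_zero_time (A : Matrix (Fin d) (Fin d) ℝ) (x : Euc d) : linFlow A 0 x = x := by
  simp [linFlow, NormedSpace.exp_zero]

lemma linFlow_add (A : Matrix (Fin d) (Fin d) ℝ) (t : ℝ) (x y : Euc d) :
    linFlow A t (x + y) = linFlow A t x + linFlow A t y := by simp [linFlow]

lemma linFlow_sub (A : Matrix (Fin d) (Fin d) ℝ) (t : ℝ) (x y : Euc d) :
    linFlow A t (x - y) = linFlow A t x - linFlow A t y := by simp [linFlow]

lemma linFlow_smul (A : Matrix (Fin d) (Fin d) ℝ) (t r : ℝ) (x : Euc d) :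
    linFlow A t (r • x) = r • linFlow A t x := by simp [linFlow]

lemma linFlow_zero (A : Matrix (Fin d) (Fin d) ℝ) (t : ℝ) :
    linFlow A t 0 = 0 := by simp [linFlow]

lemma linFlow_ne_zero (A : Matrix (Fin d) (Fin d) ℝ) (t : ℝ) {x : Euc d} (hx : x ≠ 0) :
    linFlow A t x ≠ 0 := by
  intro h0
  apply hx
  rw [← linFlow_zero_time A x, show (0 : ℝ) = -t + t by ring, linFlow_add_time, h0, linFlow_zero]

lemma linFlow_bound (A : Matrix (Fin d) (Fin d) ℝ) (t : ℝ) :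
    ∃ K > 0, ∀ x : Euc d, ‖linFlow A t x‖ ≤ K * ‖x‖ := by
  let L := LinearMap.toContinuousLinearMap (Matrix.toEuclideanLin (NormedSpace.exp (t • A)))
  refine ⟨‖L‖ + 1, by positivity, fun x => (L.le_opNorm x).trans ?_⟩
  gcongr
  linarith

/-- `x` has exact exponential growth rate `a`. -/
def HasExp (A : Matrix (Fin d) (Fin d) ℝ) (x : Euc d) (a : ℝ) : Prop :=
  (∃ c > 0, ∀ t : ℝ, 0 ≤ t → c * Real.exp (a * t) ≤ ‖linFlow A t x‖) ∧
    ∀ η > 0, ∃ K > 0, ∀ t : ℝ, 0 ≤ t → ‖linFlow A t x‖ ≤ K * Real.exp ((a + η) * t)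

lemma hasExp_exists (A : Matrix (Fin d) (Fin d) ℝ) {x : Euc d} (hx : x ≠ 0) :
    ∃ a, HasExp A x a := by
  obtain ⟨a, h1, h2⟩ := cfl_exp_exists (cgen A) (cx d x)
    (by rw [← norm_ne_zero_iff, norm_cx]; simpa using hx)
  simp only [← cx_linFlow, norm_cx] at h1 h2
  refine ⟨a, h1, fun η hη => ?_⟩
  obtain ⟨K, hK⟩ := h2 η hη
  refine ⟨|K| + 1, by positivity, fun t ht => (hK t ht).trans ?_⟩
  gcongr
  linarith [le_abs_self K]

/-- `b` is the top exponent of `A`. -/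
def IsTop (A : Matrix (Fin d) (Fin d) ℝ) (b : ℝ) : Prop :=
  (∀ η > 0, ∃ K > 0, ∀ t : ℝ, 0 ≤ t → ∀ x, ‖linFlow A t x‖ ≤ K * Real.exp ((b + η) * t) * ‖x‖) ∧
    ∃ (ξ : Euc d →L[ℝ] ℂ) (w : Euc d), ξ w ≠ 0 ∧
      ∀ (t : ℝ) z, ‖ξ (linFlow A t z)‖ = Real.exp (b * t) * ‖ξ z‖

lemma isTop_exists (hd : 0 < d) (A : Matrix (Fin d) (Fin d) ℝ) : ∃ b, IsTop A b := by
  have : Nonempty (Fin d) := ⟨⟨0, hd⟩⟩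
  obtain ⟨b, h1, ξ, hξ, h2⟩ := cfl_top (cgen A)
  refine ⟨b, fun η hη => ?_, ?_⟩
  · obtain ⟨K, hK, h⟩ := h1 η hη
    refine ⟨K, hK, fun t ht x => ?_⟩
    have := h t ht (cx d x)
    rwa [← cx_linFlow, norm_cx, norm_cx] at this
  · let L : Euc d →ₗ[ℝ] ℂ := (ξ.toLinearMap.restrictScalars ℝ) ∘ₗ cx d
    have hL : ∀ z, L z = ξ (cx d z) := fun z => rfl
    have hw : ∃ w, L w ≠ 0 := by
      by_contra hcon
      push Not at hcon
      apply hξ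
      have hb : ∀ i : Fin d, ξ (EuclideanSpace.single i 1) = 0 := by
        intro i
        have := hcon (EuclideanSpace.single i 1)
        rw [hL] at this
        convert this using 2
        ext j
        by_cases hj : j = i <;> simp [cx, hj]
      have := (EuclideanSpace.basisFun (Fin d) ℂ).toBasis.ext
        (f₁ := ξ.toLinearMap) (f₂ := 0) (by intro i; simpa using hb i)
      ext z
      exact congrArg (fun f => f z) this
    obtain ⟨w, hw⟩ := hw
    refine ⟨LinearMap.toContinuousLinearMap L, w, by simpa using hw, fun t z => ?_⟩
    have := h2 t (cx d z)
    rw [← cx_linFlow] at this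
    simpa [hL] using this

lemma linFlow_comm (A : Matrix (Fin d) (Fin d) ℝ) (s t : ℝ) (x : Euc d) :
    linFlow A s (linFlow A t x) = linFlow A t (linFlow A s x) := by
  rw [← linFlow_add_time, ← linFlow_add_time, add_comm]

lemma linFlow_neg_cancel (A : Matrix (Fin d) (Fin d) ℝ) (t : ℝ) (x : Euc d) :
    linFlow A (-t) (linFlow A t x) = x := by
  rw [← linFlow_add_time]; simp [linFlow_zero_time]

lemma HasExp.shift {A : Matrix (Fin d) (Fin d) ℝ} {x : Euc d} {a : ℝ} (h : HasExp A x a) (T : ℝ) :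
    HasExp A (linFlow A T x) a := by
  obtain ⟨⟨c, hc, h1⟩, h2⟩ := h
  obtain ⟨K, hK, hKb⟩ := linFlow_bound A T
  obtain ⟨K', hK', hKb'⟩ := linFlow_bound A (-T)
  refine ⟨⟨c / K', by positivity, fun t ht => ?_⟩, fun η hη => ?_⟩
  · have := hKb' (linFlow A T (linFlow A t x))
    rw [linFlow_neg_cancel] at this
    rw [linFlow_comm, div_mul_eq_mul_div, div_le_iff₀ hK', mul_comm _ K']
    exact (h1 t ht).trans this
  · obtain ⟨M, hM, h⟩ := h2 η hη
    refine ⟨K * M, by positivity, fun t ht => ?_⟩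
    rw [linFlow_comm, mul_assoc]
    exact (hKb _).trans (by gcongr; exact h t ht)

lemma HasExp.ne_zero {A : Matrix (Fin d) (Fin d) ℝ} {x : Euc d} {a : ℝ} (h : HasExp A x a) :
    x ≠ 0 := by
  obtain ⟨⟨c, hc, h1⟩, h2⟩ := h
  rintro rfl
  have := h1 0 le_rfl
  simp [linFlow_zero] at this
  linarith

lemma neg_of_exp_tendsto {a c : ℝ} (hc : 0 < c) {f : ℝ → ℝ} (hf : Tendsto f atTop (𝓝 0))
    (h : ∀ t, 0 ≤ t → c * Real.exp (a * t) ≤ f t) : a < 0 := by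
  by_contra! ha
  have h1 : ∀ᶠ t in atTop, f t < c := hf.eventually (gt_mem_nhds hc)
  obtain ⟨t, ht, ht0⟩ := (h1.and (eventually_ge_atTop 0)).exists
  have h2 := h t ht0
  have h3 : 1 ≤ Real.exp (a * t) := Real.one_le_exp (by positivity)
  nlinarith

lemma HasExp.neg {A : Matrix (Fin d) (Fin d) ℝ} (hA : IsStable A) {x : Euc d} {a : ℝ}
    (h : HasExp A x a) : a < 0 := by
  obtain ⟨⟨c, hc, h1⟩, h2⟩ := h
  have := (hA x : Tendsto _ _ _).norm
  rw [norm_zero] at this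
  exact neg_of_exp_tendsto hc this h1

lemma IsTop.neg {A : Matrix (Fin d) (Fin d) ℝ} (hA : IsStable A) {b : ℝ}
    (h : IsTop A b) : b < 0 := by
  obtain ⟨h1, ξ, w, hw, h2⟩ := h
  have h3 := ((ξ.continuous.tendsto _).comp (hA w : Tendsto _ _ _)).norm
  rw [map_zero, norm_zero] at h3
  refine neg_of_exp_tendsto (norm_pos_iff.mpr hw) h3 (fun t ht => ?_)
  simp only [Function.comp]
  rw [h2, mul_comm]

lemma exp_compare_s19 {a b c K : ℝ} (hc : 0 < c) (hK : 0 < K)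
    (h : ∀ t : ℝ, 0 ≤ t → c * Real.exp (a * t) ≤ K * Real.exp (b * t)) : a ≤ b := by
  by_contra! hab
  have h1 : Tendsto (fun t : ℝ => (a - b) * t) atTop atTop :=
    tendsto_id.const_mul_atTop (by linarith)
  obtain ⟨t, ht, ht0⟩ := ((h1.eventually_gt_atTop (Real.log K - Real.log c)).and
    (eventually_ge_atTop 0)).exists
  have h2 := Real.log_le_log (by positivity) (h t ht0)
  rw [Real.log_mul hc.ne' (Real.exp_pos _).ne', Real.log_mul hK.ne' (Real.exp_pos _).ne',
    Real.log_exp, Real.log_exp] at h2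
  linarith

lemma HasExp.le_top {A : Matrix (Fin d) (Fin d) ℝ} {x : Euc d} {a b : ℝ} (h : HasExp A x a)
    (hb : IsTop A b) : a ≤ b := by
  have hx := norm_pos_iff.mpr h.ne_zero
  obtain ⟨⟨c, hc, h1⟩, h2⟩ := h
  refine le_of_forall_pos_le_add fun η hη => ?_
  obtain ⟨K, hK, h3⟩ := hb.1 η hη
  refine exp_compare_s19 hc (K := K * ‖x‖) (by positivity) fun t ht => ?_
  have := (h1 t ht).trans (h3 t ht x)
  linarith

/-- a bound by rate `s+η` for all `η` bounds the exponent -/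
lemma HasExp.le_of_bound {A : Matrix (Fin d) (Fin d) ℝ} {x : Euc d} {a s : ℝ} (h : HasExp A x a)
    (hb : ∀ η > 0, ∃ K > 0, ∀ t : ℝ, 0 ≤ t → ‖linFlow A t x‖ ≤ K * Real.exp ((s + η) * t)) :
    a ≤ s := by
  obtain ⟨⟨c, hc, h1⟩, h2⟩ := h
  refine le_of_forall_pos_le_add fun η hη => ?_
  obtain ⟨K, hK, h3⟩ := hb η hη
  exact exp_compare_s19 hc hK fun t ht => (h1 t ht).trans (h3 t ht)

lemma HasExp.lyap_eq {A : Matrix (Fin d) (Fin d) ℝ} {x : Euc d} {a : ℝ} (h : HasExp A x a) :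
    lyap A x = a := by
  have hx := h.ne_zero
  obtain ⟨⟨c, hc, h1⟩, h2⟩ := h
  apply Tendsto.limsup_eq
  rw [Metric.tendsto_nhds]
  intro ε hε
  obtain ⟨K, hK, h3⟩ := h2 (ε / 2) (by positivity)
  have e1 : Tendsto (fun t : ℝ => ε / 2 * t) atTop atTop :=
    tendsto_id.const_mul_atTop (by linarith)
  filter_upwards [e1.eventually_gt_atTop (|Real.log c|), e1.eventually_gt_atTop (|Real.log K|),
    eventually_gt_atTop 0] with t ht1 ht2 ht
  have p1 := Real.log_le_log (by positivity) (h1 t ht.le)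
  have p2 := Real.log_le_log (norm_pos_iff.mpr (linFlow_ne_zero A t hx)) (h3 t ht.le)
  rw [Real.log_mul hc.ne' (Real.exp_pos _).ne', Real.log_exp] at p1
  rw [Real.log_mul hK.ne' (Real.exp_pos _).ne', Real.log_exp] at p2
  have q1 := neg_abs_le (Real.log c)
  have q2 := le_abs_self (Real.log K)
  rw [Real.dist_eq, abs_lt]
  constructor
  · rw [lt_sub_iff_add_lt, lt_div_iff₀ ht]
    nlinarith
  · rw [sub_lt_iff_lt_add, div_lt_iff₀ ht]
    nlinarith

lemma HasExp.mem_lyapSet {A : Matrix (Fin d) (Fin d) ℝ} {x : Euc d} {a s : ℝ} (h : HasExp A x a) :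
    x ∈ lyapSet A s ↔ a ≤ s := by
  simp [lyapSet, h.ne_zero, h.lyap_eq]

lemma mem_lyapSet_iff {A : Matrix (Fin d) (Fin d) ℝ} {x : Euc d} {s : ℝ} :
    x ∈ lyapSet A s ↔
    ∀ η > 0, ∃ K > 0, ∀ t : ℝ, 0 ≤ t → ‖linFlow A t x‖ ≤ K * Real.exp ((s + η) * t) := by
  by_cases hx : x = 0
  · subst hx
    simp only [lyapSet, Set.mem_ofPred_eq, true_or, true_iff, linFlow_zero, norm_zero]
    exact fun η hη => ⟨1, one_pos, fun t _ => by positivity⟩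
  · obtain ⟨a, ha⟩ := hasExp_exists A hx
    rw [ha.mem_lyapSet]
    refine ⟨fun has η hη => ?_, ha.le_of_bound⟩
    obtain ⟨K, hK, h⟩ := ha.2 η hη
    refine ⟨K, hK, fun t ht => (h t ht).trans ?_⟩
    gcongr

/-- The Lyapunov set as a subspace. -/
def lyapSub (A : Matrix (Fin d) (Fin d) ℝ) (s : ℝ) : Submodule ℝ (Euc d) where
  carrier := lyapSet A s
  zero_mem' := Or.inl rfl
  add_mem' {x y} hx hy := by
    rw [mem_lyapSet_iff] at *
    intro η hη
    obtain ⟨K, hK, h⟩ := hx η hη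
    obtain ⟨K', hK', h'⟩ := hy η hη
    refine ⟨K + K', by positivity, fun t ht => ?_⟩
    rw [linFlow_add, add_mul]
    exact (norm_add_le _ _).trans (add_le_add (h t ht) (h' t ht))
  smul_mem' r x hx := by
    rw [mem_lyapSet_iff] at *
    intro η hη
    obtain ⟨K, hK, h⟩ := hx η hη
    refine ⟨(|r| + 1) * K, by positivity, fun t ht => ?_⟩
    rw [linFlow_smul, norm_smul, mul_assoc, Real.norm_eq_abs]
    have := h t ht
    gcongr
    linarith

lemma ell_eq (A : Matrix (Fin d) (Fin d) ℝ) (s : ℝ) :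
    ell A s = Module.finrank ℝ (lyapSub A s) := by
  have : Submodule.span ℝ (lyapSet A s) = lyapSub A s := Submodule.span_eq (lyapSub A s)
  rw [ell, this]

end RealFlow


/-! ### The key estimate -/

section Key

lemma exp_log_le {P Q p q : ℝ} (hP : 0 < P) (hQ : 0 < Q) (h : P * Real.exp p ≤ Q * Real.exp q) :
    p ≤ q + (Real.log Q - Real.log P) := by
  have h2 := Real.log_le_log (by positivity) h
  rw [Real.log_mul hP.ne' (Real.exp_pos _).ne', Real.log_mul hQ.ne' (Real.exp_pos _).ne',
    Real.log_exp, Real.log_exp] at h2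
  linarith

lemma mul_exp_rpow {M z γ : ℝ} (hM : 0 ≤ M) : (M * Real.exp z) ^ γ = M ^ γ * Real.exp (γ * z) := by
  rw [Real.mul_rpow hM (Real.exp_pos _).le, ← Real.exp_mul, mul_comm z]

lemma exists_small_s19 {e ε : ℝ} (he : 0 < e) (hε : 0 < ε) (M : ℝ) : ∃ η > 0, η < e ∧ η * M < ε := by
  refine ⟨min (e / 2) (ε / (2 * (|M| + 1))), by positivity, ?_, ?_⟩
  · exact (min_le_left _ _).trans_lt (by linarith)
  · have h0 : 0 < min (e / 2) (ε / (2 * (|M| + 1))) := by positivity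
    calc min (e / 2) (ε / (2 * (|M| + 1))) * M
        ≤ min (e / 2) (ε / (2 * (|M| + 1))) * (|M| + 1) := by
          gcongr; linarith [le_abs_self M]
      _ ≤ (ε / (2 * (|M| + 1))) * (|M| + 1) := by gcongr; exact min_le_right _ _
      _ = ε / 2 := by field_simp
      _ < ε := by linarith

lemma holder_local {h : Euc d ≃ₜ Euc d} (hmem : MemH1minus h) {γ : ℝ} (h0 : 0 < γ) (h1 : γ < 1) :
    ∃ r > 0, ∃ K > 0, (∀ x y : Euc d, ‖x‖ < r → ‖y‖ < r → ‖h x - h y‖ ≤ K * ‖x - y‖ ^ γ) ∧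
      (∀ x y : Euc d, ‖x‖ < r → ‖y‖ < r → ‖h.symm x - h.symm y‖ ≤ K * ‖x - y‖ ^ γ) := by
  obtain ⟨-, ⟨r, hr, K, hK⟩, ⟨r', hr', K', hK'⟩⟩ := hmem γ h0 h1
  refine ⟨min r r', lt_min hr hr', |K| + |K'| + 1, by positivity, fun x y hx hy => ?_,
    fun x y hx hy => ?_⟩
  · have := hK x (by simpa using hx.trans_le (min_le_left _ _)) y
      (by simpa using hy.trans_le (min_le_left _ _))
    rw [dist_eq_norm, dist_eq_norm] at this
    refine this.trans ?_
    gcongr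
    linarith [le_abs_self K, abs_nonneg K']
  · have := hK' x (by simpa using hx.trans_le (min_le_right _ _)) y
      (by simpa using hy.trans_le (min_le_right _ _))
    rw [dist_eq_norm, dist_eq_norm] at this
    refine this.trans ?_
    gcongr
    linarith [le_abs_self K', abs_nonneg K]

lemma h_zero {h : Euc d ≃ₜ Euc d} (hmem : MemH1minus h) : h 0 = 0 :=
  (hmem (1 / 2) (by norm_num) (by norm_num)).1

lemma h_symm_zero {h : Euc d ≃ₜ Euc d} (hmem : MemH1minus h) : h.symm 0 = 0 := by
  rw [Homeomorph.symm_apply_eq, h_zero hmem]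

lemma h_ne_zero {h : Euc d ≃ₜ Euc d} (hmem : MemH1minus h) {x : Euc d} (hx : x ≠ 0) : h x ≠ 0 := by
  rw [← h_zero hmem]; exact h.injective.ne hx

lemma memH1minus_symm {h : Euc d ≃ₜ Euc d} (hmem : MemH1minus h) : MemH1minus h.symm :=
  fun γ h0 h1 => ⟨h_symm_zero hmem, (hmem γ h0 h1).2.2, (hmem γ h0 h1).2.1⟩

lemma isOrbitEquiv_symm {A B : Matrix (Fin d) (Fin d) ℝ} {h : Euc d ≃ₜ Euc d}
    (hrel : IsOrbitEquiv A B h) : IsOrbitEquiv B A h.symm := by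
  intro y
  have := hrel (h.symm y)
  rw [Homeomorph.apply_symm_apply] at this
  rw [← this, ← Set.image_comp]
  simp

lemma IsOrbitEquiv.exists_time {A B : Matrix (Fin d) (Fin d) ℝ} {h : Euc d ≃ₜ Euc d}
    (hrel : IsOrbitEquiv A B h) (x : Euc d) (t : ℝ) :
    ∃ τ, h (linFlow A t x) = linFlow B τ (h x) := by
  have : h (linFlow A t x) ∈ flowOrbit B (h x) := by
    rw [← hrel x]; exact ⟨_, ⟨t, rfl⟩, rfl⟩
  obtain ⟨τ, hτ⟩ := this
  exact ⟨τ, hτ.symm⟩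

set_option maxHeartbeats 1000000 in
lemma key_core {A B : Matrix (Fin d) (Fin d) ℝ} (hA : IsStable A)
    {h : Euc d ≃ₜ Euc d} (hmem : MemH1minus h) (hrel : IsOrbitEquiv A B h) {x : Euc d}
    {a a' b b' θ η : ℝ} (ha : HasExp A x a) (ha' : HasExp B (h x) a') (hb : IsTop A b)
    (hb' : IsTop B b') (hlt : a' < b') (hθ : 0 < θ)
    (hη : 0 < η) (hη1 : η < 1) (hηb : b + η < 0) (hηb' : b' + η < 0)
    (hηθ : (b + η) * θ - (1 - η) < a * θ) :
    ∃ u ≥ 0, -1 + b' * u ≤ (1 - η) * ((b + η) * θ - (1 - η)) + η ∧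
      a * θ ≤ (1 - η) * max ((a' + η) * u) (-1 + (b' + η) * u) + η := by
  set γ := 1 - η with hγ
  have hγ0 : 0 < γ := by linarith
  obtain ⟨r, hr, K, hK, hh, hhs⟩ := holder_local hmem hγ0 (by linarith : γ < 1)
  -- move the base point close to the origin
  have hTex : ∃ T, ‖linFlow A T x‖ < r ∧ ‖h (linFlow A T x)‖ < r := by
    have t1 : Tendsto (fun t => linFlow A t x) atTop (𝓝 0) := hA x
    have t2 : Tendsto (fun t => h (linFlow A t x)) atTop (𝓝 0) := by
      have := (h.continuous.tendsto 0).comp t1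
      rwa [h_zero hmem] at this
    have e1 := t1.norm.eventually (gt_mem_nhds (by simpa using hr))
    have e2 := t2.norm.eventually (gt_mem_nhds (by simpa using hr))
    exact (e1.and e2).exists
  obtain ⟨T, hT1, hT2⟩ := hTex
  obtain ⟨σ, hσ⟩ := hrel.exists_time x T
  replace ha := ha.shift T
  replace ha' := ha'.shift σ
  rw [← hσ] at ha'
  generalize linFlow A T x = x1 at *
  set y1 := h x1 with hy1
  have hy1pos : 0 < ‖y1‖ := norm_pos_iff.mpr ha'.ne_zero
  obtain ⟨⟨c, hc, hlow⟩, -⟩ := ha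
  obtain ⟨C1, hC1, hup1⟩ := ha'.2 η hη
  obtain ⟨C2, hC2, hup2⟩ := hb.1 η hη
  obtain ⟨C3, hC3, hup3⟩ := hb'.1 η hη
  obtain ⟨-, ξ, w, hw, hξ⟩ := hb'
  have hw0 : 0 < ‖w‖ := by
    rw [norm_pos_iff]; rintro rfl; simp at hw
  have hξw : 0 < ‖ξ w‖ := norm_pos_iff.mpr hw
  -- the functional vanishes on the orbit of `y1`
  have hξy : ξ y1 = 0 := by
    by_contra hne
    have : b' ≤ a' := by
      refine le_of_forall_pos_le_add fun ε hε => ?_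
      obtain ⟨M, hM, hMb⟩ := ha'.2 ε hε
      refine exp_compare_s19 (norm_pos_iff.mpr hne) (K := (‖ξ‖ + 1) * M) (by positivity) fun t ht => ?_
      rw [mul_comm, ← hξ]
      refine (ξ.le_opNorm _).trans ?_
      rw [mul_assoc]
      have := hMb t ht
      gcongr
      linarith
    linarith
  -- small radius
  obtain ⟨r2, hr2, hr2r, hr2h⟩ : ∃ r2 > 0, r2 ≤ r ∧ ∀ z : Euc d, ‖z‖ < r2 →
      ‖h z‖ < min r (‖y1‖ / 2 / C3) := by
    have t0 : Tendsto (fun z => ‖h z‖) (𝓝 0) (𝓝 0) := by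
      have := (h.continuous.tendsto 0).norm
      rwa [h_zero hmem, norm_zero] at this
    have := t0.eventually (gt_mem_nhds (show 0 < min r (‖y1‖ / 2 / C3) by positivity))
    obtain ⟨ε, hε, hball⟩ := Metric.eventually_nhds_iff.mp this
    exact ⟨min ε r, by positivity, min_le_right _ _,
      fun z hz => hball (by simpa using hz.trans_le (min_le_left _ _))⟩
  set M := C2 * (K * ‖w‖ ^ γ) with hM
  have hMpos : 0 < M := by positivity
  set N := C1 + C3 * ‖w‖ with hN
  have hNpos : 0 < N := by positivity
  set D1 := Real.log ((‖ξ‖ + 1) * K * M ^ γ) - Real.log ‖ξ w‖ with hD1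
  set D2 := Real.log (K * N ^ γ) - Real.log (c / 2) with hD2
  -- eventual conditions in `s`
  have tδ : Tendsto (fun s : ℝ => Real.exp (-s)) atTop (𝓝 0) := Real.tendsto_exp_neg_atTop_nhds_zero
  have ty : Tendsto (fun s : ℝ => y1 + Real.exp (-s) • w) atTop (𝓝 y1) := by
    have := (tδ.smul_const w).const_add y1
    simpa using this
  have tx : Tendsto (fun s : ℝ => h.symm (y1 + Real.exp (-s) • w)) atTop (𝓝 x1) := by
    have := (h.symm.continuous.tendsto y1).comp ty
    rw [hy1, Homeomorph.symm_apply_apply] at this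
    exact this
  have texp : ∀ k : ℝ, k < 0 → Tendsto (fun s : ℝ => Real.exp (k * s)) atTop (𝓝 0) := by
    intro k hk
    exact Real.tendsto_exp_atBot.comp (tendsto_id.const_mul_atTop_of_neg hk)
  have tsmall : Tendsto (fun s : ℝ => C2 * Real.exp ((b + η) * θ * s) * r) atTop (𝓝 0) := by
    have := ((texp ((b + η) * θ) (mul_neg_of_neg_of_pos hηb hθ)).const_mul C2).mul_const r
    simpa using this
  have tpre : Tendsto (fun s : ℝ => M * Real.exp (((b + η) * θ - γ - a * θ) * s)) atTop (𝓝 0) := by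
    have := (texp ((b + η) * θ - γ - a * θ) (by linarith)).const_mul M
    simpa using this
  have e1 := ty.norm.eventually (gt_mem_nhds hT2)
  have e2 := ty.norm.eventually (lt_mem_nhds (show ‖y1‖ / 2 < ‖y1‖ by linarith))
  have e3 := tx.norm.eventually (gt_mem_nhds hT1)
  have e4 := tsmall.eventually (gt_mem_nhds hr2)
  have e5 := tpre.eventually (gt_mem_nhds (show 0 < c / 2 by positivity))
  have tlin : Tendsto (fun s : ℝ => η * s) atTop atTop := tendsto_id.const_mul_atTop hη
  have e6 := tlin.eventually_ge_atTop D1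
  have e7 := tlin.eventually_ge_atTop D2
  obtain ⟨s, h1, h2, h3, h4, h5, h6, h7, hs⟩ := (e1.and (e2.and (e3.and (e4.and (e5.and (e6.and
    (e7.and (eventually_gt_atTop 0)))))))).exists
  set yd := y1 + Real.exp (-s) • w with hyd
  set xd := h.symm yd with hxd
  have hhxd : h xd = yd := by simp [hxd]
  set t := θ * s with ht
  have ht0 : 0 ≤ t := by positivity
  -- distance between the two orbits
  have hv : ‖xd - x1‖ ≤ K * ‖w‖ ^ γ * Real.exp (-(γ * s)) := by
    have := hhs yd y1 h1 hT2
    rw [← hxd, show h.symm y1 = x1 by simp [hy1]] at this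
    refine this.trans_eq ?_
    rw [hyd, add_sub_cancel_left, norm_smul, Real.norm_eq_abs, abs_of_pos (Real.exp_pos _),
      mul_comm (Real.exp _), mul_exp_rpow hw0.le]
    ring_nf
  have hdist : ‖linFlow A t xd - linFlow A t x1‖ ≤ M * Real.exp (((b + η) * θ - γ) * s) := by
    rw [← linFlow_sub]
    refine (hup2 t ht0 _).trans ?_
    calc C2 * Real.exp ((b + η) * t) * ‖xd - x1‖
        ≤ C2 * Real.exp ((b + η) * t) * (K * ‖w‖ ^ γ * Real.exp (-(γ * s))) := by gcongr
      _ = M * (Real.exp ((b + η) * t) * Real.exp (-(γ * s))) := by rw [hM]; ring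
      _ = _ := by rw [← Real.exp_add]; congr 2; rw [ht]; ring
  have hxsmall : ∀ z : Euc d, ‖z‖ < r → ‖linFlow A t z‖ < r2 := by
    intro z hz
    refine lt_of_le_of_lt (hup2 t ht0 z) (lt_of_le_of_lt ?_ h4)
    rw [show (b + η) * θ * s = (b + η) * t by rw [ht]; ring]
    gcongr
  obtain ⟨τ, hτ⟩ := hrel.exists_time xd t
  obtain ⟨τ1, hτ1⟩ := hrel.exists_time x1 t
  rw [hhxd] at hτ
  have him := hr2h _ (hxsmall xd h3)
  have him_r := him.trans_le (min_le_left _ _)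
  have him_m := him.trans_le (min_le_right _ _)
  -- positivity of time
  have hτ0 : 0 ≤ τ := by
    by_contra! hneg
    have hback := hup3 (-τ) (by linarith) (linFlow B τ yd)
    rw [linFlow_neg_cancel, ← hτ] at hback
    have hle1 : Real.exp ((b' + η) * -τ) ≤ 1 := by
      rw [Real.exp_le_one_iff]; exact mul_nonpos_of_nonpos_of_nonneg hηb'.le (by linarith)
    have : ‖yd‖ ≤ C3 * ‖h (linFlow A t xd)‖ := by
      refine hback.trans ?_
      gcongr
      exact mul_le_of_le_one_right hC3.le hle1
    rw [lt_div_iff₀ hC3] at him_m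
    linarith
  have hxd_r := (hxsmall xd h3).trans_le hr2r
  have hx1_r := (hxsmall x1 hT1).trans_le hr2r
  have hI : ‖ξ w‖ * Real.exp (-s + b' * τ)
      ≤ (‖ξ‖ + 1) * K * M ^ γ * Real.exp (γ * (((b + η) * θ - γ) * s)) := by
    have q1 : ‖ξ (linFlow B τ yd)‖ = ‖ξ w‖ * Real.exp (-s + b' * τ) := by
      rw [hξ, hyd, map_add, map_smul, hξy, zero_add, norm_smul, Real.norm_eq_abs,
        abs_of_pos (Real.exp_pos _), Real.exp_add]
      ring
    have q2 : ξ (h (linFlow A t x1)) = 0 := by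
      rw [hτ1, ← norm_eq_zero, hξ, ← hy1, hξy]; simp
    have q3 : ξ (linFlow B τ yd) = ξ (h (linFlow A t xd) - h (linFlow A t x1)) := by
      rw [map_sub, q2, sub_zero, hτ]
    rw [← q1, q3]
    calc ‖ξ (h (linFlow A t xd) - h (linFlow A t x1))‖
        ≤ ‖ξ‖ * ‖h (linFlow A t xd) - h (linFlow A t x1)‖ := ξ.le_opNorm _
      _ ≤ (‖ξ‖ + 1) * (K * ‖linFlow A t xd - linFlow A t x1‖ ^ γ) := by
          have := hh _ _ hxd_r hx1_r
          gcongr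
          linarith
      _ ≤ (‖ξ‖ + 1) * (K * (M * Real.exp (((b + η) * θ - γ) * s)) ^ γ) := by gcongr
      _ = _ := by rw [mul_exp_rpow hMpos.le]; ring
  have hII : c / 2 * Real.exp (a * θ * s)
      ≤ K * N ^ γ * Real.exp (γ * max ((a' + η) * τ) (-s + (b' + η) * τ)) := by
    have q1 : M * Real.exp (((b + η) * θ - γ) * s) ≤ c / 2 * Real.exp (a * θ * s) := by
      have : Real.exp (((b + η) * θ - γ) * s)
          = Real.exp (((b + η) * θ - γ - a * θ) * s) * Real.exp (a * θ * s) := by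
        rw [← Real.exp_add]; congr 1; ring
      rw [this, ← mul_assoc]
      gcongr
    have q2 : c * Real.exp (a * θ * s) ≤ ‖linFlow A t x1‖ := by
      have := hlow t ht0
      rwa [ht, ← mul_assoc] at this
    have q3 : c / 2 * Real.exp (a * θ * s) ≤ ‖linFlow A t xd‖ := by
      have := norm_sub_norm_le (linFlow A t x1) (linFlow A t xd)
      rw [norm_sub_rev] at this
      linarith
    have q4 : ‖linFlow A t xd‖ ≤ K * ‖linFlow B τ yd‖ ^ γ := by
      have := hhs (h (linFlow A t xd)) 0 him_r (by simpa using hr)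
      rwa [h_symm_zero hmem, sub_zero, sub_zero, Homeomorph.symm_apply_apply, hτ] at this
    set m := max ((a' + η) * τ) (-s + (b' + η) * τ) with hm
    have q5 : ‖linFlow B τ yd‖ ≤ N * Real.exp m := by
      rw [hyd, linFlow_add, linFlow_smul]
      refine (norm_add_le _ _).trans ?_
      rw [norm_smul, Real.norm_eq_abs, abs_of_pos (Real.exp_pos _), hN, add_mul]
      have p1 : Real.exp ((a' + η) * τ) ≤ Real.exp m := Real.exp_le_exp.mpr (le_max_left _ _)
      have p2 : Real.exp (-s + (b' + η) * τ) ≤ Real.exp m := Real.exp_le_exp.mpr (le_max_right _ _)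
      refine add_le_add ((hup1 τ hτ0).trans (by gcongr)) ?_
      calc Real.exp (-s) * ‖linFlow B τ w‖
          ≤ Real.exp (-s) * (C3 * Real.exp ((b' + η) * τ) * ‖w‖) := by
            have := hup3 τ hτ0 w
            gcongr
        _ = C3 * ‖w‖ * Real.exp (-s + (b' + η) * τ) := by rw [Real.exp_add]; ring
        _ ≤ _ := by gcongr
    calc c / 2 * Real.exp (a * θ * s) ≤ K * ‖linFlow B τ yd‖ ^ γ := q3.trans q4
      _ ≤ K * (N * Real.exp m) ^ γ := by gcongr
      _ = _ := by rw [mul_exp_rpow hNpos.le]; ring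
  have hI' := exp_log_le hξw (by positivity) hI
  have hII' := exp_log_le (by positivity) (by positivity) hII
  rw [← hD1] at hI'
  rw [← hD2] at hII'
  refine ⟨τ / s, by positivity, ?_, ?_⟩
  · refine le_of_mul_le_mul_right ?_ hs
    have : (-1 + b' * (τ / s)) * s = -s + b' * τ := by field_simp
    rw [this]
    linarith
  · refine le_of_mul_le_mul_right ?_ hs
    have : max ((a' + η) * (τ / s)) (-1 + (b' + η) * (τ / s)) * s
        = max ((a' + η) * τ) (-s + (b' + η) * τ) := by
      rw [max_mul_of_nonneg _ _ hs.le]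
      congr 1 <;> field_simp
    rw [add_mul, mul_assoc γ, this]
    linarith

set_option maxHeartbeats 1000000 in
lemma key_ineq {A B : Matrix (Fin d) (Fin d) ℝ} (hA : IsStable A) (hB : IsStable B)
    {h : Euc d ≃ₜ Euc d} (hmem : MemH1minus h) (hrel : IsOrbitEquiv A B h) {x : Euc d}
    {a a' b b' : ℝ} (ha : HasExp A x a) (ha' : HasExp B (h x) a') (hb : IsTop A b)
    (hb' : IsTop B b') : a' * b ≤ a * b' := by
  have hab := ha.le_top hb
  have hab' := ha'.le_top hb'
  have na := ha.neg hA
  have na' := ha'.neg hB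
  have nb := hb.neg hA
  have nb' := hb'.neg hB
  rcases hab'.eq_or_lt with heq | hlt
  · rw [heq]; nlinarith
  set θ := 1 / (b - a + 1) with hθd
  have hθ : 0 < θ := by have : 0 < b - a + 1 := by linarith
                        positivity
  have hθe : (b - a) * θ = 1 - θ := by
    have : b - a + 1 ≠ 0 := by linarith
    rw [hθd]; field_simp; ring
  have core : ∀ ε > 0, ∃ u ≥ 0, b' * u ≤ b * θ + ε ∧
      (a * θ ≤ a' * u + ε ∨ a * θ ≤ -1 + b' * u + ε) := by
    intro ε hε
    set U := 4 * (1 - a * θ) / (-b') with hU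
    have hU0 : 0 ≤ U := by
      apply div_nonneg <;> nlinarith
    obtain ⟨η, hη, hηe, hηM⟩ := exists_small_s19
      (e := min (min (1 / 2) (-b / 2)) (min (-b' / 2) (θ / (1 + θ)))) (ε := ε)
      (by have : 0 < -b := by linarith
          have : 0 < -b' := by linarith
          positivity) hε (θ * (1 - b) + 3 + U + (1 - b' * U))
    rw [lt_min_iff, lt_min_iff, lt_min_iff] at hηe
    obtain ⟨⟨g1, g2⟩, g3, g4⟩ := hηe
    rw [lt_div_iff₀ (by positivity)] at g4
    obtain ⟨u, hu, i1, i2⟩ := key_core hA hmem hrel ha ha' hb hb' hlt hθ hη (by linarith)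
      (by linarith) (by linarith) (by nlinarith)
    have hbU : 0 ≤ -b' * U := by nlinarith
    have hbθ : 0 ≤ θ * (1 - b) := by nlinarith
    have hmax_le : max ((a' + η) * u) (-1 + (b' + η) * u) ≤ (b' + η) * u := by
      apply max_le
      · gcongr
      · linarith
    have huU : u ≤ U := by
      rw [hU, le_div_iff₀ (by linarith)]
      have s1 : (1 - η) * max ((a' + η) * u) (-1 + (b' + η) * u) ≤ (1 - η) * ((b' + η) * u) :=
        mul_le_mul_of_nonneg_left hmax_le (by linarith)
      have s2 : (b' + η) * u ≤ b' / 2 * u := by gcongr; linarith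
      have s3 : b' / 2 * u ≤ 0 := by nlinarith
      have s4 : (1 - η) * ((b' + η) * u) ≤ b' / 4 * u := by nlinarith
      nlinarith
    have hexp : η * (θ * (1 - b)) + η * 3 + η * U + η * (1 - b' * U) < ε := by
      have : η * (θ * (1 - b) + 3 + U + (1 - b' * U))
        = η * (θ * (1 - b)) + η * 3 + η * U + η * (1 - b' * U) := by ring
      linarith
    have p1 : 0 ≤ η * U := by positivity
    have p2 : 0 ≤ η * (1 - b' * U) := mul_nonneg hη.le (by linarith)
    have p3 : 0 ≤ η * (θ * (1 - b)) := mul_nonneg hη.le hbθ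
    refine ⟨u, hu, ?_, ?_⟩
    · have : (1 - η) * ((b + η) * θ - (1 - η)) ≤ b * θ - 1 + η * (θ * (1 - b) + 2) := by
        have : 0 ≤ η ^ 2 * θ := by positivity
        nlinarith [sq_nonneg η]
      rw [mul_add] at this
      linarith
    · set m := max ((a' + η) * u) (-1 + (b' + η) * u) with hm
      have m1 : -1 + b' * U ≤ m := by
        refine le_trans ?_ (le_max_right _ _)
        nlinarith
      have m2 : (1 - η) * m ≤ m + η * (1 - b' * U) := by nlinarith
      have hηu : η * u ≤ η * U := by gcongr
      rcases le_total ((a' + η) * u) (-1 + (b' + η) * u) with hc | hc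
      · right
        have : m = -1 + (b' + η) * u := max_eq_right hc
        rw [add_mul] at this
        linarith
      · left
        have : m = (a' + η) * u := max_eq_left hc
        rw [add_mul] at this
        linarith
  by_contra! hcon
  obtain ⟨ε, hε, he1, he2⟩ := exists_small_s19 (e := θ / 2) (ε := (a' * b - a * b') * θ)
    (by positivity) (by have : 0 < a' * b - a * b' := by linarith
                        positivity) (-(a' + b'))
  obtain ⟨u, hu, i1, i2 | i2⟩ := core ε hε
  · have s1 : -b' * (a * θ) ≤ -b' * (a' * u + ε) := mul_le_mul_of_nonneg_left i2 (by linarith)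
    have s2 : -a' * (b' * u) ≤ -a' * (b * θ + ε) := mul_le_mul_of_nonneg_left i1 (by linarith)
    nlinarith
  · nlinarith

end Key


section Tau

set_option maxHeartbeats 1000000 in
lemma tau_core {A B : Matrix (Fin d) (Fin d) ℝ} (hA : IsStable A)
    {h : Euc d ≃ₜ Euc d} (hmem : MemH1minus h) {x : Euc d}
    {a a' b' η : ℝ} (ha : HasExp A x a) (ha' : HasExp B (h x) a')
    (hb' : IsTop B b') {τ : ℝ → ℝ} (hτ : ∀ t, h (linFlow A t x) = linFlow B (τ t) (h x))
    (hη : 0 < η) (hη1 : η < 1) (hηb' : b' + η < 0) :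
    ∀ᶠ t in atTop, 0 < t ∧ 0 ≤ τ t / t ∧
      a ≤ (1 - η) * ((a' + η) * (τ t / t)) + η ∧
      a' * (τ t / t) ≤ (1 - η) * (a + η) + η := by
  set γ := 1 - η with hγ
  have hγ0 : 0 < γ := by linarith
  obtain ⟨r, hr, K, hK, hh, hhs⟩ := holder_local hmem hγ0 (by linarith : γ < 1)
  have t1 : Tendsto (fun t => linFlow A t x) atTop (𝓝 0) := hA x
  have t2 : Tendsto (fun t => h (linFlow A t x)) atTop (𝓝 0) := by
    have := (h.continuous.tendsto 0).comp t1
    rwa [h_zero hmem] at this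
  have hy := norm_pos_iff.mpr ha'.ne_zero
  obtain ⟨C3, hC3, hup3⟩ := hb'.1 η hη
  obtain ⟨C1, hC1, hup1⟩ := ha'.2 η hη
  obtain ⟨C2, hC2, hup2⟩ := ha.2 η hη
  obtain ⟨⟨c, hc, hlow⟩, -⟩ := ha
  obtain ⟨⟨c', hc', hlow'⟩, -⟩ := ha'
  have hsm : 0 < min r (‖h x‖ / C3) := by positivity
  have e1 := t1.norm.eventually (gt_mem_nhds (by simpa using hr))
  have e2 := t2.norm.eventually (gt_mem_nhds (by rw [norm_zero]; exact hsm))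
  have tlin : Tendsto (fun s : ℝ => η * s) atTop atTop := tendsto_id.const_mul_atTop hη
  filter_upwards [e1, e2, eventually_gt_atTop 0,
    tlin.eventually_ge_atTop (Real.log (K * C1 ^ γ) - Real.log c),
    tlin.eventually_ge_atTop (Real.log (K * C2 ^ γ) - Real.log c')] with t h1 h2 ht h3 h4
  have h2r := h2.trans_le (min_le_left _ _)
  have h2m := h2.trans_le (min_le_right _ _)
  have hτ0 : 0 ≤ τ t := by
    by_contra! hneg
    have hback := hup3 (-τ t) (by linarith) (linFlow B (τ t) (h x))
    rw [linFlow_neg_cancel, ← hτ] at hback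
    have hle1 : Real.exp ((b' + η) * -τ t) ≤ 1 := by
      rw [Real.exp_le_one_iff]; exact mul_nonpos_of_nonpos_of_nonneg hηb'.le (by linarith)
    have : ‖h x‖ ≤ C3 * ‖h (linFlow A t x)‖ := by
      refine hback.trans ?_
      gcongr
      exact mul_le_of_le_one_right hC3.le hle1
    rw [lt_div_iff₀ hC3] at h2m
    linarith
  have hI : c * Real.exp (a * t) ≤ K * C1 ^ γ * Real.exp (γ * ((a' + η) * τ t)) := by
    have q4 : ‖linFlow A t x‖ ≤ K * ‖linFlow B (τ t) (h x)‖ ^ γ := by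
      have := hhs (h (linFlow A t x)) 0 h2r (by simpa using hr)
      rwa [h_symm_zero hmem, sub_zero, sub_zero, Homeomorph.symm_apply_apply, hτ] at this
    calc c * Real.exp (a * t) ≤ K * ‖linFlow B (τ t) (h x)‖ ^ γ := (hlow t ht.le).trans q4
      _ ≤ K * (C1 * Real.exp ((a' + η) * τ t)) ^ γ := by
          have := hup1 (τ t) hτ0
          gcongr
      _ = _ := by rw [mul_exp_rpow hC1.le]; ring
  have hII : c' * Real.exp (a' * τ t) ≤ K * C2 ^ γ * Real.exp (γ * ((a + η) * t)) := by
    have q4 : ‖linFlow B (τ t) (h x)‖ ≤ K * ‖linFlow A t x‖ ^ γ := by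
      have := hh (linFlow A t x) 0 h1 (by simpa using hr)
      rwa [h_zero hmem, sub_zero, sub_zero, hτ] at this
    calc c' * Real.exp (a' * τ t) ≤ K * ‖linFlow A t x‖ ^ γ := (hlow' _ hτ0).trans q4
      _ ≤ K * (C2 * Real.exp ((a + η) * t)) ^ γ := by
          have := hup2 t ht.le
          gcongr
      _ = _ := by rw [mul_exp_rpow hC2.le]; ring
  have hI' := exp_log_le hc (by positivity) hI
  have hII' := exp_log_le hc' (by positivity) hII
  refine ⟨ht, by positivity, ?_, ?_⟩
  · refine le_of_mul_le_mul_right ?_ ht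
    have : (γ * ((a' + η) * (τ t / t)) + η) * t = γ * ((a' + η) * τ t) + η * t := by field_simp
    rw [this]
    linarith
  · refine le_of_mul_le_mul_right ?_ ht
    have : (a' * (τ t / t)) * t = a' * τ t := by field_simp
    rw [this]
    linarith

set_option maxHeartbeats 1000000 in
lemma tau_limit {A B : Matrix (Fin d) (Fin d) ℝ} (hA : IsStable A) (hB : IsStable B)
    {h : Euc d ≃ₜ Euc d} (hmem : MemH1minus h) {x : Euc d}
    {a a' b' : ℝ} (ha : HasExp A x a) (ha' : HasExp B (h x) a')
    (hb' : IsTop B b') {τ : ℝ → ℝ} (hτ : ∀ t, h (linFlow A t x) = linFlow B (τ t) (h x)) :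
    Tendsto (fun t => τ t / t) atTop (𝓝 (a / a')) := by
  have na := ha.neg hA
  have na' := ha'.neg hB
  have nb' := hb'.neg hB
  suffices H : Tendsto (fun t => a' * (τ t / t)) atTop (𝓝 a) by
    have := H.const_mul a'⁻¹
    have e : ∀ z, a'⁻¹ * (a' * z) = z := fun z => inv_mul_cancel_left₀ na'.ne z
    simp only [e] at this
    rwa [inv_mul_eq_div] at this
  rw [Metric.tendsto_nhds]
  intro ε hε
  set U := 4 * (1 - a) / (-a') with hU
  have hU0 : 0 ≤ U := by apply div_nonneg <;> linarith
  obtain ⟨η, hη, hηe, hηM⟩ := exists_small_s19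
    (e := min (1 / 2) (min (-a' / 2) (-b' / 2))) (ε := ε)
    (by have : 0 < -a' := by linarith
        have : 0 < -b' := by linarith
        positivity) hε (U * (1 - a') + 1 + (2 - a))
  rw [lt_min_iff, lt_min_iff] at hηe
  obtain ⟨g1, g2, g3⟩ := hηe
  filter_upwards [tau_core hA hmem ha ha' hb' hτ hη (by linarith) (by linarith)]
    with t ⟨ht, hu, i1, i2⟩
  generalize τ t / t = u at *
  have s2 : (a' + η) * u ≤ a' / 2 * u := by gcongr; linarith
  have s3 : a' / 2 * u ≤ 0 := mul_nonpos_of_nonpos_of_nonneg (by linarith) hu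
  have s4 : (1 - η) * ((a' + η) * u) ≤ (1 - η) * (a' / 2 * u) :=
    mul_le_mul_of_nonneg_left s2 (by linarith)
  have s5 : (1 - η) * (a' / 2 * u) ≤ 1 / 2 * (a' / 2 * u) :=
    mul_le_mul_of_nonpos_right (by linarith) s3
  have huU : u ≤ U := by
    rw [hU, le_div_iff₀ (by linarith)]
    linarith
  have hexp : η * (U * (1 - a')) + η + η * (2 - a) < ε := by linarith
  have p1 : 0 ≤ η * (U * (1 - a')) :=
    mul_nonneg hη.le (mul_nonneg hU0 (by linarith))
  have p2 : 0 ≤ η * (2 - a) := mul_nonneg hη.le (by linarith)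
  have p3 : η * (u * (1 - a')) ≤ η * (U * (1 - a')) :=
    mul_le_mul_of_nonneg_left (mul_le_mul_of_nonneg_right huU (by linarith)) hη.le
  have p4 : 0 ≤ η * (η * u) := by positivity
  rw [Real.dist_eq, abs_lt]
  constructor
  · linarith
  · have : 0 ≤ η * η := by positivity
    linarith

end Tau

section Final

lemma exp_relation {A B : Matrix (Fin d) (Fin d) ℝ} (hA : IsStable A) (hB : IsStable B)
    {h : Euc d ≃ₜ Euc d} (hmem : MemH1minus h) (hrel : IsOrbitEquiv A B h) {x : Euc d}
    {a a' b b' : ℝ} (ha : HasExp A x a) (ha' : HasExp B (h x) a') (hb : IsTop A b)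
    (hb' : IsTop B b') : a = b / b' * a' := by
  have nb' := hb'.neg hB
  have h1 := key_ineq hA hB hmem hrel ha ha' hb hb'
  have h2 := key_ineq (x := h x) (a := a') (a' := a) hB hA (memH1minus_symm hmem)
    (isOrbitEquiv_symm hrel) ha' (by simpa using ha) hb' hb
  rw [div_mul_eq_mul_div, eq_div_iff nb'.ne]
  linarith

lemma image_lyapSet {A B : Matrix (Fin d) (Fin d) ℝ} (hA : IsStable A) (hB : IsStable B)
    {h : Euc d ≃ₜ Euc d} (hmem : MemH1minus h) (hrel : IsOrbitEquiv A B h)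
    {b b' : ℝ} (hb : IsTop A b) (hb' : IsTop B b') (s : ℝ) :
    h '' lyapSet A (b / b' * s) = lyapSet B s := by
  have hα : 0 < b / b' := div_pos_of_neg_of_neg (hb.neg hA) (hb'.neg hB)
  have key : ∀ x, x ∈ lyapSet A (b / b' * s) ↔ h x ∈ lyapSet B s := by
    intro x
    by_cases hx : x = 0
    · subst hx
      simp [lyapSet, h_zero hmem]
    · obtain ⟨a, ha⟩ := hasExp_exists A hx
      obtain ⟨a', ha'⟩ := hasExp_exists B (x := h x) (by
        intro h0
        apply hx
        rw [← h_zero hmem] at h0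
        exact h.injective h0)
      rw [ha.mem_lyapSet, ha'.mem_lyapSet, exp_relation hA hB hmem hrel ha ha' hb hb',
        mul_le_mul_iff_right₀ hα]
  ext y
  constructor
  · rintro ⟨x, hx, rfl⟩
    exact (key x).mp hx
  · intro hy
    exact ⟨h.symm y, (key _).mpr (by simpa using hy), by simp⟩

lemma dimH_sub_ball (S : Submodule ℝ (Euc d)) {r : ℝ} (hr : 0 < r) :
    dimH ((S : Set (Euc d)) ∩ Metric.ball 0 r) = Module.finrank ℝ S := by
  have h1 : ((S : Set (Euc d)) ∩ Metric.ball 0 r) = Subtype.val '' (Metric.ball (0 : S) r) := by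
    ext y
    simp only [Set.mem_inter_iff, SetLike.mem_coe, mem_ball_zero_iff, Set.mem_image,
      Subtype.exists, exists_and_right, exists_eq_right]
    constructor
    · rintro ⟨hy, hyr⟩; exact ⟨hy, by simpa using hyr⟩
    · rintro ⟨hy, hyr⟩; exact ⟨hy, by simpa using hyr⟩
  rw [h1, isometry_subtype_coe.dimH_image]
  apply Real.dimH_of_nonempty_interior
  rw [Metric.isOpen_ball.interior_eq]
  exact ⟨0, by simpa using hr⟩

lemma finrank_le_of_image {h : Euc d ≃ₜ Euc d} (hmem : MemH1minus h)
    (S S' : Submodule ℝ (Euc d)) (hS : h '' S ⊆ S') :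
    Module.finrank ℝ S ≤ Module.finrank ℝ S' := by
  have main : ∀ γ : ℝ, 0 < γ → γ < 1 →
      (Module.finrank ℝ S : ℝ) * γ ≤ Module.finrank ℝ S' := by
    intro γ h0 h1
    obtain ⟨r, hr, K, hK, hh, hhs⟩ := holder_local hmem h0 h1
    obtain ⟨r2, hr2, hr2h⟩ : ∃ r2 > 0, ∀ z : Euc d, ‖z‖ < r2 → ‖h z‖ < r := by
      have t0 : Tendsto (fun z => ‖h z‖) (𝓝 0) (𝓝 0) := by
        have := (h.continuous.tendsto 0).norm
        rwa [h_zero hmem, norm_zero] at this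
      obtain ⟨ε, hε, hball⟩ := Metric.eventually_nhds_iff.mp (t0.eventually (gt_mem_nhds hr))
      exact ⟨ε, hε, fun z hz => hball (by simpa using hz)⟩
    have hsub : (S : Set (Euc d)) ∩ Metric.ball 0 r2
        ⊆ h.symm '' ((S' : Set (Euc d)) ∩ Metric.ball 0 r) := by
      rintro z ⟨hz, hzr⟩
      refine ⟨h z, ⟨hS ⟨z, hz, rfl⟩, ?_⟩, by simp⟩
      simpa using hr2h z (by simpa using hzr)
    lift γ to NNReal using h0.le
    lift K to NNReal using hK.le
    have hH : HolderOnWith K γ h.symm ((S' : Set (Euc d)) ∩ Metric.ball 0 r) := by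
      intro p hp q hq
      have := hhs p q (by simpa using hp.2) (by simpa using hq.2)
      rw [← dist_eq_norm, ← dist_eq_norm] at this
      rw [edist_dist, edist_dist, ENNReal.ofReal_rpow_of_nonneg dist_nonneg h0.le]
      refine (ENNReal.ofReal_le_ofReal this).trans ?_
      rw [ENNReal.ofReal_mul hK.le, ENNReal.ofReal_coe_nnreal]
    have h0' : 0 < γ := by exact_mod_cast h0
    have h3 := (dimH_mono hsub).trans (hH.dimH_image_le h0')
    rw [dimH_sub_ball S hr2, dimH_sub_ball S' hr] at h3
    rw [ENNReal.le_div_iff_mul_le (Or.inl (by simpa using h0'.ne'))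
      (Or.inl ENNReal.coe_ne_top)] at h3
    have h4 := ENNReal.toReal_mono (by simp) h3
    simpa using h4
  have : (Module.finrank ℝ S : ℝ) ≤ Module.finrank ℝ S' := by
    have t : Tendsto (fun γ : ℝ => (Module.finrank ℝ S : ℝ) * γ) (𝓝[<] 1)
        (𝓝 ((Module.finrank ℝ S : ℝ) * 1)) :=
      ((continuous_const.mul continuous_id).tendsto (1 : ℝ)).mono_left nhdsWithin_le_nhds
    rw [mul_one] at t
    refine le_of_tendsto t ?_
    filter_upwards [Ioo_mem_nhdsLT (show (0 : ℝ) < 1 by norm_num)] with γ hγ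
    exact main γ hγ.1 hγ.2
  exact_mod_cast this

lemma ell_relation {A B : Matrix (Fin d) (Fin d) ℝ}
    {h : Euc d ≃ₜ Euc d} (hmem : MemH1minus h) {s s' : ℝ}
    (him : h '' lyapSet A s = lyapSet B s') : ell A s = ell B s' := by
  rw [ell_eq, ell_eq]
  apply le_antisymm
  · exact finrank_le_of_image hmem _ _ him.subset
  · refine finrank_le_of_image (memH1minus_symm hmem) _ _ ?_
    change h.symm '' lyapSet B s' ⊆ lyapSet A s
    rw [← him, ← Set.image_comp]
    simp

open scoped Pointwise in
lemma lyapExp_relation {A B : Matrix (Fin d) (Fin d) ℝ} {α : ℝ} (hα : 0 < α)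
    (hell : ∀ s, ell A (α * s) = ell B s) (j : ℕ) : lyapExp A j = α * lyapExp B j := by
  have : {s : ℝ | j + 1 ≤ ell A s} = α • {s : ℝ | j + 1 ≤ ell B s} := by
    ext s
    rw [Set.mem_smul_set_iff_inv_smul_mem₀ hα.ne']
    simp only [Set.mem_ofPred_eq, smul_eq_mul]
    rw [← hell, mul_inv_cancel_left₀ hα.ne']
  rw [lyapExp, this, Real.sInf_smul_of_nonneg hα.le, smul_eq_mul, lyapExp]

lemma alpha_le {A B : Matrix (Fin d) (Fin d) ℝ} (hA : IsStable A) (hd : 0 < d)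
    {h : Euc d ≃ₜ Euc d} {α β : ℝ} (hα : 0 < α)
    (h1 : ∀ s : ℝ, ⇑h '' lyapSet A (α * s) = lyapSet B s)
    (h2 : ∀ s : ℝ, ⇑h '' lyapSet A (β * s) = lyapSet B s) : β ≤ α := by
  have : Nonempty (Fin d) := ⟨⟨0, hd⟩⟩
  obtain ⟨x, hx⟩ := exists_ne (0 : Euc d)
  obtain ⟨a, ha⟩ := hasExp_exists A hx
  have na := ha.neg hA
  have e : lyapSet A (α * (a / α)) = lyapSet A (β * (a / α)) :=
    h.injective.image_injective ((h1 _).trans (h2 _).symm)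
  have m : x ∈ lyapSet A (α * (a / α)) := by
    rw [ha.mem_lyapSet, mul_div_cancel₀ _ hα.ne']
  rw [e, ha.mem_lyapSet, ← mul_div_assoc, le_div_iff₀ hα] at m
  nlinarith

end Final

/-- **Lemma 6.7**: if the stable flows `Φ`, `Ψ` are `h`-related with `h ∈ 𝓗_{1⁻}`, then
there is a unique `α > 0` such that (a) `Λ^Φ = α Λ^Ψ`, (b) `h (L^Φ(αs)) = L^Ψ(s)` for all
`s`, and (c) `τ_x(t)/t → α` as `t → ∞` for every `x ≠ 0`. -/
theorem stable_allHolder_lyapunov_rigidity {d : ℕ} (hd : 0 < d)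
    (A B : Matrix (Fin d) (Fin d) ℝ) (hA : IsStable A) (hB : IsStable B)
    (h : Euc d ≃ₜ Euc d) (hmem : MemH1minus h) (hrel : IsOrbitEquiv A B h) :
    ∃! α : ℝ, 0 < α ∧
      ((∀ j : ℕ, j < d → lyapExp A j = α * lyapExp B j) ∧
        (∀ s : ℝ, ⇑h '' lyapSet A (α * s) = lyapSet B s) ∧
        (∀ x : Euc d, x ≠ 0 → ∀ τ : ℝ → ℝ, Continuous τ → Function.Bijective τ →
          τ 0 = 0 → (∀ t : ℝ, h (linFlow A t x) = linFlow B (τ t) (h x)) →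
          Filter.Tendsto (fun t => τ t / t) Filter.atTop (𝓝 α))) := by
  obtain ⟨b, hb⟩ := isTop_exists hd A
  obtain ⟨b', hb'⟩ := isTop_exists hd B
  have hα : 0 < b / b' := div_pos_of_neg_of_neg (hb.neg hA) (hb'.neg hB)
  have hbb := image_lyapSet hA hB hmem hrel hb hb'
  refine ⟨b / b', ⟨hα, ?_, hbb, ?_⟩, ?_⟩
  · intro j _
    exact lyapExp_relation hα (fun s => ell_relation hmem (hbb s)) j
  · intro x hx τ _ _ _ hτ
    obtain ⟨a, ha⟩ := hasExp_exists A hx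
    obtain ⟨a', ha'⟩ := hasExp_exists B (x := h x) (by
      intro h0
      apply hx
      rw [← h_zero hmem] at h0
      exact h.injective h0)
    have e := exp_relation hA hB hmem hrel ha ha' hb hb'
    have := tau_limit hA hB hmem ha ha' hb' hτ
    rwa [e, mul_div_cancel_right₀ _ (ha'.neg hB).ne] at this
  · rintro β ⟨hβ, -, hβb, -⟩
    exact le_antisymm (alpha_le hA hd hα hbb hβb) (alpha_le hA hd hβ hβb hbb)

end LF
end
end
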